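/- arXiv:1403.3607 — 7 statements merged into one kernel-verified Lean document; each statement's English description precedes it below -/
import Mathlib

section
/- (Davenport–Hasse relation) Let m be a positive integer with q ≡ 1 (mod m) and p ∤ m. Then for every multiplicative character ρ of F_q, one has ∏_{χ : χ^m = ε} G(χρ) = −G(ρ^m) · ρ(m^{−m}) · ∏_{χ : χ^m = ε} G(χ), where both products run over all multiplicative characters χ of F_q satisfying χ^m = ε, and m^{−m} denotes the inverse in F_q^× of the image of m^m. -/
namespace DavenportHasse
open Polynomial

section PowerSums
variable {F : Type*} [Field F]

/-- For a monic polynomial, the sum of the `k`-th powers of its roots (with multiplicity), read off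
from the logarithmic derivative of the reversed polynomial. -/
noncomputable def rootPowerSum (k : ℕ) (f : F[X]) : F :=
  -PowerSeries.coeff k (PowerSeries.X * PowerSeries.derivative F (f.reverse : PowerSeries F) *
    (f.reverse : PowerSeries F)⁻¹)

lemma constantCoeff_reverse {f : F[X]} (hf : f.Monic) :
    PowerSeries.constantCoeff (f.reverse : PowerSeries F) = 1 := by
  rw [← PowerSeries.coeff_zero_eq_constantCoeff_apply, Polynomial.coeff_coe, coeff_zero_reverse, hf]

lemma rootPowerSum_one (k : ℕ) : rootPowerSum k (1 : F[X]) = 0 := by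
  have : (1 : F[X]).reverse = 1 := by rw [← C_1, reverse_C]
  simp [rootPowerSum, this]

lemma rootPowerSum_mul (k : ℕ) {f g : F[X]} (hf : f.Monic) (hg : g.Monic) :
    rootPowerSum k (f * g) = rootPowerSum k f + rootPowerSum k g := by
  have h1 := constantCoeff_reverse hf
  have h2 := constantCoeff_reverse hg
  rw [rootPowerSum, rootPowerSum, rootPowerSum, ← neg_add, ← map_add, reverse_mul_of_domain,
    Polynomial.coe_mul, PowerSeries.mul_inv_rev, Derivation.leibniz]
  set u := (f.reverse : PowerSeries F)
  set v := (g.reverse : PowerSeries F)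
  have hu : u * u⁻¹ = 1 := PowerSeries.mul_inv_cancel _ (by simp [h1])
  have hv : v * v⁻¹ = 1 := PowerSeries.mul_inv_cancel _ (by simp [h2])
  congr 2
  simp only [smul_eq_mul]
  linear_combination (PowerSeries.X * PowerSeries.derivative F v * v⁻¹) * hu +
    (PowerSeries.X * PowerSeries.derivative F u * u⁻¹) * hv

lemma rootPowerSum_X_sub_C {k : ℕ} (hk : 0 < k) (a : F) : rootPowerSum k (X - C a) = a ^ k := by
  have hr : ((X - C a : F[X]).reverse : PowerSeries F) = 1 - PowerSeries.C a * PowerSeries.X := by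
    ext n
    rw [Polynomial.coeff_coe, coeff_reverse, natDegree_X_sub_C]
    rcases n with - | - | n
    · simp [revAt_le]
    · simp [revAt_le]
    · rw [revAt_eq_self_of_lt (by omega)]
      simp [coeff_X, PowerSeries.coeff_one]
  obtain ⟨j, rfl⟩ : ∃ j, k = j + 1 := ⟨k - 1, by omega⟩
  have hinv : (1 - PowerSeries.C a * PowerSeries.X : PowerSeries F)⁻¹ =
      PowerSeries.mk fun n ↦ a ^ n := by
    rw [PowerSeries.inv_eq_iff_mul_eq_one (by simp)]
    ext n
    rw [mul_sub, mul_one, mul_left_comm, map_sub, PowerSeries.coeff_C_mul]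
    rcases n with - | n
    · simp
    · simp [PowerSeries.coeff_succ_mul_X, PowerSeries.coeff_one, pow_succ']
  rw [rootPowerSum, hr, hinv, mul_assoc, PowerSeries.coeff_succ_X_mul]
  simp [Derivation.leibniz, pow_succ']

lemma rootPowerSum_map {K : Type*} [Field K] (φ : F →+* K) (k : ℕ) {f : F[X]} (hf : f.Monic) :
    rootPowerSum k (f.map φ) = φ (rootPowerSum k f) := by
  have h1 := constantCoeff_reverse hf
  have hrev : ((f.map φ).reverse : PowerSeries K) =
      PowerSeries.map φ (f.reverse : PowerSeries F) := by
    ext n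
    simp [coeff_reverse]
  have hder (u : PowerSeries F) : PowerSeries.derivative K (PowerSeries.map φ u) =
      PowerSeries.map φ (PowerSeries.derivative F u) := by
    ext n
    simp [PowerSeries.coeff_derivative]
  have hinv : (PowerSeries.map φ (f.reverse : PowerSeries F))⁻¹ =
      PowerSeries.map φ (f.reverse : PowerSeries F)⁻¹ := by
    rw [PowerSeries.inv_eq_iff_mul_eq_one
        (by simp [← PowerSeries.coeff_zero_eq_constantCoeff_apply, hf.leadingCoeff]),
      ← map_mul, PowerSeries.inv_mul_cancel _ (by simp [h1]), map_one]
  rw [rootPowerSum, rootPowerSum, hrev, hder, hinv, ← PowerSeries.map_X φ, ← map_mul, ← map_mul,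
    PowerSeries.coeff_map, map_neg]

lemma rootPowerSum_multiset_prod {k : ℕ} (hk : 0 < k) (s : Multiset F) :
    rootPowerSum k (s.map fun a ↦ X - C a).prod = (s.map (· ^ k)).sum := by
  induction s using Multiset.induction with
  | empty => simp [rootPowerSum_one]
  | cons a s ih =>
    rw [Multiset.map_cons, Multiset.prod_cons, rootPowerSum_mul k (monic_X_sub_C a)
      (monic_multiset_prod_of_monic _ _ fun a _ ↦ monic_X_sub_C a), ih, rootPowerSum_X_sub_C hk]
    simp

/-- Changing the constant coefficient `c` of a monic polynomial of degree `d` changes the `d`-th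
power sum by `-d * c`. -/
lemma rootPowerSum_add_C {d : ℕ} (hd : 0 < d) {f : F[X]} (hf : f.Monic) (hfd : f.natDegree = d)
    (c : F) : rootPowerSum d (f + C c) = rootPowerSum d f - d * c := by
  have hg : (f + C c).Monic := hf.add_of_left <| degree_C_le.trans_lt <| by
    rw [degree_eq_natDegree hf.ne_zero, hfd]; exact_mod_cast hd
  have h1 := constantCoeff_reverse hf
  have h2 := constantCoeff_reverse hg
  have hr : ((f + C c).reverse : PowerSeries F) =
      (f.reverse : PowerSeries F) + PowerSeries.C c * PowerSeries.X ^ d := by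
    ext n
    rw [map_add, PowerSeries.coeff_C_mul, PowerSeries.coeff_X_pow, Polynomial.coeff_coe,
      Polynomial.coeff_coe, coeff_reverse, coeff_reverse, natDegree_add_C, hfd, coeff_add, coeff_C]
    congr 1
    have : revAt d n = 0 ↔ n = d := by
      rcases le_or_gt n d with h | h
      · rw [revAt_le h]; omega
      · rw [revAt_eq_self_of_lt h]; omega
    simp [this]
  have hX : (PowerSeries.X : PowerSeries F) * PowerSeries.X ^ (d - 1) = PowerSeries.X ^ d := by
    rw [← pow_succ', Nat.sub_add_cancel hd]
  have hder : PowerSeries.X * PowerSeries.derivative F ((f + C c).reverse : PowerSeries F) =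
      PowerSeries.X * PowerSeries.derivative F (f.reverse : PowerSeries F) +
        (d : PowerSeries F) * PowerSeries.C c * PowerSeries.X ^ d := by
    rw [hr, map_add, Derivation.leibniz, Derivation.leibniz_pow]
    simp only [PowerSeries.derivative_C, PowerSeries.derivative_X, smul_eq_mul, nsmul_eq_mul,
      mul_zero, add_zero, mul_one, mul_add]
    rw [← hX]
    ring
  set u := (f.reverse : PowerSeries F)
  set v := ((f + C c).reverse : PowerSeries F) with hv_def
  have hu : u * u⁻¹ = 1 := PowerSeries.mul_inv_cancel _ (by simp [h1])
  have hv : v * v⁻¹ = 1 := PowerSeries.mul_inv_cancel _ (by simp [h2])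
  have key : PowerSeries.X * PowerSeries.derivative F v * v⁻¹ =
      PowerSeries.X * PowerSeries.derivative F u * u⁻¹ +
        ((d : PowerSeries F) * PowerSeries.C c - PowerSeries.C c *
          (PowerSeries.X * PowerSeries.derivative F u) * u⁻¹) * v⁻¹ * PowerSeries.X ^ d := by
    rw [hder]
    linear_combination
      (-(PowerSeries.X * PowerSeries.derivative F u * u⁻¹ * v⁻¹)) * hr +
        (PowerSeries.X * PowerSeries.derivative F u * u⁻¹) * hv -
        (PowerSeries.X * PowerSeries.derivative F u * v⁻¹) * hu
  have hcoeff := PowerSeries.coeff_mul_X_pow (((d : PowerSeries F) * PowerSeries.C c -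
    PowerSeries.C c * (PowerSeries.X * PowerSeries.derivative F u) * u⁻¹) * v⁻¹) d 0
  rw [zero_add] at hcoeff
  unfold rootPowerSum
  rw [key, map_add, hcoeff]
  simp [h2]
  ring

/-- The first power sum is minus the subleading coefficient. -/
lemma rootPowerSum_one_left {d : ℕ} {f : F[X]} (hf : f.Monic) (hfd : f.natDegree = d + 1) :
    rootPowerSum 1 f = -f.coeff d := by
  have h1 := constantCoeff_reverse hf
  have h2 : PowerSeries.constantCoeff (PowerSeries.derivative F (f.reverse : PowerSeries F)) =
      f.coeff d := by
    rw [← PowerSeries.coeff_zero_eq_constantCoeff_apply, PowerSeries.coeff_derivative]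
    simp [nextCoeff, hfd]
  rw [rootPowerSum, mul_assoc, PowerSeries.coeff_succ_X_mul]
  simp [h1, h2]

end PowerSums

section Weight
variable {F : Type*} [Field F]

/-- The multiplicative weight `f ↦ χ(∏ x) ψ(∑ x ^ k)`, where `x` runs over the roots of the monic
polynomial `f`. -/
noncomputable def weight (χ : MulChar F ℂ) (ψ : AddChar F ℂ) (k : ℕ) (f : F[X]) : ℂ :=
  χ ((-1) ^ f.natDegree * f.coeff 0) * ψ (rootPowerSum k f)

lemma weight_one (χ : MulChar F ℂ) (ψ : AddChar F ℂ) (k : ℕ) : weight χ ψ k 1 = 1 := by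
  simp [weight, rootPowerSum_one]

lemma weight_mul (χ : MulChar F ℂ) (ψ : AddChar F ℂ) (k : ℕ) {f g : F[X]} (hf : f.Monic)
    (hg : g.Monic) : weight χ ψ k (f * g) = weight χ ψ k f * weight χ ψ k g := by
  rw [weight, weight, weight, hf.natDegree_mul hg, mul_coeff_zero, rootPowerSum_mul k hf hg,
    AddChar.map_add_eq_mul, pow_add, mul_mul_mul_comm, map_mul]
  ring

variable {E : Type*} [Field E] [Algebra F E] [FiniteDimensional F E]

open IntermediateField Module

lemma trace_pow_eq_rootPowerSum [Algebra.IsSeparable F E] {k : ℕ} (hk : 0 < k) (x : E) :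
    Algebra.trace F E (x ^ k) = finrank F⟮x⟯ E * rootPowerSum k (minpoly F x) := by
  have hx : IsIntegral F x := .of_finite F x
  have hgen : x ^ k = algebraMap F⟮x⟯ E (AdjoinSimple.gen F x ^ k) := by simp
  rw [← Algebra.trace_trace (S := F⟮x⟯), hgen, Algebra.trace_algebraMap, map_nsmul, nsmul_eq_mul]
  congr 1
  set pb := adjoin.powerBasis hx with hpb
  have hgen' : AdjoinSimple.gen F x = pb.gen := (adjoin.powerBasis_gen hx).symm
  have hmin : minpoly F x = minpoly F pb.gen := by
    rw [adjoin.powerBasis_gen, minpoly_gen]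
  let K := AlgebraicClosure F
  have hsplit : ((minpoly F pb.gen).map (algebraMap F K)).Splits := IsAlgClosed.splits _
  apply (algebraMap F K).injective
  rw [trace_eq_sum_embeddings K, hgen', hmin,
    ← rootPowerSum_map _ _ (minpoly.monic pb.isIntegral_gen),
    hsplit.eq_prod_roots_of_monic ((minpoly.monic pb.isIntegral_gen).map _),
    rootPowerSum_multiset_prod hk]
  classical
  have hnodup : ((minpoly F pb.gen).map (algebraMap F K)).roots.Nodup :=
    nodup_roots ((separable_map _).mpr (Algebra.IsSeparable.isSeparable F _))
  rw [Fintype.sum_equiv pb.liftEquiv' _ (fun y ↦ (y : K) ^ k) (fun σ ↦ by simp),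
    Finset.sum_mem_multiset _ _ (fun y ↦ y ^ k) fun _ ↦ rfl, Finset.sum_eq_multiset_sum,
    Multiset.toFinset_val, hnodup.dedup]

lemma norm_eq_minpoly_coeff (x : E) : Algebra.norm F x =
    ((-1) ^ (minpoly F x).natDegree * (minpoly F x).coeff 0) ^ finrank F⟮x⟯ E := by
  have hx : IsIntegral F x := .of_finite F x
  rw [Algebra.norm_eq_norm_adjoin]
  congr 1
  have := Algebra.PowerBasis.norm_gen_eq_coeff_zero_minpoly (adjoin.powerBasis hx)
  rwa [adjoin.powerBasis_gen, minpoly_gen, adjoin.powerBasis_dim] at this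

lemma weight_minpoly_pow [Algebra.IsSeparable F E] (χ : MulChar F ℂ) (ψ : AddChar F ℂ) {k : ℕ}
    (hk : 0 < k) (x : E) :
    weight χ ψ k (minpoly F x) ^ (finrank F E / (minpoly F x).natDegree) =
      χ (Algebra.norm F x) * ψ (Algebra.trace F E (x ^ k)) := by
  have hx : IsIntegral F x := .of_finite F x
  have hdeg : finrank F E / (minpoly F x).natDegree = finrank F⟮x⟯ E := by
    rw [← finrank_mul_finrank F F⟮x⟯ E, adjoin.finrank hx,
      Nat.mul_div_cancel_left _ (minpoly.natDegree_pos hx)]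
  rw [hdeg, trace_pow_eq_rootPowerSum hk, norm_eq_minpoly_coeff, weight, mul_pow, map_pow,
    ← nsmul_eq_mul, AddChar.map_nsmul_eq_pow]

variable [Finite F]

lemma card_minpoly_fiber [Fintype E] [DecidableEq F[X]] {Q : F[X]} (hQ : Irreducible Q)
    (hm : Q.Monic) (hdvd : Q.natDegree ∣ finrank F E) :
    (Finset.univ.filter fun x : E ↦ minpoly F x = Q).card = Q.natDegree := by
  classical
  have hsplit : (Q.map (algebraMap F E)).Splits := by
    have := Fintype.ofFinite F
    have hd := hQ.natDegree_dvd_iff_dvd_X_pow_card_pow_sub_X.mp hdvd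
    rw [← Module.natCard_eq_pow_finrank, Nat.card_eq_fintype_card] at hd
    have hs : ((X ^ Fintype.card E - X : F[X]).map (algebraMap F E)).Splits :=
      IsSplittingField.splits E _
    have h0 : (X ^ Fintype.card E - X : F[X]) ≠ 0 :=
      FiniteField.X_pow_card_sub_X_ne_zero F Fintype.one_lt_card
    exact hs.of_dvd (Polynomial.map_ne_zero h0) (Polynomial.map_dvd (algebraMap F E) hd)
  rw [← card_rootSet_eq_natDegree (PerfectField.separable_of_irreducible hQ) hsplit,
    ← Set.toFinset_card]
  congr 1
  ext x
  simp only [Finset.mem_filter, Finset.mem_univ, true_and, Set.mem_toFinset,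
    mem_rootSet_of_ne hQ.ne_zero]
  constructor
  · rintro rfl
    exact minpoly.aeval _ _
  · intro h
    exact (minpoly.eq_of_irreducible_of_monic hQ h hm).symm

end Weight

lemma map_pow_of_monic {F : Type*} [Field F] {Λ : F[X] → ℂ} (hΛ1 : Λ 1 = 1)
    (hΛ : ∀ f g : F[X], f.Monic → g.Monic → Λ (f * g) = Λ f * Λ g) {Q : F[X]} (hQ : Q.Monic)
    (k : ℕ) : Λ (Q ^ k) = Λ Q ^ k := by
  induction k with
  | zero => simp [hΛ1]
  | succ k ih => rw [pow_succ, hΛ _ _ (hQ.pow k) hQ, ih, pow_succ]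

section EulerProduct
open Finset UniqueFactorizationMonoid Module
variable (F : Type*) [Field F] [Finite F]

lemma finite_monic_natDegree_le (d : ℕ) : {f : F[X] | f.Monic ∧ f.natDegree ≤ d}.Finite := by
  refine Set.Finite.of_finite_image (f := fun f ↦ fun i : Fin (d + 1) ↦ f.coeff i)
    (Set.toFinite _) fun f hf g hg h ↦ ?_
  ext i
  rcases Nat.lt_or_ge i (d + 1) with hi | hi
  · exact congrFun h ⟨i, hi⟩
  · rw [coeff_eq_zero_of_natDegree_lt (by have := hf.2; omega),
      coeff_eq_zero_of_natDegree_lt (by have := hg.2; omega)]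

/-- The monic polynomials of degree `d`. -/
noncomputable def monicPolys (d : ℕ) : Finset F[X] :=
  ((finite_monic_natDegree_le F d).subset
    (t := {f | f.Monic ∧ f.natDegree = d}) fun _ h ↦ ⟨h.1, h.2.le⟩).toFinset

/-- The monic irreducible polynomials of degree at most `d`. -/
noncomputable def monicIrreducibles (d : ℕ) : Finset F[X] :=
  ((finite_monic_natDegree_le F d).subset
    (t := {f | f.Monic ∧ f.natDegree ≤ d ∧ Irreducible f}) fun _ h ↦ ⟨h.1, h.2.1⟩).toFinset

variable {F}

@[simp] lemma mem_monicPolys {d : ℕ} {f : F[X]} :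
    f ∈ monicPolys F d ↔ f.Monic ∧ f.natDegree = d := by
  simp [monicPolys]

@[simp] lemma mem_monicIrreducibles {d : ℕ} {f : F[X]} :
    f ∈ monicIrreducibles F d ↔ f.Monic ∧ f.natDegree ≤ d ∧ Irreducible f := by
  simp [monicIrreducibles]

/-- The `d`-th coefficient of the L-series of `Λ`. -/
noncomputable def coeffSum (Λ : F[X] → ℂ) (d : ℕ) : ℂ := ∑ f ∈ monicPolys F d, Λ f

/-- The `n`-th coefficient of the logarithmic derivative of the L-series of `Λ`. -/
noncomputable def primeSum (Λ : F[X] → ℂ) (n : ℕ) : ℂ :=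
  ∑ Q ∈ monicIrreducibles F n with Q.natDegree ∣ n, Q.natDegree * Λ Q ^ (n / Q.natDegree)

open Classical in
lemma sum_natDegree_of_pow_dvd {d : ℕ} {g : F[X]} (hg : g.Monic) (hd : g.natDegree = d) :
    ∑ Q ∈ monicIrreducibles F d, ∑ k ∈ Icc 1 d, (if Q ^ k ∣ g then Q.natDegree else 0) = d := by
  have hg0 := hg.ne_zero
  have hcount {Q : F[X]} (hQ : Irreducible Q) (hm : Q.Monic) (k : ℕ) :
      Q ^ k ∣ g ↔ k ≤ (normalizedFactors g).count Q := by
    rw [pow_dvd_iff_le_emultiplicity, emultiplicity_eq_count_normalizedFactors hQ hg0,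
      hm.normalize_eq_self, Nat.cast_le]
  have hmem {Q : F[X]} (hQ : Q ∈ normalizedFactors g) : Q.Monic ∧ Irreducible Q :=
    ⟨by simpa [normalize_normalized_factor Q hQ] using
      monic_normalize (irreducible_of_normalized_factor Q hQ).ne_zero,
      irreducible_of_normalized_factor Q hQ⟩
  have hdeg : ((normalizedFactors g).map natDegree).sum = d := by
    rw [← natDegree_multiset_prod _ (zero_notMem_normalizedFactors g), ← hd]
    exact natDegree_eq_of_degree_eq (degree_eq_degree_of_associated (prod_normalizedFactors hg0))
  rw [Finset.sum_multiset_map_count] at hdeg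
  refine Eq.trans ?_ hdeg
  symm
  rw [Finset.sum_subset (s₂ := monicIrreducibles F d)]
  · refine sum_congr rfl fun Q hQ ↦ ?_
    rw [mem_monicIrreducibles] at hQ
    obtain ⟨hm, -, hirr⟩ := hQ
    have hle : (normalizedFactors g).count Q ≤ d := by
      have h := natDegree_le_of_dvd ((hcount hirr hm _).mpr le_rfl) hg0
      rw [natDegree_pow, hd] at h
      exact (Nat.le_mul_of_pos_right _ hirr.natDegree_pos).trans h
    rw [← sum_filter, sum_const]
    congr 1
    rw [filter_congr (q := fun k ↦ k ≤ (normalizedFactors g).count Q)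
      fun k _ ↦ hcount hirr hm k]
    have : (Icc 1 d).filter (fun k ↦ k ≤ (normalizedFactors g).count Q) =
        Icc 1 ((normalizedFactors g).count Q) := by
      ext k; simp only [mem_filter, mem_Icc]; omega
    rw [this, Nat.card_Icc, Nat.add_sub_cancel]
  · intro Q hQ
    rw [Multiset.mem_toFinset] at hQ
    rw [mem_monicIrreducibles]
    exact ⟨(hmem hQ).1, hd ▸ natDegree_le_of_dvd (dvd_of_mem_normalizedFactors hQ) hg0,
      (hmem hQ).2⟩
  · intro Q _ hQ
    rw [Multiset.mem_toFinset] at hQ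
    simp [Multiset.count_eq_zero_of_notMem hQ]

variable {Λ : F[X] → ℂ}

open Classical in
lemma sum_pow_dvd (hΛ1 : Λ 1 = 1)
    (hΛ : ∀ f g : F[X], f.Monic → g.Monic → Λ (f * g) = Λ f * Λ g) {Q : F[X]} (hQ : Q.Monic)
    (d k : ℕ) :
    ∑ g ∈ monicPolys F d with Q ^ k ∣ g, Λ g =
      if k * Q.natDegree ≤ d then Λ Q ^ k * coeffSum Λ (d - k * Q.natDegree) else 0 := by
  have hQk := hQ.pow k
  split_ifs with h
  · rw [coeffSum, mul_sum]
    symm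
    refine sum_bij (fun h _ ↦ Q ^ k * h) ?_ ?_ ?_ ?_
    · intro f hf
      rw [mem_monicPolys] at hf
      rw [mem_filter, mem_monicPolys, hQk.natDegree_mul hf.1, natDegree_pow, hf.2]
      exact ⟨⟨hQk.mul hf.1, by omega⟩, dvd_mul_right _ _⟩
    · intro a _ b _ hab
      exact mul_left_cancel₀ hQk.ne_zero hab
    · intro g hg
      rw [mem_filter, mem_monicPolys] at hg
      obtain ⟨⟨hgm, hgd⟩, f, rfl⟩ := hg
      have hf := hQk.of_mul_monic_left hgm
      rw [hQk.natDegree_mul hf, natDegree_pow] at hgd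
      exact ⟨f, mem_monicPolys.mpr ⟨hf, by omega⟩, rfl⟩
    · intro f hf
      rw [mem_monicPolys] at hf
      rw [hΛ _ _ hQk hf.1, map_pow_of_monic hΛ1 hΛ hQ]
  · rw [filter_eq_empty_iff.mpr, sum_empty]
    intro g hg hdvd
    rw [mem_monicPolys] at hg
    have := natDegree_le_of_dvd hdvd hg.1.ne_zero
    rw [natDegree_pow, hg.2] at this
    exact h this

lemma natCast_mul_coeffSum (hΛ1 : Λ 1 = 1)
    (hΛ : ∀ f g : F[X], f.Monic → g.Monic → Λ (f * g) = Λ f * Λ g) (d : ℕ) :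
    d * coeffSum Λ d = ∑ n ∈ Icc 1 d, primeSum Λ n * coeffSum Λ (d - n) := by
  classical
  have hprime {n : ℕ} (hn : n ∈ Icc 1 d) : primeSum Λ n = ∑ Q ∈ monicIrreducibles F d,
      ∑ k ∈ Icc 1 d, if n = k * Q.natDegree then Q.natDegree * Λ Q ^ k else 0 := by
    rw [mem_Icc] at hn
    have hfilter : (monicIrreducibles F n).filter (fun Q ↦ Q.natDegree ∣ n) =
        (monicIrreducibles F d).filter (fun Q ↦ Q.natDegree ∣ n) := by
      ext Q
      simp only [mem_filter, mem_monicIrreducibles]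
      constructor
      · rintro ⟨⟨h1, h2, h3⟩, h4⟩
        exact ⟨⟨h1, h2.trans hn.2, h3⟩, h4⟩
      · rintro ⟨⟨h1, h2, h3⟩, h4⟩
        exact ⟨⟨h1, Nat.le_of_dvd hn.1 h4, h3⟩, h4⟩
    rw [primeSum, hfilter, sum_filter]
    refine sum_congr rfl fun Q hQ ↦ ?_
    have hpos := (mem_monicIrreducibles.mp hQ).2.2.natDegree_pos
    split_ifs with h
    · obtain ⟨k, rfl⟩ := h
      have hk0 : 0 < k := Nat.pos_of_mul_pos_left hn.1
      rw [Nat.mul_div_cancel_left _ hpos, sum_eq_single k]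
      · rw [if_pos (mul_comm _ _)]
      · intro j _ hj
        rw [if_neg]
        rw [mul_comm]
        exact fun h ↦ hj (Nat.eq_of_mul_eq_mul_right hpos h).symm
      · intro hk
        exact absurd (mem_Icc.mpr ⟨hk0, (Nat.le_mul_of_pos_left _ hpos).trans hn.2⟩) hk
    · symm
      exact sum_eq_zero fun k _ ↦ if_neg fun hk ↦ h ⟨k, by rw [hk, mul_comm]⟩
  calc d * coeffSum Λ d
      = ∑ g ∈ monicPolys F d, ∑ Q ∈ monicIrreducibles F d, ∑ k ∈ Icc 1 d,
          (if Q ^ k ∣ g then Q.natDegree * Λ g else 0) := by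
        rw [coeffSum, mul_sum]
        refine sum_congr rfl fun g hg ↦ ?_
        rw [mem_monicPolys] at hg
        have h := congrArg (Nat.cast (R := ℂ)) (sum_natDegree_of_pow_dvd hg.1 hg.2)
        push_cast at h
        rw [← h, sum_mul]
        refine sum_congr rfl fun Q _ ↦ ?_
        rw [sum_mul]
        exact sum_congr rfl fun k _ ↦ by split_ifs <;> simp
    _ = ∑ Q ∈ monicIrreducibles F d, ∑ k ∈ Icc 1 d, Q.natDegree *
          ∑ g ∈ monicPolys F d with Q ^ k ∣ g, Λ g := by
        rw [sum_comm]
        refine sum_congr rfl fun Q _ ↦ ?_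
        rw [sum_comm]
        refine sum_congr rfl fun k _ ↦ ?_
        rw [sum_filter, mul_sum]
        exact sum_congr rfl fun g _ ↦ by split_ifs <;> simp
    _ = ∑ Q ∈ monicIrreducibles F d, ∑ k ∈ Icc 1 d, ∑ n ∈ Icc 1 d,
          (if n = k * Q.natDegree then Q.natDegree * Λ Q ^ k else 0) * coeffSum Λ (d - n) := by
        refine sum_congr rfl fun Q hQ ↦ sum_congr rfl fun k hk ↦ ?_
        have hQ' := mem_monicIrreducibles.mp hQ
        have hpos : 0 < k * Q.natDegree := Nat.mul_pos (mem_Icc.mp hk).1 hQ'.2.2.natDegree_pos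
        rw [sum_pow_dvd hΛ1 hΛ hQ'.1]
        simp only [ite_mul, zero_mul, sum_ite_eq', mem_Icc]
        by_cases h : k * Q.natDegree ≤ d
        · rw [if_pos h, if_pos ⟨hpos, h⟩, mul_assoc]
        · rw [if_neg h, if_neg fun h' ↦ h h'.2, mul_zero]
    _ = ∑ n ∈ Icc 1 d, primeSum Λ n * coeffSum Λ (d - n) := by
        rw [sum_congr rfl fun Q _ ↦ sum_comm, sum_comm]
        refine sum_congr rfl fun n hn ↦ ?_
        simp_rw [hprime hn, sum_mul]

lemma primeSum_eq_sum_minpoly {E : Type*} [Field E] [Fintype E] [Algebra F E] {n : ℕ}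
    (hE : finrank F E = n) (Λ : F[X] → ℂ) :
    primeSum Λ n = ∑ x : E, Λ (minpoly F x) ^ (n / (minpoly F x).natDegree) := by
  classical
  subst hE
  have hint (x : E) : IsIntegral F x := .of_finite F x
  rw [primeSum, ← sum_fiberwise_of_maps_to (g := fun x : E ↦ minpoly F x)
    (t := {Q ∈ monicIrreducibles F (finrank F E) | Q.natDegree ∣ finrank F E})]
  · refine sum_congr rfl fun Q hQ ↦ ?_
    rw [mem_filter, mem_monicIrreducibles] at hQ
    rw [sum_congr rfl (g := fun _ ↦ Λ Q ^ (finrank F E / Q.natDegree)) fun x hx ↦ by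
      rw [(mem_filter.mp hx).2], sum_const, card_minpoly_fiber hQ.1.2.2 hQ.1.1 hQ.2, nsmul_eq_mul]
  · intro x _
    rw [mem_filter, mem_monicIrreducibles]
    exact ⟨⟨minpoly.monic (hint x), minpoly.natDegree_le x, minpoly.irreducible (hint x)⟩,
      minpoly.degree_dvd (hint x)⟩

end EulerProduct

section CharacterCount
open Finset Module
variable {F : Type*} [Field F] [Fintype F]

/-- The multiplicative characters of exponent dividing `m`. -/
noncomputable def charsOfExponent (F : Type*) [Field F] [Fintype F] (m : ℕ) :
    Finset (MulChar F ℂ) :=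
  (Set.toFinite {χ : MulChar F ℂ | χ ^ m = 1}).toFinset

@[simp] lemma mem_charsOfExponent {m : ℕ} {χ : MulChar F ℂ} :
    χ ∈ charsOfExponent F m ↔ χ ^ m = 1 := by
  simp [charsOfExponent]

lemma card_pow_eq_one_of_isCyclic {G : Type*} [CommGroup G] [IsCyclic G] [Finite G] {m : ℕ}
    (hm : m ∣ Nat.card G) : Nat.card {g : G // g ^ m = 1} = m := by
  have h := IsCyclic.card_powMonoidHom_ker (G := G) m
  rw [Nat.gcd_eq_right hm] at h
  exact h

lemma card_charsOfExponent {m : ℕ} (hm : m ∣ Fintype.card F - 1) :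
    (charsOfExponent F m).card = m := by
  classical
  obtain ⟨e⟩ := MulChar.mulEquiv_units F ℂ
  have : IsCyclic (MulChar F ℂ) := isCyclic_of_surjective e.symm e.symm.surjective
  have hcard : Nat.card (MulChar F ℂ) = Fintype.card F - 1 := by
    rw [Nat.card_congr e.toEquiv, Nat.card_eq_fintype_card, Fintype.card_units]
  rw [charsOfExponent, ← Set.ncard_eq_toFinset_card]
  exact card_pow_eq_one_of_isCyclic (hcard ▸ hm)

lemma sum_charsOfExponent_eq_zero {m : ℕ} {a : F} {χ₀ : MulChar F ℂ} (h₀ : χ₀ ^ m = 1)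
    (ha : χ₀ a ≠ 1) : ∑ χ ∈ charsOfExponent F m, χ a = 0 := by
  have h : ∑ χ ∈ charsOfExponent F m, χ a = χ₀ a * ∑ χ ∈ charsOfExponent F m, χ a := by
    rw [mul_sum]
    refine (sum_equiv (Equiv.mulLeft χ₀) (fun χ ↦ ?_) fun χ _ ↦ ?_).symm
    · simp [mul_pow, h₀]
    · simp
  have h' : (χ₀ a - 1) * ∑ χ ∈ charsOfExponent F m, χ a = 0 := by linear_combination -h
  exact (mul_eq_zero.mp h').resolve_left (sub_ne_zero.mpr ha)

variable {E : Type*} [Field E] [Fintype E] [Algebra F E]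

lemma exists_pow_eq_of_forall_norm {m : ℕ} (hm0 : 0 < m) (hm : m ∣ Fintype.card F - 1) (z : Eˣ)
    (hz : ∀ χ : MulChar F ℂ, χ ^ m = 1 → χ (Algebra.norm F (z : E)) = 1) :
    ∃ y : Eˣ, y ^ m = z := by
  classical
  obtain ⟨χ, hχ⟩ := MulChar.exists_mulChar_orderOf F hm (Complex.isPrimitiveRoot_exp m hm0.ne')
  obtain ⟨g, hg⟩ := IsCyclic.exists_generator (α := Eˣ)
  obtain ⟨k, hk⟩ := mem_powers_iff_mem_zpowers.mpr (hg z)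
  dsimp only at hk
  have hgen (u : Fˣ) : u ∈ Subgroup.zpowers (Units.map (Algebra.norm F (S := E)) g) := by
    obtain ⟨v, rfl⟩ := FiniteField.unitsMap_norm_surjective F E u
    obtain ⟨j, rfl⟩ := hg v
    exact ⟨j, by simp⟩
  have h1 := hz χ (hχ ▸ pow_orderOf_eq_one χ)
  have hχk : χ ^ k = 1 := by
    rw [MulChar.eq_iff hgen, MulChar.one_apply_coe]
    rw [← hk, Units.val_pow_eq_pow_val, map_pow, map_pow] at h1
    rcases k.eq_zero_or_pos with rfl | hk0
    · rw [pow_zero]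
      exact MulChar.one_apply_coe _
    · rw [MulChar.pow_apply' _ hk0.ne']
      simpa using h1
  obtain ⟨j, rfl⟩ := hχ ▸ orderOf_dvd_of_pow_eq_one hχk
  exact ⟨g ^ j, by rw [← hk, ← pow_mul, mul_comm]⟩

lemma card_pow_eq [DecidableEq E] {m : ℕ} (hm0 : 0 < m) (hm : m ∣ Fintype.card F - 1) {z : E}
    (hz : z ≠ 0) : ((univ.filter fun x : E ↦ x ^ m = z).card : ℂ) =
      ∑ χ ∈ charsOfExponent F m, χ (Algebra.norm F z) := by
  classical
  by_cases hy : ∃ y : E, y ^ m = z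
  · obtain ⟨y, rfl⟩ := hy
    have hy0 : y ≠ 0 := fun h ↦ hz (by rw [h, zero_pow hm0.ne'])
    have hE : m ∣ Nat.card Eˣ := by
      rw [Nat.card_eq_fintype_card, Fintype.card_units, Module.card_eq_pow_finrank (K := F)]
      exact hm.trans (Nat.sub_one_dvd_pow_sub_one _ _)
    have hcard : (univ.filter fun x : E ↦ x ^ m = y ^ m).card = m := by
      have hker := card_pow_eq_one_of_isCyclic hE
      rw [Nat.card_eq_fintype_card, Fintype.card_subtype] at hker
      refine Eq.trans (Eq.symm ?_) hker
      refine card_bij (fun u _ ↦ u * y) ?_ ?_ ?_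
      · intro u hu
        rw [mem_filter] at hu
        have : (u : E) ^ m = 1 := by rw [← Units.val_pow_eq_pow_val, hu.2, Units.val_one]
        simp [mul_pow, this]
      · intro u _ v _ h
        exact Units.ext (mul_right_cancel₀ hy0 h)
      · intro x hx
        have hx' := (mem_filter.mp hx).2
        have hx0 : x ≠ 0 := by
          rintro rfl
          rw [zero_pow hm0.ne'] at hx'
          exact hz hx'.symm
        refine ⟨Units.mk0 x hx0 / Units.mk0 y hy0, ?_, ?_⟩
        · simp only [mem_filter, mem_univ, true_and]
          ext
          simp [div_pow, hx', hz]
        · simp [hy0]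
    have hone : ∀ χ ∈ charsOfExponent F m, χ (Algebra.norm F (y ^ m)) = 1 := by
      intro χ hχ
      have hu : IsUnit (Algebra.norm F y) := (Algebra.norm_ne_zero_iff.mpr hy0).isUnit
      rw [map_pow, map_pow, ← MulChar.pow_apply' _ hm0.ne', mem_charsOfExponent.mp hχ,
        MulChar.one_apply hu]
    rw [hcard, sum_congr rfl hone, sum_const, card_charsOfExponent hm, nsmul_one]
  · have hemp : (univ.filter fun x : E ↦ x ^ m = z) = ∅ :=
      filter_eq_empty_iff.mpr fun x _ hx ↦ hy ⟨x, hx⟩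
    have : ∃ χ₀ : MulChar F ℂ, χ₀ ^ m = 1 ∧ χ₀ (Algebra.norm F z) ≠ 1 := by
      by_contra! h
      obtain ⟨y, hy'⟩ := exists_pow_eq_of_forall_norm hm0 hm (Units.mk0 z hz) h
      exact hy ⟨y, by rw [← Units.val_pow_eq_pow_val, hy', Units.val_mk0]⟩
    obtain ⟨χ₀, h₀, h₁⟩ := this
    rw [hemp, sum_charsOfExponent_eq_zero h₀ h₁, card_empty, Nat.cast_zero]

lemma sum_pow_norm_trace {m : ℕ} (hm0 : 0 < m) (hm : m ∣ Fintype.card F - 1)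
    (ρ : MulChar F ℂ) (ψ : AddChar F ℂ) :
    ∑ x : E, (ρ ^ m) (Algebra.norm F x) * ψ (Algebra.trace F E (x ^ m)) =
      ∑ χ ∈ charsOfExponent F m, ∑ z : E,
        (χ * ρ) (Algebra.norm F z) * ψ (Algebra.trace F E z) := by
  classical
  rw [sum_comm, ← sum_fiberwise_of_maps_to (t := univ) (g := fun x : E ↦ x ^ m)
    fun _ _ ↦ mem_univ _]
  refine sum_congr rfl fun z _ ↦ ?_
  rw [sum_congr rfl (g := fun _ ↦ ρ (Algebra.norm F z) * ψ (Algebra.trace F E z)) fun x hx ↦ by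
    rw [← (mem_filter.mp hx).2, MulChar.pow_apply' _ hm0.ne', ← map_pow, ← map_pow]]
  simp only [MulChar.mul_apply, mul_assoc]
  rw [sum_const, nsmul_eq_mul, ← sum_mul]
  rcases eq_or_ne z 0 with rfl | hz
  · simp [Algebra.norm_zero, MulChar.map_zero]
  · rw [card_pow_eq hm0 hm hz]

lemma primeSum_weight {m n : ℕ} (hm0 : 0 < m) (hm : m ∣ Fintype.card F - 1) (hn : 0 < n)
    (ρ : MulChar F ℂ) (ψ : AddChar F ℂ) :
    primeSum (weight (ρ ^ m) ψ m) n =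
      ∑ χ ∈ charsOfExponent F m, primeSum (weight (χ * ρ) ψ 1) n := by
  obtain ⟨p, hp⟩ := CharP.exists F
  have : Fact p.Prime := ⟨CharP.char_is_prime F p⟩
  have : NeZero n := ⟨hn.ne'⟩
  let E := FiniteField.Extension F p n
  have : Fintype E := Fintype.ofFinite E
  have hE : finrank F E = n := FiniteField.finrank_extension F p n
  have h (χ : MulChar F ℂ) {k : ℕ} (hk : 0 < k) : primeSum (weight χ ψ k) n =
      ∑ x : E, χ (Algebra.norm F x) * ψ (Algebra.trace F E (x ^ k)) := by
    rw [primeSum_eq_sum_minpoly hE]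
    exact sum_congr rfl fun x _ ↦ by rw [← weight_minpoly_pow χ ψ hk x, hE]
  rw [h _ hm0, sum_pow_norm_trace hm0 hm]
  exact sum_congr rfl fun χ _ ↦ by rw [h _ one_pos]; simp only [pow_one]

end CharacterCount

section LSeries
open Finset
variable {F : Type*} [Field F] [Finite F]

lemma coeffSum_zero {Λ : F[X] → ℂ} (hΛ1 : Λ 1 = 1) : coeffSum Λ 0 = 1 := by
  have : monicPolys F 0 = {1} := by
    ext f
    rw [mem_monicPolys, mem_singleton]
    exact ⟨fun h ↦ h.1.natDegree_eq_zero.mp h.2, by rintro rfl; simp⟩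
  rw [coeffSum, this, sum_singleton, hΛ1]

lemma primeSum_zero (Λ : F[X] → ℂ) : primeSum Λ 0 = 0 := by
  rw [primeSum]
  refine sum_eq_zero fun Q hQ ↦ ?_
  have h := mem_monicIrreducibles.mp (mem_filter.mp hQ).1
  exact absurd h.2.2.natDegree_pos (by omega)

lemma X_mul_derivative_mk_coeffSum {Λ : F[X] → ℂ} (hΛ1 : Λ 1 = 1)
    (hΛ : ∀ f g : F[X], f.Monic → g.Monic → Λ (f * g) = Λ f * Λ g) :
    PowerSeries.X * PowerSeries.derivative ℂ (PowerSeries.mk (coeffSum Λ)) =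
      PowerSeries.mk (primeSum Λ) * PowerSeries.mk (coeffSum Λ) := by
  ext d
  have h := natCast_mul_coeffSum hΛ1 hΛ d
  rw [PowerSeries.coeff_mul d (PowerSeries.mk _), Nat.sum_antidiagonal_eq_sum_range_succ_mk,
    sum_range_succ']
  simp only [PowerSeries.coeff_mk, primeSum_zero, zero_mul, add_zero]
  rw [range_eq_Ico, sum_Ico_add' (fun n ↦ primeSum Λ n * coeffSum Λ (d - n)), zero_add,
    show Ico 1 (d + 1) = Icc 1 d from rfl, ← h]
  cases d with
  | zero => simp
  | succ d =>
    rw [PowerSeries.coeff_succ_X_mul]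
    simp [PowerSeries.coeff_derivative, mul_comm]

lemma X_mul_derivative_prod {ι : Type*} (s : Finset ι) {u S : ι → PowerSeries ℂ}
    (h : ∀ i ∈ s, PowerSeries.X * PowerSeries.derivative ℂ (u i) = S i * u i) :
    PowerSeries.X * PowerSeries.derivative ℂ (∏ i ∈ s, u i) = (∑ i ∈ s, S i) * ∏ i ∈ s, u i := by
  classical
  induction s using Finset.induction_on with
  | empty => simp
  | insert a s ha ih =>
    rw [prod_insert ha, sum_insert ha, Derivation.leibniz, smul_eq_mul, smul_eq_mul]
    linear_combination (u a) * ih (fun i hi ↦ h i (mem_insert_of_mem hi)) +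
      (∏ i ∈ s, u i) * h a (mem_insert_self a s)

lemma eq_of_X_mul_derivative {u v S : PowerSeries ℂ} (hu : PowerSeries.constantCoeff u = 1)
    (hv : PowerSeries.constantCoeff v = 1)
    (hu' : PowerSeries.X * PowerSeries.derivative ℂ u = S * u)
    (hv' : PowerSeries.X * PowerSeries.derivative ℂ v = S * v) : u = v := by
  have hd : PowerSeries.derivative ℂ u * v = u * PowerSeries.derivative ℂ v := by
    apply mul_left_cancel₀ (PowerSeries.X_ne_zero (R := ℂ))
    linear_combination v * hu' - u * hv'
  have hvv : v * v⁻¹ = 1 := PowerSeries.mul_inv_cancel v (by rw [hv]; exact one_ne_zero)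
  have h : u * v⁻¹ = 1 := by
    refine PowerSeries.derivative.ext ?_ (by simp [hu, hv])
    rw [Derivation.leibniz, PowerSeries.derivative_inv', Derivation.map_one_eq_zero, smul_eq_mul,
      smul_eq_mul]
    linear_combination v⁻¹ ^ 2 * hd - v⁻¹ * PowerSeries.derivative ℂ u * hvv
  linear_combination v * h - u * hvv

lemma coeff_card_prod_one_add {ι : Type*} (s : Finset ι) (a : ι → ℂ) :
    PowerSeries.coeff s.card (∏ i ∈ s, (1 + PowerSeries.C (a i) * PowerSeries.X)) =
      ∏ i ∈ s, a i := by
  classical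
  rw [prod_one_add, map_sum, sum_eq_single s]
  · rw [prod_mul_distrib, prod_const, ← map_prod, PowerSeries.coeff_C_mul_X_pow, if_pos rfl]
  · intro t ht hts
    rw [prod_mul_distrib, prod_const, ← map_prod, PowerSeries.coeff_C_mul_X_pow, if_neg]
    intro h
    exact hts (eq_of_subset_of_card_le (mem_powerset.mp ht) h.le)
  · intro h
    exact absurd (mem_powerset_self s) h

lemma coeffSum_weight_eq_zero (χ : MulChar F ℂ) {ψ : AddChar F ℂ} (hψ : ψ ≠ 1) {d : ℕ}
    (hd : 2 ≤ d) : coeffSum (weight χ ψ 1) d = 0 := by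
  obtain ⟨b, hb⟩ := (AddChar.ne_one_iff).mp hψ
  obtain ⟨e, rfl⟩ : ∃ e, d = e + 2 := ⟨d - 2, by omega⟩
  let s (b : F) : F[X] := C (-b) * X ^ (e + 1)
  have hs (b : F) {f : F[X]} (hf : f ∈ monicPolys F (e + 2)) : f + s b ∈ monicPolys F (e + 2) := by
    rw [mem_monicPolys] at hf ⊢
    have hlt : (s b).degree < f.degree := by
      rw [degree_eq_natDegree hf.1.ne_zero, hf.2]
      refine (degree_C_mul_X_pow_le _ _).trans_lt ?_
      exact_mod_cast Nat.lt_succ_self _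
    exact ⟨hf.1.add_of_left hlt, by rw [natDegree_add_eq_left_of_degree_lt hlt, hf.2]⟩
  have h : coeffSum (weight χ ψ 1) (e + 2) = ψ b * coeffSum (weight χ ψ 1) (e + 2) := by
    rw [coeffSum, mul_sum]
    symm
    refine sum_bij' (fun f _ ↦ f + s b) (fun f _ ↦ f + s (-b)) (fun f hf ↦ hs b hf)
      (fun f hf ↦ hs (-b) hf) ?_ ?_ ?_
    · intro f _
      simp [s]
    · intro f _
      simp [s]
    · intro f hf
      have hf' := mem_monicPolys.mp hf
      have hg' := mem_monicPolys.mp (hs b hf)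
      rw [weight, weight, hf'.2, hg'.2, rootPowerSum_one_left hf'.1 hf'.2,
        rootPowerSum_one_left hg'.1 hg'.2, mul_left_comm, ← AddChar.map_add_eq_mul]
      simp [s, add_comm]
  have h' : (ψ b - 1) * coeffSum (weight χ ψ 1) (e + 2) = 0 := by linear_combination -h
  exact (mul_eq_zero.mp h').resolve_left (sub_ne_zero.mpr hb)

end LSeries

section GaussSum
open Finset
variable {F : Type*} [Field F] [Fintype F]

open Classical in
lemma sum_monicPolys {d : ℕ} (hd : 0 < d) (Φ : F[X] → ℂ) :
    ∑ f ∈ monicPolys F d, Φ f =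
      ∑ h ∈ monicPolys F d with h.coeff 0 = 0, ∑ a : F, Φ (h + C a) := by
  have hmem {f : F[X]} (hf : f ∈ monicPolys F d) (a : F) : f + C a ∈ monicPolys F d := by
    rw [mem_monicPolys] at hf ⊢
    have hlt : (C a).degree < f.degree :=
      degree_C_le.trans_lt (by rw [← natDegree_pos_iff_degree_pos, hf.2]; exact hd)
    exact ⟨hf.1.add_of_left hlt, by rw [natDegree_add_C, hf.2]⟩
  rw [← sum_product']
  symm
  refine sum_bij' (fun x _ ↦ x.1 + C x.2) (fun f _ ↦ (f + C (-f.coeff 0), f.coeff 0))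
    ?_ ?_ ?_ ?_ ?_
  · intro x hx
    exact hmem (mem_filter.mp (mem_product.mp hx).1).1 _
  · intro f hf
    simp [-mem_monicPolys, -map_neg, hmem hf]
  · rintro ⟨h, a⟩ hx
    have h0 := (mem_filter.mp (mem_product.mp hx).1).2
    simp only at h0
    simp [h0]
  · intro f _
    simp
  · intro x _
    rfl

lemma coeffSum_weight_one (χ : MulChar F ℂ) (ψ : AddChar F ℂ) :
    coeffSum (weight χ ψ 1) 1 = gaussSum χ ψ := by
  classical
  have hfilter : (monicPolys F 1).filter (fun h ↦ h.coeff 0 = 0) = {X} := by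
    ext f
    rw [mem_filter, mem_monicPolys, mem_singleton]
    constructor
    · rintro ⟨⟨hf, hd⟩, h0⟩
      rw [hf.eq_X_add_C hd, h0, C_0, add_zero]
    · rintro rfl
      simp [monic_X]
  rw [coeffSum, sum_monicPolys one_pos, hfilter, sum_singleton, gaussSum,
    ← Equiv.sum_comp (Equiv.neg F)]
  refine sum_congr rfl fun a _ ↦ ?_
  have hX : X + C (-a) = X - C a := by rw [map_neg, sub_eq_add_neg]
  rw [Equiv.neg_apply, hX, weight, rootPowerSum_X_sub_C one_pos]
  simp

lemma mk_coeffSum_weight (χ : MulChar F ℂ) {ψ : AddChar F ℂ} (hψ : ψ ≠ 1) :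
    PowerSeries.mk (coeffSum (weight χ ψ 1)) =
      1 + PowerSeries.C (gaussSum χ ψ) * PowerSeries.X := by
  ext d
  match d with
  | 0 => simp [coeffSum_zero (weight_one χ ψ 1)]
  | 1 => simp [coeffSum_weight_one, PowerSeries.coeff_one]
  | d + 2 =>
    rw [PowerSeries.coeff_mk, coeffSum_weight_eq_zero χ hψ (by omega)]
    simp [PowerSeries.coeff_one]

lemma prod_gaussSum {m : ℕ} (hm0 : 0 < m) (hm : m ∣ Fintype.card F - 1) (ρ : MulChar F ℂ)
    {ψ : AddChar F ℂ} (hψ : ψ ≠ 1) :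
    ∏ χ ∈ charsOfExponent F m, gaussSum (χ * ρ) ψ = coeffSum (weight (ρ ^ m) ψ m) m := by
  have hw (χ : MulChar F ℂ) (k : ℕ) := X_mul_derivative_mk_coeffSum (weight_one χ ψ k)
    fun f g hf hg ↦ weight_mul χ ψ k hf hg
  have hS : PowerSeries.mk (primeSum (weight (ρ ^ m) ψ m)) =
      ∑ χ ∈ charsOfExponent F m, PowerSeries.mk (primeSum (weight (χ * ρ) ψ 1)) := by
    ext n
    rw [map_sum]
    simp only [PowerSeries.coeff_mk]
    rcases n.eq_zero_or_pos with rfl | hn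
    · simp [primeSum_zero]
    · exact primeSum_weight hm0 hm hn ρ ψ
  have h := eq_of_X_mul_derivative (S := PowerSeries.mk (primeSum (weight (ρ ^ m) ψ m)))
    (u := PowerSeries.mk (coeffSum (weight (ρ ^ m) ψ m)))
    (v := ∏ χ ∈ charsOfExponent F m, PowerSeries.mk (coeffSum (weight (χ * ρ) ψ 1)))
    (by simp [coeffSum_zero (weight_one _ ψ m)])
    (by
      rw [map_prod]
      exact prod_eq_one fun χ _ ↦ by simp [coeffSum_zero (weight_one _ ψ 1)])
    (hw _ m) (hS ▸ X_mul_derivative_prod _ fun χ _ ↦ hw _ 1)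
  rw [prod_congr rfl fun χ _ ↦ mk_coeffSum_weight _ hψ] at h
  have h' := congrArg (PowerSeries.coeff m) h
  rw [PowerSeries.coeff_mk] at h'
  rw [h', ← coeff_card_prod_one_add, card_charsOfExponent hm]

open Classical in
lemma coeffSum_weight_self {m : ℕ} (hm0 : 0 < m) (hmF : (m : F) ≠ 0) (ρ : MulChar F ℂ)
    (ψ : AddChar F ℂ) : coeffSum (weight (ρ ^ m) ψ m) m =
      (∑ h ∈ monicPolys F m with h.coeff 0 = 0, ψ (rootPowerSum m h)) *
        (ρ (((m : F) ^ m)⁻¹) * gaussSum (ρ ^ m) ψ) := by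
  rw [coeffSum, sum_monicPolys hm0, sum_mul]
  refine sum_congr rfl fun h hh ↦ ?_
  obtain ⟨hh, h0⟩ := mem_filter.mp hh
  obtain ⟨hh, hd⟩ := mem_monicPolys.mp hh
  have hu : -(m : F) ≠ 0 := neg_ne_zero.mpr hmF
  rw [gaussSum, mul_sum, mul_sum]
  refine Fintype.sum_equiv (Equiv.mulLeft₀ _ hu) _ _ fun a ↦ ?_
  rw [weight, natDegree_add_C, hd, rootPowerSum_add_C hm0 hh hd, coeff_add, h0, coeff_C_zero,
    zero_add, show Equiv.mulLeft₀ _ hu a = -(m * a : F) from neg_mul _ _, sub_eq_add_neg,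
    AddChar.map_add_eq_mul,
    MulChar.pow_apply' _ hm0.ne', MulChar.pow_apply' _ hm0.ne', ← map_pow, ← map_pow]
  have hsign : ((-1) ^ m * a) ^ m = ((m : F) ^ m)⁻¹ * (-(m * a)) ^ m := by
    rw [neg_pow (m * a : F), mul_pow, mul_pow, ← pow_mul, mul_left_comm, ← mul_assoc (_⁻¹),
      inv_mul_cancel₀ (pow_ne_zero _ hmF), one_mul]
    congr 1
    rcases m.even_or_odd with he | ho
    · rw [he.neg_one_pow, (he.mul_right m).neg_one_pow]
    · rw [ho.neg_one_pow, (ho.mul ho).neg_one_pow]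
  rw [hsign, map_mul]
  ring

/-- The Davenport–Hasse product relation, as a product over a finite set of characters. -/
theorem prod_gaussSum_mul {m : ℕ} (hm0 : 0 < m) (hm : m ∣ Fintype.card F - 1)
    (hmF : (m : F) ≠ 0) (ρ : MulChar F ℂ) {ψ : AddChar F ℂ} (hψ : ψ ≠ 1) :
    ∏ χ ∈ charsOfExponent F m, gaussSum (χ * ρ) ψ =
      -gaussSum (ρ ^ m) ψ * ρ (((m : F) ^ m)⁻¹) * ∏ χ ∈ charsOfExponent F m, gaussSum χ ψ := by
  have h1 := prod_gaussSum hm0 hm 1 hψ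
  rw [coeffSum_weight_self hm0 hmF, one_pow, gaussSum_one_left hψ, MulChar.one_apply
    (inv_ne_zero (pow_ne_zero m hmF)).isUnit] at h1
  simp only [mul_one] at h1
  rw [prod_gaussSum hm0 hm ρ hψ, coeffSum_weight_self hm0 hmF, h1]
  ring

end GaussSum

end DavenportHasse

/-- Davenport–Hasse relation: for `m ∣ q − 1` (i.e. `q ≡ 1 (mod m)`) with `p ∤ m`, and any
multiplicative character `ρ` of `F_q`,
`∏_{χ^m = ε} G(χρ) = −G(ρ^m) · ρ(m^{−m}) · ∏_{χ^m = ε} G(χ)`. -/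
theorem davenport_hasse_relation
    (p r : ℕ) (hp : p.Prime) (hodd : Odd p) (hr : 0 < r)
    (F : Type) [Field F] [Fintype F] (hcard : Fintype.card F = p ^ r)
    (ψ : AddChar F ℂ) (hψ : ψ ≠ 1)
    (m : ℕ) (hm : 0 < m) (hqm : p ^ r ≡ 1 [MOD m]) (hpm : ¬ p ∣ m)
    (ρ : MulChar F ℂ) :
    (∏ᶠ (χ : MulChar F ℂ) (_ : χ ^ m = 1), gaussSum (χ * ρ) ψ)
      = - gaussSum (ρ ^ m) ψ * ρ (((m : F) ^ m)⁻¹) *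
        ∏ᶠ (χ : MulChar F ℂ) (_ : χ ^ m = 1), gaussSum χ ψ := by
  have hdvd : m ∣ Fintype.card F - 1 :=
    hcard ▸ (Nat.modEq_iff_dvd' (Nat.one_le_pow _ _ hp.pos)).mp hqm.symm
  have hmF : (m : F) ≠ 0 := by
    have hp0 : (p : F) = 0 := by
      have h := FiniteField.cast_card_eq_zero F
      rw [hcard, Nat.cast_pow] at h
      exact pow_eq_zero_iff hr.ne' |>.mp h
    intro h
    have hgcd : ((Nat.gcd p m : ℤ) : F) = 0 := by
      rw [Nat.gcd_eq_gcd_ab]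
      push_cast
      rw [hp0, h, zero_mul, zero_mul, add_zero]
    rw [(hp.coprime_iff_not_dvd).mpr hpm] at hgcd
    simp at hgcd
  have hfin (f : MulChar F ℂ → ℂ) : (∏ᶠ (χ : MulChar F ℂ) (_ : χ ^ m = 1), f χ) =
      ∏ χ ∈ DavenportHasse.charsOfExponent F m, f χ := by
    rw [← finprod_mem_coe_finset]
    simp
  rw [hfin, hfin]
  exact DavenportHasse.prod_gaussSum_mul hm hdvd hmF ρ hψ
end

section
/- Let p > 3 be a prime, r a positive integer, and q = p^r. For every integer l with 1 ≤ l ≤ q−2 and l ≠ (q−1)/2, and every integer i with 0 ≤ i ≤ r−1, the following identity of integers holds: ⌊3lp^i/(q−1)⌋ + 3⌊−lp^i/(q−1)⌋ − 3⌊−2lp^i/(q−1)⌋ − ⌊6lp^i/(q−1)⌋ = −2⌊⟨p^i/2⟩ − lp^i/(q−1)⌋ − ⌊⟨−p^i/6⟩ + lp^i/(q−1)⌋ − ⌊⟨−5p^i/6⟩ + lp^i/(q−1)⌋. -/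
/-- A combination of Hermite's identities for `2x`, `3x` and `6x`. -/
theorem floor_hermite_combination (x : ℚ) (hx : ∀ n : ℤ, 2 * x ≠ n) :
    ⌊3 * x⌋ + 3 * ⌊-x⌋ - 3 * ⌊-(2 * x)⌋ - ⌊6 * x⌋
      = -2 * ⌊1 / 2 - x⌋ - ⌊1 / 6 + x⌋ - ⌊5 / 6 + x⌋ := by
  obtain ⟨n, k, hk0, hk6, h⟩ : ∃ n k : ℤ, 0 ≤ k ∧ k < 6 ∧ ⌊6 * x⌋ = 6 * n + k :=
    ⟨⌊6 * x⌋ / 6, ⌊6 * x⌋ % 6, by omega, by omega, by omega⟩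
  have hl := Int.floor_le (6 * x)
  have hu := Int.lt_floor_add_one (6 * x)
  have hint := lt_or_gt_of_ne (hx (2 * n))
  have hhalf := lt_or_gt_of_ne (hx (2 * n + 1))
  rw [h] at hl hu ⊢
  push_cast at hl hu hint hhalf
  have value : ∀ (y : ℚ) (m : ℤ), (m : ℚ) ≤ y → y < m + 1 → ⌊y⌋ = m :=
    fun y m h₁ h₂ => Int.floor_eq_iff.mpr ⟨h₁, h₂⟩
  have hneg : ⌊-x⌋ = -n - 1 := by
    apply value <;> push_cast <;> interval_cases k <;> push_cast at hl hu <;>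
      rcases hint with hint | hint <;> linarith
  have hthree : ⌊3 * x⌋ = 3 * n + k / 2 := by
    apply value <;> interval_cases k <;> norm_num at hl hu ⊢ <;> linarith
  have hnegtwo : ⌊-(2 * x)⌋ = -2 * n - 1 - k / 3 := by
    apply value <;> interval_cases k <;> norm_num at hl hu ⊢ <;>
      rcases hint with hint | hint <;> rcases hhalf with hhalf | hhalf <;> linarith
  have hhalfsub : ⌊1 / 2 - x⌋ = -n - k / 3 := by
    apply value <;> interval_cases k <;> norm_num at hl hu ⊢ <;>
      rcases hhalf with hhalf | hhalf <;> linarith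
  have hsixth : ⌊1 / 6 + x⌋ = n + (k + 1) / 6 := by
    apply value <;> interval_cases k <;> norm_num at hl hu ⊢ <;> linarith
  have hfivesixths : ⌊5 / 6 + x⌋ = n + (k + 5) / 6 := by
    apply value <;> interval_cases k <;> norm_num at hl hu ⊢ <;> linarith
  rw [hneg, hthree, hnegtwo, hhalfsub, hsixth, hfivesixths]
  omega

/-- Powers of a prime greater than `3` are `±1` modulo `6`. -/
theorem prime_pow_mod_six {p : ℕ} (hp : p.Prime) (hp3 : 3 < p) (i : ℕ) :
    p ^ i % 6 = 1 ∨ p ^ i % 6 = 5 := by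
  have h₂ : ¬ 2 ∣ p ^ i := fun h => by
    have := (Nat.prime_dvd_prime_iff_eq Nat.prime_two hp).mp (Nat.prime_two.dvd_of_dvd_pow h)
    omega
  have h₃ : ¬ 3 ∣ p ^ i := fun h => by
    have := (Nat.prime_dvd_prime_iff_eq Nat.prime_three hp).mp (Nat.prime_three.dvd_of_dvd_pow h)
    omega
  omega

/-- If `2 * l * p ^ i / (p ^ r - 1)` is an integer, then `p ^ r - 1` divides `2 * l`. -/
theorem dvd_two_mul_of_two_mul_div_eq_intCast {p r l i : ℕ} (hp : 1 < p) (hr : 0 < r) {n : ℤ}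
    (h : 2 * ((l * p ^ i : ℚ) / (p ^ r - 1)) = n) : p ^ r - 1 ∣ 2 * l := by
  have hq : 1 < p ^ r := Nat.one_lt_pow hr.ne' hp
  have hq0 : (p ^ r - 1 : ℚ) ≠ 0 := by
    have : (1 : ℚ) < p ^ r := by exact_mod_cast hq
    linarith
  have hcop : Nat.Coprime (p ^ r - 1) (p ^ i) := by
    apply Nat.Coprime.pow_right
    apply Nat.Coprime.coprime_dvd_right (dvd_pow_self p hr.ne')
    exact (Nat.coprime_self_sub_left hq.le).mpr (Nat.coprime_one_left _)
  refine hcop.dvd_of_dvd_mul_right (Int.natCast_dvd_natCast.mp ⟨n, ?_⟩)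
  field_simp at h
  rw [Nat.cast_sub hq.le]
  push_cast
  exact_mod_cast h

/-- The floor-function identity of Lemma 3.3: for `q = p^r` (`p > 3` prime), `1 ≤ l ≤ q−2`,
`l ≠ (q−1)/2`, and `0 ≤ i ≤ r−1`,
`⌊3lpⁱ/(q−1)⌋ + 3⌊−lpⁱ/(q−1)⌋ − 3⌊−2lpⁱ/(q−1)⌋ − ⌊6lpⁱ/(q−1)⌋
  = −2⌊⟨pⁱ/2⟩ − lpⁱ/(q−1)⌋ − ⌊⟨−pⁱ/6⟩ + lpⁱ/(q−1)⌋ − ⌊⟨−5pⁱ/6⟩ + lpⁱ/(q−1)⌋`. -/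
theorem floor_fract_identity
    (p r : ℕ) (hp : p.Prime) (hp3 : 3 < p) (hr : 0 < r)
    (l : ℕ) (hl1 : 1 ≤ l) (hl2 : l ≤ p ^ r - 2) (hl3 : l ≠ (p ^ r - 1) / 2)
    (i : ℕ) (hi : i ≤ r - 1) :
    ⌊(3 * l * p ^ i : ℚ) / (p ^ r - 1)⌋ + 3 * ⌊(-(l * p ^ i) : ℚ) / (p ^ r - 1)⌋
      - 3 * ⌊(-(2 * l * p ^ i) : ℚ) / (p ^ r - 1)⌋
      - ⌊(6 * l * p ^ i : ℚ) / (p ^ r - 1)⌋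
    = -2 * ⌊Int.fract ((p ^ i : ℚ) / 2) - (l * p ^ i : ℚ) / (p ^ r - 1)⌋
      - ⌊Int.fract (-(p ^ i : ℚ) / 6) + (l * p ^ i : ℚ) / (p ^ r - 1)⌋
      - ⌊Int.fract (-(5 * p ^ i) / 6 : ℚ) + (l * p ^ i : ℚ) / (p ^ r - 1)⌋ := by
  have hx : ∀ n : ℤ, 2 * ((l * p ^ i : ℚ) / (p ^ r - 1)) ≠ n := by
    intro n h
    obtain ⟨c, hc⟩ := dvd_two_mul_of_two_mul_div_eq_intCast (by omega) hr h
    have hc0 : c ≠ 0 := by rintro rfl; omega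
    have hc2 : c < 2 := by
      by_contra! h2
      have := Nat.mul_le_mul_left (p ^ r - 1) h2
      omega
    obtain rfl : c = 1 := by omega
    omega
  have key := floor_hermite_combination _ hx
  rw [show (3 * l * p ^ i : ℚ) / (p ^ r - 1) = 3 * ((l * p ^ i : ℚ) / (p ^ r - 1)) by ring,
    show (-(l * p ^ i) : ℚ) / (p ^ r - 1) = -((l * p ^ i : ℚ) / (p ^ r - 1)) by ring,
    show (-(2 * l * p ^ i) : ℚ) / (p ^ r - 1) = -(2 * ((l * p ^ i : ℚ) / (p ^ r - 1))) by ring,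
    show (6 * l * p ^ i : ℚ) / (p ^ r - 1) = 6 * ((l * p ^ i : ℚ) / (p ^ r - 1)) by ring, key]
  generalize (l * p ^ i : ℚ) / (p ^ r - 1) = x
  have fract_value : ∀ (y f : ℚ) (m : ℤ), 0 ≤ f → f < 1 → y - f = m → Int.fract y = f :=
    fun y f m h₀ h₁ h => Int.fract_eq_iff.mpr ⟨h₀, h₁, m, h⟩
  have hdiv : (p ^ i : ℚ) = 6 * (p ^ i / 6 : ℕ) + (p ^ i % 6 : ℕ) := by
    exact_mod_cast (Nat.div_add_mod (p ^ i) 6).symm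
  generalize p ^ i / 6 = k at hdiv
  rcases prime_pow_mod_six hp hp3 i with h | h <;> rw [h] at hdiv <;> rw [hdiv]
  · rw [fract_value _ (1 / 2) (3 * k) (by norm_num) (by norm_num) (by push_cast; ring),
      fract_value _ (5 / 6) (-k - 1) (by norm_num) (by norm_num) (by push_cast; ring),
      fract_value _ (1 / 6) (-5 * k - 1) (by norm_num) (by norm_num) (by push_cast; ring)]
    ring
  · rw [fract_value _ (1 / 2) (3 * k + 2) (by norm_num) (by norm_num) (by push_cast; ring),
      fract_value _ (1 / 6) (-k - 1) (by norm_num) (by norm_num) (by push_cast; ring),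
      fract_value _ (5 / 6) (-5 * k - 5) (by norm_num) (by norm_num) (by push_cast; ring)]
end

section
/- For every multiplicative character χ of F_q (p odd), one has the Gauss-sum identity G(χ) · G(χφ) = G(φ) · G(χ²) · χ^{−1}(4), as an identity of complex numbers (this is the m = 2 specialization of the Davenport–Hasse relation). -/
open Finset

section

variable {F R : Type*} [Field F] [Fintype F] [CommRing R]

lemma sum_comp_sq_eq_sum_mul_quadraticChar_add_one [DecidableEq F] (hF : ringChar F ≠ 2)
    (f : F → R) :
    ∑ t : F, f (t ^ 2) = ∑ u : F, ((quadraticChar F u : ℤ) + 1 : R) * f u := by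
  rw [← sum_fiberwise univ (fun t : F ↦ t ^ 2)]
  refine sum_congr rfl fun u _ ↦ ?_
  rw [sum_congr rfl (g := fun _ ↦ f u) (fun t ht ↦ by rw [(mem_filter.mp ht).2]),
    sum_const, nsmul_eq_mul]
  congr 1
  have := congrArg (Int.cast : ℤ → R) (quadraticChar_card_sqrts hF u)
  push_cast at this
  rw [← this]
  congr 2
  ext; simp

variable [IsDomain R]

lemma MulChar.eq_of_sq_eq_one_of_ne_one {χ₁ χ₂ : MulChar F R}
    (h₁ : χ₁ ^ 2 = 1) (h₁' : χ₁ ≠ 1) (h₂ : χ₂ ^ 2 = 1) (h₂' : χ₂ ≠ 1) : χ₁ = χ₂ := by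
  obtain ⟨g, hg⟩ := IsCyclic.exists_generator (α := Fˣ)
  have key : ∀ χ : MulChar F R, χ ^ 2 = 1 → χ ≠ 1 → χ g = -1 := by
    intro χ h h'
    have hsq : χ g ^ 2 = 1 := by
      rw [← MulChar.pow_apply_coe, h, MulChar.one_apply_coe]
    refine (mul_self_eq_one_iff.mp (sq (χ g) ▸ hsq)).resolve_left fun h1 ↦ h' ?_
    rw [MulChar.eq_iff hg, h1, MulChar.one_apply_coe]
  rw [MulChar.eq_iff hg, key χ₁ h₁ h₁', key χ₂ h₂ h₂']

lemma MulChar.eq_quadraticChar_ringHomComp [DecidableEq F] [CharZero R] (hF : ringChar F ≠ 2)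
    {φ : MulChar F R} (h : φ ^ 2 = 1) (h' : φ ≠ 1) :
    φ = (quadraticChar F).ringHomComp (Int.castRingHom R) := by
  refine MulChar.eq_of_sq_eq_one_of_ne_one h h' ?_ ?_
  · exact ((quadraticChar_isQuadratic F).comp _).sq_eq_one
  · exact (MulChar.ringHomComp_ne_one_iff (RingHom.injective_int _)).mpr (quadraticChar_ne_one hF)

/-- The Jacobi sum duplication formula. -/
lemma jacobiSum_self_eq_inv_four_mul [CharZero R] (hF : ringChar F ≠ 2)
    {φ χ : MulChar F R} (hφ : φ ^ 2 = 1) (hφ' : φ ≠ 1) (hχ : χ ≠ 1) :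
    jacobiSum χ χ = χ⁻¹ 4 * jacobiSum χ φ := by
  classical
  have h2 : (2 : F) ≠ 0 := Ring.two_ne_zero hF
  have hsum : ∑ u : F, χ (1 - u) = 0 := by
    exact ((Equiv.subLeft (1 : F)).sum_comp χ).trans (MulChar.sum_eq_zero_of_ne_one hχ)
  calc jacobiSum χ χ = ∑ t : F, χ⁻¹ 4 * χ (1 - t ^ 2) := by
        let e : F ≃ F := (Equiv.mulRight₀ (2⁻¹ : F) (inv_ne_zero h2)).trans (Equiv.addRight 2⁻¹)
        rw [jacobiSum, ← e.sum_comp]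
        refine sum_congr rfl fun t _ ↦ ?_
        rw [MulChar.inv_apply', ← map_mul, ← map_mul]
        congr 1
        simp only [e, Equiv.trans_apply, Equiv.mulRight₀_apply, Equiv.coe_addRight]
        have h4 : (4 : F) = 2 * 2 := by norm_num
        rw [h4]
        field_simp
        ring
    _ = χ⁻¹ 4 * jacobiSum χ φ := by
        rw [← mul_sum, sum_comp_sq_eq_sum_mul_quadraticChar_add_one hF fun u ↦ χ (1 - u),
          jacobiSum_comm, jacobiSum, MulChar.eq_quadraticChar_ringHomComp hF hφ hφ']
        simp [add_mul, sum_add_distrib, hsum]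

end


/-- The `m = 2` specialization of the Davenport–Hasse relation:
`G(χ) · G(χφ) = G(φ) · G(χ²) · χ⁻¹(4)`, where `φ` is the quadratic character
(the unique multiplicative character of order 2). -/
theorem davenport_hasse_m_two
    (p r : ℕ) (hp : p.Prime) (hodd : Odd p) (hr : 0 < r)
    (F : Type) [Field F] [Fintype F] (hcard : Fintype.card F = p ^ r)
    (ψ : AddChar F ℂ) (hψ : ψ ≠ 1)
    (φ : MulChar F ℂ) (hφ : orderOf φ = 2)
    (χ : MulChar F ℂ) :
    gaussSum χ ψ * gaussSum (χ * φ) ψ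
      = gaussSum φ ψ * gaussSum (χ ^ 2) ψ * χ⁻¹ (4 : F) := by
  have hF : ringChar F ≠ 2 := fun h ↦ by
    have h0 := FiniteField.even_card_iff_char_two.mp h
    rw [hcard] at h0
    exact Nat.not_even_iff_odd.mpr hodd.pow (Nat.even_iff.mpr h0)
  have hφ2 : φ ^ 2 = 1 := hφ ▸ pow_orderOf_eq_one φ
  have hφ1 : φ ≠ 1 := fun h ↦ by simp [h] at hφ
  rcases eq_or_ne χ 1 with rfl | hχ
  · have h4 : (4 : F) ≠ 0 := by
      rw [show (4 : F) = 2 * 2 by norm_num]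
      exact mul_self_ne_zero.mpr (Ring.two_ne_zero hF)
    rw [inv_one, one_pow, one_mul, MulChar.one_apply h4.isUnit, mul_one, mul_comm]
  by_cases hχ2 : χ ^ 2 = 1
  · obtain rfl := MulChar.eq_of_sq_eq_one_of_ne_one hφ2 hφ1 hχ2 hχ
    have hinv : φ⁻¹ = φ := inv_eq_of_mul_eq_one_left (by rw [← sq, hφ2])
    have h4 : φ (4 : F) = 1 := by
      rw [show (4 : F) = 2 ^ 2 by norm_num, map_pow, ← MulChar.pow_apply' φ two_ne_zero, hφ2,
        MulChar.one_apply (Ring.two_ne_zero hF).isUnit]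
    rw [hinv, h4, mul_one, sq]
  · have hχφ : χ * φ ≠ 1 := fun h ↦ hχ2 <| by
      have := congrArg (· ^ 2) h
      simpa [mul_pow, hφ2] using this
    have hG : gaussSum χ ψ ≠ 0 :=
      gaussSum_ne_zero_of_nontrivial (by exact_mod_cast Fintype.card_ne_zero) hχ
        (AddChar.IsPrimitive.of_ne_one hψ)
    have hJ := jacobiSum_mul_nontrivial (sq χ ▸ hχ2) ψ
    have hJφ := jacobiSum_mul_nontrivial hχφ ψ
    rw [jacobiSum_self_eq_inv_four_mul hF hφ2 hφ1 hχ, ← sq χ] at hJ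
    apply mul_left_cancel₀ hG
    linear_combination gaussSum (χ ^ 2) ψ * χ⁻¹ 4 * hJφ - gaussSum (χ * φ) ψ * hJ
end

section
/- Suppose q ≡ 1 (mod 3) and let χ₃ be a multiplicative character of F_q of exact order 3. Then for every multiplicative character χ of F_q, one has G(χ) · G(χχ₃) · G(χχ₃²) = q · G(χ³) · χ^{−1}(27), as an identity of complex numbers (this is the m = 3 specialization of the Davenport–Hasse relation). -/
theorem sum_comp_eq_sum_card_mul {A Q : Type*} [Fintype A] [Fintype Q] [DecidableEq Q]
    (f : A → Q) (φ : Q → ℂ) :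
    ∑ a, φ (f a) = ∑ y, (Finset.card {a | f a = y} : ℂ) * φ y := by
  rw [← Finset.sum_fiberwise (s := Finset.univ) (g := f)]
  refine Finset.sum_congr rfl fun y _ => ?_
  rw [Finset.sum_congr rfl (g := fun _ => φ y) (by simp +contextual)]
  simp

theorem sum_card_fiber {A Q : Type*} [Fintype A] [Fintype Q] [DecidableEq Q] (f : A → Q) :
    ∑ y, Finset.card {a | f a = y} = Fintype.card A :=
  (Finset.card_eq_sum_card_fiberwise (fun _ _ => Finset.mem_univ _)).symm

section FiniteExtension

variable {F E : Type*} [Field F] [Fintype F] [Field E] [Fintype E] [Algebra F E]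

open Module

omit [Fintype E] in
theorem algebraMap_pow_card (x : F) : algebraMap F E x ^ Fintype.card F = algebraMap F E x := by
  rw [← map_pow, FiniteField.pow_card]

theorem pow_card_pow_card_of_finrank_two (h : finrank F E = 2) (w : E) :
    (w ^ Fintype.card F) ^ Fintype.card F = w := by
  rw [← pow_mul, ← sq, ← h, ← Module.card_eq_pow_finrank, FiniteField.pow_card]

theorem pow_card_pow_card_pow_card_of_finrank_three (h : finrank F E = 3) (w : E) :
    ((w ^ Fintype.card F) ^ Fintype.card F) ^ Fintype.card F = w := by
  rw [← pow_mul, ← pow_mul, ← pow_three, ← h, ← Module.card_eq_pow_finrank,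
    FiniteField.pow_card]

theorem algebraMap_trace_of_finrank_two (h : finrank F E = 2) (w : E) :
    algebraMap F E (Algebra.trace F E w) = w + w ^ Fintype.card F := by
  rw [FiniteField.algebraMap_trace_eq_sum_pow, h]
  simp [Finset.sum_range_succ]

theorem algebraMap_norm_of_finrank_two (h : finrank F E = 2) (w : E) :
    algebraMap F E (Algebra.norm F w) = w * w ^ Fintype.card F := by
  rw [FiniteField.algebraMap_norm_eq_prod_pow, h]
  simp [Finset.prod_range_succ]

theorem algebraMap_trace_of_finrank_three (h : finrank F E = 3) (w : E) :
    algebraMap F E (Algebra.trace F E w) =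
      w + w ^ Fintype.card F + (w ^ Fintype.card F) ^ Fintype.card F := by
  rw [FiniteField.algebraMap_trace_eq_sum_pow, h]
  simp [Finset.sum_range_succ, ← pow_mul, sq]

theorem algebraMap_norm_of_finrank_three (h : finrank F E = 3) (w : E) :
    algebraMap F E (Algebra.norm F w) =
      w * w ^ Fintype.card F * (w ^ Fintype.card F) ^ Fintype.card F := by
  rw [FiniteField.algebraMap_norm_eq_prod_pow, h]
  simp [Finset.prod_range_succ, ← pow_mul, sq]

theorem algebraMap_trace_mul_pow_card (h : finrank F E = 3) (w : E) :
    algebraMap F E (Algebra.trace F E (w * w ^ Fintype.card F)) =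
      w * w ^ Fintype.card F + w ^ Fintype.card F * (w ^ Fintype.card F) ^ Fintype.card F +
        (w ^ Fintype.card F) ^ Fintype.card F * w := by
  rw [algebraMap_trace_of_finrank_three h, mul_pow, mul_pow,
    pow_card_pow_card_pow_card_of_finrank_three h]

theorem trace_cube_of_finrank_two (h : finrank F E = 2) (w : E) :
    Algebra.trace F E (w ^ 3) =
      Algebra.trace F E w ^ 3 - 3 * Algebra.trace F E w * Algebra.norm F w := by
  apply (algebraMap F E).injective
  simp only [map_sub, map_mul, map_pow, map_ofNat, algebraMap_trace_of_finrank_two h,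
    algebraMap_norm_of_finrank_two h]
  ring

theorem trace_cube_of_finrank_three (h : finrank F E = 3) (w : E) :
    Algebra.trace F E (w ^ 3) =
      Algebra.trace F E w ^ 3
        - 3 * Algebra.trace F E w * Algebra.trace F E (w * w ^ Fintype.card F)
        + 3 * Algebra.norm F w := by
  apply (algebraMap F E).injective
  simp only [map_sub, map_add, map_mul, map_pow, map_ofNat, algebraMap_trace_mul_pow_card h]
  simp only [algebraMap_trace_of_finrank_three h, algebraMap_norm_of_finrank_three h]
  rw [pow_right_comm w, pow_right_comm (w ^ _)]
  ring

open Classical in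
theorem card_add_card_quadratic_le (h : finrank F E = 2) (e : F × F) :
    Finset.card {a : F × F | (a.1 + a.2, a.1 * a.2) = e} +
      Finset.card {w : E | (Algebra.trace F E w, Algebra.norm F w) = e} ≤ 2 := by
  obtain ⟨s, t⟩ := e
  simp only [Prod.mk.injEq]
  set i := algebraMap F E with hi
  have hinj : Function.Injective i := i.injective
  set A : Finset (F × F) := {a | a.1 + a.2 = s ∧ a.1 * a.2 = t} with hA
  set B : Finset E := {w | Algebra.trace F E w = s ∧ Algebra.norm F w = t} with hB
  have hAr : ∀ a ∈ A, ∀ z : F, z ^ 2 - s * z + t = (z - a.1) * (z - a.2) := by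
    intro a ha z
    obtain ⟨rfl, rfl⟩ := (Finset.mem_filter.1 ha).2
    ring
  have hBr : ∀ w ∈ B, ∀ z : E, z ^ 2 - i s * z + i t = (z - w) * (z - w ^ Fintype.card F) := by
    intro w hw z
    obtain ⟨rfl, rfl⟩ := (Finset.mem_filter.1 hw).2
    rw [algebraMap_trace_of_finrank_two h, algebraMap_norm_of_finrank_two h]
    ring
  have hBB : ∀ w ∈ B, ∀ w' ∈ B, w' = w ∨ w' = w ^ Fintype.card F := by
    intro w hw w' hw'
    have := (hBr w hw w').symm.trans (hBr w' hw' w')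
    rw [sub_self, zero_mul, mul_eq_zero, sub_eq_zero, sub_eq_zero] at this
    exact this
  have hBA : ∀ w ∈ B, ∀ a ∈ A, w = i a.1 ∧ w = i a.2 := by
    have key : ∀ w ∈ B, ∀ x : F, x ^ 2 - s * x + t = 0 → w = i x := by
      intro w hw x hx
      have h1 := hBr w hw (i x)
      rw [← map_pow, ← map_mul, ← map_sub, ← map_add, hx, map_zero, eq_comm, mul_eq_zero,
        sub_eq_zero, sub_eq_zero] at h1
      rcases h1 with h1 | h1
      · exact h1.symm
      · rw [← pow_card_pow_card_of_finrank_two h w, ← h1, algebraMap_pow_card]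
    intro w hw a ha
    exact ⟨key w hw _ (by rw [hAr a ha]; ring), key w hw _ (by rw [hAr a ha]; ring)⟩
  have hAA : ∀ a ∈ A, ∀ b ∈ A, b = a ∨ b = (a.2, a.1) := by
    rintro ⟨x, y⟩ ha ⟨x', y'⟩ hb
    have := (hAr _ ha x').symm.trans (hAr _ hb x')
    rw [sub_self, zero_mul, mul_eq_zero, sub_eq_zero, sub_eq_zero] at this
    have h1 := (Finset.mem_filter.1 ha).2.1
    have h2 := (Finset.mem_filter.1 hb).2.1
    simp only at h1 h2 this
    simp only [Prod.mk.injEq]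
    grind
  rcases B.eq_empty_or_nonempty with hBe | ⟨w, hw⟩
  · rw [hBe, Finset.card_empty]
    rcases A.eq_empty_or_nonempty with hAe | ⟨a, ha⟩
    · simp [hAe]
    · exact (Finset.card_le_card (t := {a, (a.2, a.1)})
        (fun b hb => by simpa using hAA a ha b hb)).trans Finset.card_le_two
  · rcases A.eq_empty_or_nonempty with hAe | ⟨a, ha⟩
    · rw [hAe, Finset.card_empty, zero_add]
      exact (Finset.card_le_card (t := {w, w ^ Fintype.card F})
        (fun b hb => by simpa using hBB w hw b hb)).trans Finset.card_le_two
    · have hA1 : A.card ≤ 1 := Finset.card_le_one.2 fun a ha b hb => by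
        have h1 := hBA w hw a ha
        have h2 := hBA w hw b hb
        exact Prod.ext (hinj (h1.1.symm.trans h2.1)) (hinj (h1.2.symm.trans h2.2))
      have hB1 : B.card ≤ 1 := Finset.card_le_one.2 fun w hw w' hw' =>
        (hBA w hw a ha).1.trans (hBA w' hw' a ha).1.symm
      omega

open Classical in
theorem two_mul_sum_quadratic (h : finrank F E = 2) (φ : F × F → ℂ) :
    2 * ∑ e, φ e = ∑ a : F × F, φ (a.1 + a.2, a.1 * a.2) +
      ∑ w : E, φ (Algebra.trace F E w, Algebra.norm F w) := by
  have key := (Finset.sum_eq_sum_iff_of_le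
    (fun e (_ : e ∈ Finset.univ) => card_add_card_quadratic_le (E := E) h e)).1 (by
      rw [Finset.sum_add_distrib, sum_card_fiber, sum_card_fiber, Fintype.card_prod,
        Module.card_eq_pow_finrank (K := F) (V := E), h]
      simp
      ring)
  rw [sum_comp_eq_sum_card_mul (fun a : F × F => (a.1 + a.2, a.1 * a.2)),
    sum_comp_eq_sum_card_mul (fun w : E => (Algebra.trace F E w, Algebra.norm F w)),
    ← Finset.sum_add_distrib, Finset.mul_sum]
  refine Finset.sum_congr rfl fun e he => ?_
  rw [← add_mul, ← Nat.cast_add, key e he]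
  simp

variable {E₂ E₃ : Type*} [Field E₂] [Fintype E₂] [Algebra F E₂] [Field E₃] [Fintype E₃]
  [Algebra F E₃]

open Classical in
theorem card_add_card_add_card_cubic_le (h₂ : finrank F E₂ = 2) (h₃ : finrank F E₃ = 3)
    (e : F × F × F) :
    Finset.card {a : F × F × F | (a.1 + a.2.1 + a.2.2,
        a.1 * a.2.1 + a.1 * a.2.2 + a.2.1 * a.2.2, a.1 * a.2.1 * a.2.2) = e} +
      3 * Finset.card {b : F × E₂ | (b.1 + Algebra.trace F E₂ b.2,
        b.1 * Algebra.trace F E₂ b.2 + Algebra.norm F b.2, b.1 * Algebra.norm F b.2) = e} +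
      2 * Finset.card {v : E₃ | (Algebra.trace F E₃ v,
        Algebra.trace F E₃ (v * v ^ Fintype.card F), Algebra.norm F v) = e} ≤ 6 := by
  obtain ⟨e₁, e₂, e₃⟩ := e
  simp only [Prod.mk.injEq]
  set i := algebraMap F E₂ with hi
  set j := algebraMap F E₃ with hj
  have hiinj : Function.Injective i := i.injective
  have hjinj : Function.Injective j := j.injective
  set A : Finset (F × F × F) := {a | a.1 + a.2.1 + a.2.2 = e₁ ∧
    a.1 * a.2.1 + a.1 * a.2.2 + a.2.1 * a.2.2 = e₂ ∧ a.1 * a.2.1 * a.2.2 = e₃} with hA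
  set B : Finset (F × E₂) := {b | b.1 + Algebra.trace F E₂ b.2 = e₁ ∧
    b.1 * Algebra.trace F E₂ b.2 + Algebra.norm F b.2 = e₂ ∧ b.1 * Algebra.norm F b.2 = e₃} with hB
  set C : Finset E₃ := {v | Algebra.trace F E₃ v = e₁ ∧
    Algebra.trace F E₃ (v * v ^ Fintype.card F) = e₂ ∧ Algebra.norm F v = e₃} with hC
  have hAr : ∀ a ∈ A, ∀ z : F, z ^ 3 - e₁ * z ^ 2 + e₂ * z - e₃ =
      (z - a.1) * (z - a.2.1) * (z - a.2.2) := by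
    intro a ha z
    obtain ⟨rfl, rfl, rfl⟩ := (Finset.mem_filter.1 ha).2
    ring
  have hBr : ∀ b ∈ B, ∀ z : E₂, z ^ 3 - i e₁ * z ^ 2 + i e₂ * z - i e₃ =
      (z - i b.1) * (z - b.2) * (z - b.2 ^ Fintype.card F) := by
    intro b hb z
    obtain ⟨rfl, rfl, rfl⟩ := (Finset.mem_filter.1 hb).2
    simp only [map_add, map_mul, hi]
    rw [algebraMap_trace_of_finrank_two h₂, algebraMap_norm_of_finrank_two h₂]
    ring
  have hCr : ∀ v ∈ C, ∀ z : E₃, z ^ 3 - j e₁ * z ^ 2 + j e₂ * z - j e₃ =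
      (z - v) * (z - v ^ Fintype.card F) * (z - (v ^ Fintype.card F) ^ Fintype.card F) := by
    intro v hv z
    obtain ⟨rfl, rfl, rfl⟩ := (Finset.mem_filter.1 hv).2
    simp only [hj]
    rw [algebraMap_trace_mul_pow_card h₃, algebraMap_trace_of_finrank_three h₃,
      algebraMap_norm_of_finrank_three h₃]
    ring
  have hir : ∀ z : F, i (z ^ 3 - e₁ * z ^ 2 + e₂ * z - e₃) =
      i z ^ 3 - i e₁ * i z ^ 2 + i e₂ * i z - i e₃ := fun z => by simp
  have hjr : ∀ z : F, j (z ^ 3 - e₁ * z ^ 2 + e₂ * z - e₃) =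
      j z ^ 3 - j e₁ * j z ^ 2 + j e₂ * j z - j e₃ := fun z => by simp
  have hAroot : ∀ a ∈ A, a.1 ^ 3 - e₁ * a.1 ^ 2 + e₂ * a.1 - e₃ = 0 ∧
      a.2.1 ^ 3 - e₁ * a.2.1 ^ 2 + e₂ * a.2.1 - e₃ = 0 ∧
      a.2.2 ^ 3 - e₁ * a.2.2 ^ 2 + e₂ * a.2.2 - e₃ = 0 := fun a ha => by
    simp [hAr a ha]
  have hBroot : ∀ b ∈ B, b.1 ^ 3 - e₁ * b.1 ^ 2 + e₂ * b.1 - e₃ = 0 := fun b hb => by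
    apply hiinj
    rw [hir, hBr b hb]
    simp
  have hAA : ∀ a ∈ A, ∀ b ∈ A, b = a ∨ b = (a.1, a.2.2, a.2.1) ∨ b = (a.2.1, a.1, a.2.2) ∨
      b = (a.2.1, a.2.2, a.1) ∨ b = (a.2.2, a.1, a.2.1) ∨ b = (a.2.2, a.2.1, a.1) := by
    rintro ⟨x, y, z⟩ ha ⟨x', y', z'⟩ hb
    have r₁ := (hAr _ ha x').symm.trans (hAroot _ hb).1
    obtain ⟨h1, h2, -⟩ := (Finset.mem_filter.1 ha).2
    obtain ⟨k1, k2, -⟩ := (Finset.mem_filter.1 hb).2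
    simp only [mul_eq_zero, sub_eq_zero] at h1 h2 k1 k2 r₁
    simp only [Prod.mk.injEq]
    have aux : ∀ a b c d : F, a + b = c + d → a * b = c * d →
        (a = c ∧ b = d) ∨ (a = d ∧ b = c) := by
      intro a b c d hs hp
      have : (a - c) * (a - d) = 0 := by linear_combination a * hs - hp
      rcases mul_eq_zero.1 this with h | h
      · exact Or.inl ⟨by linear_combination h, by linear_combination hs - h⟩
      · exact Or.inr ⟨by linear_combination h, by linear_combination hs - h⟩
    rcases r₁ with (rfl | rfl) | rfl
    · rcases aux y' z' y z (by linear_combination k1 - h1)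
        (by linear_combination k2 - h2 - x' * (k1 - h1)) with h | h <;> simp [h]
    · rcases aux y' z' x z (by linear_combination k1 - h1)
        (by linear_combination k2 - h2 - x' * (k1 - h1)) with h | h <;> simp [h]
    · rcases aux y' z' x y (by linear_combination k1 - h1)
        (by linear_combination k2 - h2 - x' * (k1 - h1)) with h | h <;> simp [h]
  have hBA : ∀ x u : F, (x, i u) ∈ B → (x, u, u) ∈ A := by
    intro x u hb
    obtain ⟨h1, h2, h3⟩ := (Finset.mem_filter.1 hb).2
    have ht : Algebra.trace F E₂ (i u) = u + u := by
      apply hiinj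
      rw [hi, algebraMap_trace_of_finrank_two h₂, algebraMap_pow_card, map_add]
    have hn : Algebra.norm F (i u) = u * u := by
      apply hiinj
      rw [hi, algebraMap_norm_of_finrank_two h₂, algebraMap_pow_card, map_mul]
    simp only [ht, hn] at h1 h2 h3
    refine Finset.mem_filter.2 ⟨Finset.mem_univ _, ?_, ?_, ?_⟩
    · rw [← h1]; ring
    · rw [← h2]; ring
    · rw [← h3]; ring
  have hCroot : ∀ v ∈ C, ∀ x : F, x ^ 3 - e₁ * x ^ 2 + e₂ * x - e₃ = 0 → v = j x := by
    intro v hv x hx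
    have h1 := hCr v hv (j x)
    rw [← hjr, hx, map_zero, eq_comm, mul_eq_zero, mul_eq_zero, sub_eq_zero, sub_eq_zero,
      sub_eq_zero] at h1
    rcases h1 with (h1 | h1) | h1
    · exact h1.symm
    · rw [← pow_card_pow_card_pow_card_of_finrank_three h₃ v, ← h1, algebraMap_pow_card,
        algebraMap_pow_card]
    · rw [← pow_card_pow_card_pow_card_of_finrank_three h₃ v, ← h1, algebraMap_pow_card]
  rcases C.eq_empty_or_nonempty with hCe | ⟨v, hv⟩
  · rw [hCe, Finset.card_empty, mul_zero, add_zero]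
    rcases B.eq_empty_or_nonempty with hBe | ⟨⟨x, w⟩, hb⟩
    · rw [hBe, Finset.card_empty, mul_zero, add_zero]
      rcases A.eq_empty_or_nonempty with hAe | ⟨a, ha⟩
      · simp [hAe]
      · exact (Finset.card_le_card (t := {a, (a.1, a.2.2, a.2.1), (a.2.1, a.1, a.2.2),
          (a.2.1, a.2.2, a.1), (a.2.2, a.1, a.2.1), (a.2.2, a.2.1, a.1)})
          (fun b hb => by simpa using hAA a ha b hb)).trans Finset.card_le_six
    · rcases A.eq_empty_or_nonempty with hAe | ⟨a, ha⟩
      · have hB2 : B.card ≤ 2 := by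
          refine (Finset.card_le_card (t := {(x, w), (x, w ^ Fintype.card F)}) ?_).trans
            Finset.card_le_two
          have hnot : ∀ b ∈ B, ∀ u, b.2 ≠ i u := by
            rintro ⟨y, _⟩ hy u rfl
            simpa [hAe] using hBA y u hy
          have hnot' : ∀ b ∈ B, ∀ u, i u ≠ b.2 ^ Fintype.card F := by
            intro b hb u hu
            apply hnot b hb u
            rw [← pow_card_pow_card_of_finrank_two h₂ b.2, ← hu, algebraMap_pow_card]
          rintro ⟨x', w'⟩ hb'
          have h1 := (hBr _ hb (i x')).symm.trans ((hir x').symm.trans (by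
            rw [hBroot _ hb', map_zero]))
          simp only [mul_eq_zero, sub_eq_zero, (hnot _ hb x').symm, hnot' _ hb x', or_false] at h1
          have h2 := (hBr _ hb w').symm.trans (hBr _ hb' w')
          simp only [sub_self, mul_zero, zero_mul, mul_eq_zero, sub_eq_zero, hnot _ hb' x,
            false_or] at h2
          rw [hiinj h1]
          simpa using h2
        rw [hAe, Finset.card_empty]
        omega
      · obtain ⟨u, rfl⟩ : ∃ u, w = i u := by
          have h1 : w ^ 3 - i e₁ * w ^ 2 + i e₂ * w - i e₃ = 0 := by simp [hBr _ hb w]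
          have h2 : w ^ 3 - i e₁ * w ^ 2 + i e₂ * w - i e₃ =
              (w - i a.1) * (w - i a.2.1) * (w - i a.2.2) := by
            obtain ⟨rfl, rfl, rfl⟩ := (Finset.mem_filter.1 ha).2
            simp only [map_add, map_mul]
            ring
          rw [h2, mul_eq_zero, mul_eq_zero, sub_eq_zero, sub_eq_zero, sub_eq_zero] at h1
          rcases h1 with (h1 | h1) | h1 <;> exact ⟨_, h1⟩
        have hxu := hBA x u hb
        have hA3 : A.card ≤ 3 := by
          refine (Finset.card_le_card (t := {(x, u, u), (u, x, u), (u, u, x)}) ?_).trans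
            Finset.card_le_three
          intro b hb
          have := hAA _ hxu b hb
          simp only [Finset.mem_insert, Finset.mem_singleton] at this ⊢
          tauto
        have hB1 : B.card ≤ 1 := by
          refine Finset.card_le_one_iff_subset_singleton.2 ⟨(x, i u), ?_⟩
          rintro ⟨x', w'⟩ hb'
          have h2 := (hBr _ hb w').symm.trans (hBr _ hb' w')
          simp only [hi, algebraMap_pow_card] at h2
          simp only [sub_self, mul_zero, zero_mul, mul_eq_zero, sub_eq_zero] at h2
          obtain ⟨u', rfl⟩ : ∃ u', w' = i u' := by
            rcases h2 with (h2 | h2) | h2 <;> exact ⟨_, h2⟩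
          have := hAA _ hxu _ (hBA x' u' hb')
          simp only [Prod.mk.injEq] at this
          have h3 : x' = x ∧ u' = u := by
            clear * - this
            grind
          simp [h3]
        omega
  · by_cases hroot : ∃ u : F, u ^ 3 - e₁ * u ^ 2 + e₂ * u - e₃ = 0
    · obtain ⟨u, hu⟩ := hroot
      have hvu := hCroot v hv u hu
      have huniq : ∀ x : F, x ^ 3 - e₁ * x ^ 2 + e₂ * x - e₃ = 0 → x = u := fun x hx =>
        hjinj ((hCroot v hv x hx).symm.trans hvu)
      have hC1 : C.card ≤ 1 := Finset.card_le_one.2 fun v hv w hw =>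
        (hCroot v hv u hu).trans (hCroot w hw u hu).symm
      have hA1 : A.card ≤ 1 := by
        refine Finset.card_le_one_iff_subset_singleton.2 ⟨(u, u, u), fun a ha => ?_⟩
        obtain ⟨h1, h2, h3⟩ := hAroot a ha
        rw [Finset.mem_singleton]
        exact Prod.ext (huniq _ h1) (Prod.ext (huniq _ h2) (huniq _ h3))
      have hB1 : B.card ≤ 1 := by
        refine Finset.card_le_one_iff_subset_singleton.2 ⟨(u, i u), ?_⟩
        rintro ⟨x, w⟩ hb
        have hx := huniq _ (hBroot _ hb)
        obtain ⟨h1, h2, h3⟩ := (Finset.mem_filter.1 hv).2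
        have g1 : e₁ = 3 * u := by
          apply hjinj
          rw [← h1, hj, algebraMap_trace_of_finrank_three h₃, hvu, map_mul, map_ofNat]
          simp only [hj, algebraMap_pow_card]
          ring
        have g2 : e₂ = 3 * u ^ 2 := by
          apply hjinj
          rw [← h2, hj, algebraMap_trace_mul_pow_card h₃, hvu, map_mul, map_ofNat, map_pow]
          simp only [hj, algebraMap_pow_card]
          ring
        have g3 : e₃ = u ^ 3 := by
          apply hjinj
          rw [← h3, hj, algebraMap_norm_of_finrank_three h₃, hvu, map_pow]
          simp only [hj, algebraMap_pow_card]
          ring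
        have hw := hBr _ hb w
        have hw' : (w - i u) ^ 3 = 0 := by
          simp only [sub_self, mul_zero, zero_mul] at hw
          rw [g1, g2, g3, map_mul, map_mul, map_ofNat, map_pow, map_pow] at hw
          linear_combination hw
        have hw'' : w = i u := sub_eq_zero.1 (pow_eq_zero_iff three_ne_zero |>.1 hw')
        simp only at hx
        simp [hx, hw'']
      omega
    · have hA0 : A = ∅ := Finset.eq_empty_of_forall_notMem fun a ha =>
        hroot ⟨_, (hAroot a ha).1⟩
      have hB0 : B = ∅ := Finset.eq_empty_of_forall_notMem fun b hb =>
        hroot ⟨_, hBroot b hb⟩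
      have hC3 : C.card ≤ 3 := by
        refine (Finset.card_le_card (t := {v, v ^ Fintype.card F,
          (v ^ Fintype.card F) ^ Fintype.card F}) ?_).trans Finset.card_le_three
        intro w hw
        have := (hCr v hv w).symm.trans (hCr w hw w)
        simp only [sub_self, zero_mul, mul_eq_zero, sub_eq_zero] at this
        simp only [Finset.mem_insert, Finset.mem_singleton]
        tauto
      rw [hA0, hB0, Finset.card_empty, Finset.card_empty]
      omega

open Classical in
theorem six_mul_sum_cubic (h₂ : finrank F E₂ = 2) (h₃ : finrank F E₃ = 3)
    (φ : F × F × F → ℂ) :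
    6 * ∑ e, φ e = ∑ a : F × F × F, φ (a.1 + a.2.1 + a.2.2,
        a.1 * a.2.1 + a.1 * a.2.2 + a.2.1 * a.2.2, a.1 * a.2.1 * a.2.2) +
      3 * ∑ b : F × E₂, φ (b.1 + Algebra.trace F E₂ b.2,
        b.1 * Algebra.trace F E₂ b.2 + Algebra.norm F b.2, b.1 * Algebra.norm F b.2) +
      2 * ∑ v : E₃, φ (Algebra.trace F E₃ v,
        Algebra.trace F E₃ (v * v ^ Fintype.card F), Algebra.norm F v) := by
  have key := (Finset.sum_eq_sum_iff_of_le
    (fun e (_ : e ∈ Finset.univ) =>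
      card_add_card_add_card_cubic_le (E₂ := E₂) (E₃ := E₃) h₂ h₃ e)).1 (by
      rw [Finset.sum_add_distrib, Finset.sum_add_distrib, ← Finset.mul_sum, ← Finset.mul_sum,
        sum_card_fiber, sum_card_fiber, sum_card_fiber, Fintype.card_prod, Fintype.card_prod,
        Fintype.card_prod, Module.card_eq_pow_finrank (K := F) (V := E₂), h₂,
        Module.card_eq_pow_finrank (K := F) (V := E₃), h₃]
      simp
      ring)
  rw [sum_comp_eq_sum_card_mul (fun a : F × F × F => (a.1 + a.2.1 + a.2.2,
        a.1 * a.2.1 + a.1 * a.2.2 + a.2.1 * a.2.2, a.1 * a.2.1 * a.2.2)),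
    sum_comp_eq_sum_card_mul (fun b : F × E₂ => (b.1 + Algebra.trace F E₂ b.2,
        b.1 * Algebra.trace F E₂ b.2 + Algebra.norm F b.2, b.1 * Algebra.norm F b.2)),
    sum_comp_eq_sum_card_mul (fun v : E₃ => (Algebra.trace F E₃ v,
        Algebra.trace F E₃ (v * v ^ Fintype.card F), Algebra.norm F v)),
    Finset.mul_sum, Finset.mul_sum, Finset.mul_sum, ← Finset.sum_add_distrib,
    ← Finset.sum_add_distrib]
  refine Finset.sum_congr rfl fun e he => ?_
  rw [← mul_assoc, ← mul_assoc, ← add_mul, ← add_mul]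
  congr 1
  exact_mod_cast (key e he).symm

end FiniteExtension

section GaussSum

open Module

open Classical in
/-- If `η` is a cubic character of a finite field, then `1 + η a + η a ^ 2` is the number of cube
roots of `a ≠ 0`. -/
theorem sum_comp_cube_eq_sum_mul {E : Type*} [Field E] [Fintype E] {η : MulChar E ℂ}
    (hη : orderOf η = 3) {f : E → ℂ} (hf : f 0 = 0) :
    ∑ v, f (v ^ 3) = ∑ a, f a * (1 + η a + η a ^ 2) := by
  have hη3 : ∀ a : E, a ≠ 0 → η a ^ 3 = 1 := fun a ha => by
    rw [← MulChar.pow_apply' η three_ne_zero, ← hη, pow_orderOf_eq_one,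
      MulChar.one_apply ha.isUnit]
  have hη1 : η ≠ 1 := fun h => by simp [h] at hη
  have hη2 : η ^ 2 ≠ 1 := fun h => by
    have := orderOf_dvd_of_pow_eq_one h
    rw [hη] at this
    omega
  set w : E → ℕ := fun a => if a = 0 then 1 else if η a = 1 then 3 else 0 with hw
  have hwη : ∀ a : E, a ≠ 0 → (w a : ℂ) = 1 + η a + η a ^ 2 := fun a ha => by
    by_cases h : η a = 1
    · simp [hw, ha, h]
      norm_num
    · simp only [hw, ha, h, if_false, Nat.cast_zero]
      have h3 : (η a - 1) * (1 + η a + η a ^ 2) = 0 := by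
        linear_combination hη3 a ha
      exact ((mul_eq_zero.1 h3).resolve_left (sub_ne_zero.2 h)).symm
  have hle : ∀ a ∈ Finset.univ, Finset.card {v : E | v ^ 3 = a} ≤ w a := by
    intro a _
    by_cases ha : a = 0
    · simp only [hw, ha, if_true]
      exact Finset.card_le_one.2 (by simp +contextual)
    rcases Finset.eq_empty_or_nonempty {v : E | v ^ 3 = a} with he | ⟨v, hv⟩
    · simp [he]
    · have hv' : v ^ 3 = a := by simpa using hv
      have hv0 : v ≠ 0 := by
        rintro rfl
        exact ha (by simp [← hv'])
      have h1 : η a = 1 := by rw [← hv', map_pow, hη3 v hv0]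
      simp only [hw, ha, h1, if_false, if_true]
      refine (Finset.card_le_card (t := (Polynomial.nthRoots 3 a).toFinset) fun u hu => ?_).trans
        ((Multiset.toFinset_card_le _).trans (Polynomial.card_nthRoots 3 a))
      simpa [Polynomial.mem_nthRoots] using hu
  have htot : ∑ a, Finset.card {v : E | v ^ 3 = a} = ∑ a, w a := by
    rw [sum_card_fiber (fun v : E => v ^ 3)]
    have hcast : ∀ a : E, (w a : ℂ) = 1 + η a + (η ^ 2) a := fun a => by
      by_cases ha : a = 0
      · simp [hw, ha, MulChar.map_zero]
      · rw [hwη a ha, MulChar.pow_apply' η two_ne_zero]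
    have : ((∑ a, w a : ℕ) : ℂ) = (Fintype.card E : ℂ) := by
      push_cast
      rw [Finset.sum_congr rfl fun a _ => hcast a]
      simp [Finset.sum_add_distrib, MulChar.sum_eq_zero_of_ne_one hη1,
        MulChar.sum_eq_zero_of_ne_one hη2]
    exact_mod_cast this.symm
  have key := (Finset.sum_eq_sum_iff_of_le hle).1 htot
  rw [sum_comp_eq_sum_card_mul (fun v : E => v ^ 3)]
  refine Finset.sum_congr rfl fun a ha => ?_
  rw [key a ha]
  by_cases h0 : a = 0
  · simp [h0, hf]
  · rw [hwη a h0, mul_comm]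

variable {F : Type*} [Field F] [Fintype F]

omit [Fintype F] in
theorem sum_normTrace_cube {E : Type*} [Field E] [Fintype E] [Algebra F E] (ψ : AddChar F ℂ)
    {χ₃ : MulChar F ℂ} (hχ₃ : orderOf χ₃ = 3) (χ : MulChar F ℂ) :
    ∑ v : E, (χ ^ 3) (Algebra.norm F v) * ψ (Algebra.trace F E (v ^ 3)) =
      ∑ v : E, χ (Algebra.norm F v) * ψ (Algebra.trace F E v) +
      ∑ v : E, (χ * χ₃) (Algebra.norm F v) * ψ (Algebra.trace F E v) +
      ∑ v : E, (χ * χ₃ ^ 2) (Algebra.norm F v) * ψ (Algebra.trace F E v) := by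
  let η : MulChar E ℂ :=
    { toMonoidHom := χ₃.toMonoidHom.comp (Algebra.norm F)
      map_nonunit' := fun a ha => by
        have : a = 0 := by simpa using ha
        change χ₃ (Algebra.norm F a) = 0
        simp [this, MulChar.map_zero] }
  have hη : ∀ a, η a = χ₃ (Algebra.norm F a) := fun _ => rfl
  have hη3 : orderOf η = 3 := by
    refine orderOf_eq_prime ?_ ?_
    · ext a
      rw [MulChar.pow_apply' η three_ne_zero, hη, ← MulChar.pow_apply' χ₃ three_ne_zero, ← hχ₃,
        pow_orderOf_eq_one, MulChar.one_apply a.isUnit, MulChar.one_apply (a.isUnit.map _)]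
    · intro h
      have h1 : χ₃ = 1 := by
        ext a
        obtain ⟨b, hb⟩ := FiniteField.norm_surjective F E a
        have hb0 : b ≠ 0 := by
          rintro rfl
          exact a.ne_zero (by simp [← hb])
        rw [← hb, ← hη, h, MulChar.one_apply hb0.isUnit, hb, MulChar.one_apply a.isUnit]
      simp [h1] at hχ₃
  have key := sum_comp_cube_eq_sum_mul hη3
    (f := fun a => χ (Algebra.norm F a) * ψ (Algebra.trace F E a)) (by simp [MulChar.map_zero])
  simp only [map_pow, hη] at key ⊢
  simp only [MulChar.pow_apply' χ three_ne_zero]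
  rw [key, ← Finset.sum_add_distrib, ← Finset.sum_add_distrib]
  refine Finset.sum_congr rfl fun a _ => ?_
  rw [MulChar.mul_apply, MulChar.mul_apply, MulChar.pow_apply' χ₃ two_ne_zero]
  ring

/-- The Davenport–Hasse lifting relation for quadratic extensions. -/
theorem sum_normTrace_of_finrank_two {E : Type*} [Field E] [Fintype E] [Algebra F E]
    (h : finrank F E = 2) {ψ : AddChar F ℂ} (hψ : ψ ≠ 1) (χ : MulChar F ℂ) :
    ∑ w : E, χ (Algebra.norm F w) * ψ (Algebra.trace F E w) = -gaussSum χ ψ ^ 2 := by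
  have key := two_mul_sum_quadratic (E := E) h (fun e => χ e.2 * ψ e.1)
  have h0 : ∑ e : F × F, χ e.2 * ψ e.1 = 0 := by
    rw [Fintype.sum_prod_type_right]
    simp only [← Finset.mul_sum, AddChar.sum_eq_zero_of_ne_one hψ, mul_zero, Finset.sum_const_zero]
  have h1 : ∑ a : F × F, χ (a.1 * a.2) * ψ (a.1 + a.2) = gaussSum χ ψ ^ 2 := by
    rw [sq, gaussSum, Fintype.sum_mul_sum, Fintype.sum_prod_type]
    simp only [map_mul, AddChar.map_add_eq_mul]
    exact Finset.sum_congr rfl fun _ _ => Finset.sum_congr rfl fun _ _ => by ring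
  rw [h0, h1] at key
  linear_combination -key

omit [Field F] in
theorem sum_triple_mul (f : F → ℂ) :
    ∑ a : F × F × F, f a.1 * f a.2.1 * f a.2.2 = (∑ x, f x) ^ 3 := by
  simp only [Fintype.sum_prod_type, mul_assoc, ← Finset.mul_sum, ← Finset.sum_mul]
  ring

omit [Field F] in
theorem sum_pair_mul {E : Type*} [Fintype E] (f : F → ℂ) (g : E → ℂ) :
    ∑ b : F × E, f b.1 * g b.2 = (∑ x, f x) * ∑ w, g w := by
  rw [Fintype.sum_prod_type, Fintype.sum_mul_sum]

variable {E₂ E₃ : Type*} [Field E₂] [Fintype E₂] [Algebra F E₂] [Field E₃] [Fintype E₃]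
  [Algebra F E₃]

/-- The Davenport–Hasse lifting relation for cubic extensions. -/
theorem sum_normTrace_of_finrank_three (h₂ : finrank F E₂ = 2) (h₃ : finrank F E₃ = 3)
    {ψ : AddChar F ℂ} (hψ : ψ ≠ 1) (χ : MulChar F ℂ) :
    ∑ v : E₃, χ (Algebra.norm F v) * ψ (Algebra.trace F E₃ v) = gaussSum χ ψ ^ 3 := by
  have key := six_mul_sum_cubic (E₂ := E₂) (E₃ := E₃) h₂ h₃ (fun e => χ e.2.2 * ψ e.1)
  have h0 : ∑ e : F × F × F, χ e.2.2 * ψ e.1 = 0 := by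
    rw [Fintype.sum_prod_type_right]
    simp only [← Finset.mul_sum, AddChar.sum_eq_zero_of_ne_one hψ, mul_zero, Finset.sum_const_zero]
  have h1 : ∑ a : F × F × F, χ (a.1 * a.2.1 * a.2.2) * ψ (a.1 + a.2.1 + a.2.2) =
      gaussSum χ ψ ^ 3 := by
    rw [gaussSum, ← sum_triple_mul]
    refine Finset.sum_congr rfl fun _ _ => ?_
    simp only [map_mul, AddChar.map_add_eq_mul]
    ring
  have h2 : ∑ b : F × E₂, χ (b.1 * Algebra.norm F b.2) * ψ (b.1 + Algebra.trace F E₂ b.2) =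
      gaussSum χ ψ * -gaussSum χ ψ ^ 2 := by
    rw [← sum_normTrace_of_finrank_two (E := E₂) h₂ hψ, gaussSum, ← sum_pair_mul]
    refine Finset.sum_congr rfl fun _ _ => ?_
    simp only [map_mul, AddChar.map_add_eq_mul]
    ring
  rw [h0, h1, h2] at key
  linear_combination -key / 2

theorem sum_cubic_powerSum {ψ : AddChar F ℂ} (hψ : ψ ≠ 1) (h3 : (3 : F) ≠ 0) (χ : MulChar F ℂ) :
    ∑ e : F × F × F, χ e.2.2 * ψ (e.1 ^ 3 - 3 * e.1 * e.2.1 + 3 * e.2.2) =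
      Fintype.card F * (χ⁻¹ 3 * gaussSum χ ψ) := by
  classical
  have hprim : ψ.IsPrimitive := AddChar.IsPrimitive.of_ne_one hψ
  have hshift : ∑ z, χ z * ψ (3 * z) = χ⁻¹ 3 * gaussSum χ ψ := by
    have := gaussSum_mulShift χ ψ (Units.mk0 3 h3)
    rw [← this, Units.val_mk0, ← mul_assoc, ← MulChar.mul_apply, inv_mul_cancel,
      MulChar.one_apply h3.isUnit, one_mul]
    rfl
  have hinner : ∀ x : F, ∑ y, ψ (y * (-3 * x)) = if x = 0 then (Fintype.card F : ℂ) else 0 := by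
    intro x
    rw [AddChar.sum_mulShift _ hprim]
    simp [h3]
  have hsplit : ∀ e : F × F × F, χ e.2.2 * ψ (e.1 ^ 3 - 3 * e.1 * e.2.1 + 3 * e.2.2) =
      ψ (e.1 ^ 3) * (ψ (e.2.1 * (-3 * e.1)) * (χ e.2.2 * ψ (3 * e.2.2))) := fun e => by
    rw [show e.1 ^ 3 - 3 * e.1 * e.2.1 + 3 * e.2.2 =
      e.1 ^ 3 + e.2.1 * (-3 * e.1) + 3 * e.2.2 by ring, AddChar.map_add_eq_mul,
      AddChar.map_add_eq_mul]
    ring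
  simp only [hsplit, Fintype.sum_prod_type, ← Finset.mul_sum, ← Finset.sum_mul, hshift, hinner]
  simp

theorem gaussSum_mul_gaussSum_mul_gaussSum_of_orderOf_eq_three (h₂ : finrank F E₂ = 2)
    (h₃ : finrank F E₃ = 3) {ψ : AddChar F ℂ} (hψ : ψ ≠ 1) (h3 : (3 : F) ≠ 0)
    {χ₃ : MulChar F ℂ} (hχ₃ : orderOf χ₃ = 3) (χ : MulChar F ℂ) :
    gaussSum χ ψ * gaussSum (χ * χ₃) ψ * gaussSum (χ * χ₃ ^ 2) ψ =
      Fintype.card F * gaussSum (χ ^ 3) ψ * χ⁻¹ 27 := by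
  have key := six_mul_sum_cubic (E₂ := E₂) (E₃ := E₃) h₂ h₃
    (fun e => (χ ^ 3) e.2.2 * ψ (e.1 ^ 3 - 3 * e.1 * e.2.1 + 3 * e.2.2))
  have s1 := sum_normTrace_cube (E := F) ψ hχ₃ χ
  have s2 := sum_normTrace_cube (E := E₂) ψ hχ₃ χ
  have s3 := sum_normTrace_cube (E := E₃) ψ hχ₃ χ
  simp only [Algebra.norm_self, Algebra.trace_self, MonoidHom.id_apply, LinearMap.id_apply] at s1
  change _ = gaussSum χ ψ + gaussSum (χ * χ₃) ψ + gaussSum (χ * χ₃ ^ 2) ψ at s1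
  simp only [sum_normTrace_of_finrank_two h₂ hψ] at s2
  simp only [sum_normTrace_of_finrank_three (E₂ := E₂) h₂ h₃ hψ] at s3
  have k1 : ∑ a : F × F × F, (χ ^ 3) (a.1 * a.2.1 * a.2.2) * ψ ((a.1 + a.2.1 + a.2.2) ^ 3
      - 3 * (a.1 + a.2.1 + a.2.2) * (a.1 * a.2.1 + a.1 * a.2.2 + a.2.1 * a.2.2)
      + 3 * (a.1 * a.2.1 * a.2.2)) = (∑ x : F, (χ ^ 3) x * ψ (x ^ 3)) ^ 3 := by
    rw [← sum_triple_mul]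
    refine Finset.sum_congr rfl fun a _ => ?_
    rw [show (a.1 + a.2.1 + a.2.2) ^ 3
      - 3 * (a.1 + a.2.1 + a.2.2) * (a.1 * a.2.1 + a.1 * a.2.2 + a.2.1 * a.2.2)
      + 3 * (a.1 * a.2.1 * a.2.2) = a.1 ^ 3 + a.2.1 ^ 3 + a.2.2 ^ 3 by ring]
    simp only [map_mul, AddChar.map_add_eq_mul]
    ring
  have k2 : ∑ b : F × E₂, (χ ^ 3) (b.1 * Algebra.norm F b.2) *
      ψ ((b.1 + Algebra.trace F E₂ b.2) ^ 3 - 3 * (b.1 + Algebra.trace F E₂ b.2) *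
        (b.1 * Algebra.trace F E₂ b.2 + Algebra.norm F b.2) + 3 * (b.1 * Algebra.norm F b.2)) =
      (∑ x : F, (χ ^ 3) x * ψ (x ^ 3)) *
        ∑ w : E₂, (χ ^ 3) (Algebra.norm F w) * ψ (Algebra.trace F E₂ (w ^ 3)) := by
    rw [← sum_pair_mul]
    refine Finset.sum_congr rfl fun b _ => ?_
    rw [show (b.1 + Algebra.trace F E₂ b.2) ^ 3 - 3 * (b.1 + Algebra.trace F E₂ b.2) *
        (b.1 * Algebra.trace F E₂ b.2 + Algebra.norm F b.2) + 3 * (b.1 * Algebra.norm F b.2) =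
        b.1 ^ 3 + Algebra.trace F E₂ (b.2 ^ 3) by rw [trace_cube_of_finrank_two h₂]; ring]
    simp only [map_mul, AddChar.map_add_eq_mul]
    ring
  simp only [← trace_cube_of_finrank_three h₃] at key
  rw [sum_cubic_powerSum hψ h3, k1, k2, s1, s2, s3] at key
  have h27 : (χ ^ 3)⁻¹ 3 = χ⁻¹ 27 := by
    rw [← inv_pow, MulChar.pow_apply' _ three_ne_zero, ← map_pow]
    norm_num
  rw [h27] at key
  linear_combination -key / 6

end GaussSum

/-- The `m = 3` specialization of the Davenport–Hasse relation: if `q ≡ 1 (mod 3)` and `χ₃`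
has exact order 3, then `G(χ) · G(χχ₃) · G(χχ₃²) = q · G(χ³) · χ⁻¹(27)`. -/
theorem davenport_hasse_m_three
    (p r : ℕ) (hp : p.Prime) (hodd : Odd p) (hr : 0 < r)
    (F : Type) [Field F] [Fintype F] (hcard : Fintype.card F = p ^ r)
    (ψ : AddChar F ℂ) (hψ : ψ ≠ 1)
    (hq3 : p ^ r % 3 = 1)
    (χ₃ : MulChar F ℂ) (hχ₃ : orderOf χ₃ = 3)
    (χ : MulChar F ℂ) :
    gaussSum χ ψ * gaussSum (χ * χ₃) ψ * gaussSum (χ * χ₃ ^ 2) ψ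
      = (p : ℂ) ^ r * gaussSum (χ ^ 3) ψ * χ⁻¹ (27 : F) := by
  have : Fact p.Prime := ⟨hp⟩
  have : CharP F p := charP_of_card_eq_prime_pow hcard
  have h3 : (3 : F) ≠ 0 := by
    intro h
    have hdvd : p ∣ 3 := (CharP.cast_eq_zero_iff F p 3).1 (by exact_mod_cast h)
    obtain rfl := (Nat.prime_dvd_prime_iff_eq hp Nat.prime_three).1 hdvd
    have := dvd_pow_self 3 hr.ne'
    omega
  have := Fintype.ofFinite (FiniteField.Extension F p 2)
  have := Fintype.ofFinite (FiniteField.Extension F p 3)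
  rw [gaussSum_mul_gaussSum_mul_gaussSum_of_orderOf_eq_three
    (FiniteField.finrank_extension F p 2) (FiniteField.finrank_extension F p 3) hψ h3 hχ₃ χ, hcard]
  push_cast
  rfl
end

section
/- Suppose q ≡ 1 (mod 3) (so q ≡ 1 (mod 6) since q is odd), and let χ₆ be a multiplicative character of F_q of exact order 6. Then for every multiplicative character χ of F_q, one has ∏_{j=0}^{5} G(χ · χ₆^j) = q² · φ(−1) · G(φ) · G(χ⁶) · (χ^{−1}(6))⁶, as an identity of complex numbers (this is the m = 6 specialization of the Davenport–Hasse relation). -/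
open Finset

lemma card_cubic_roots_le_one_add_sum {F : Type*} [Field F] [Fintype F] [DecidableEq F]
    (h2 : (2 : F) ≠ 0) (h3 : (3 : F) ≠ 0)
    {z : F} (hz : z ^ 2 = -3) {ω : MulChar F ℂ} (hω : ω ^ 3 = 1) {n : F} (hn : n ≠ 0) (w : F) :
    ∃ k : ℤ, ∑ v with v ^ 2 - w * v + n ^ 3 = 0, ω v = k ∧
      (#{x : F | x ^ 3 - 3 * n * x = w} : ℤ) ≤ 1 + k := by
  have hω3 : ∀ v : F, v ≠ 0 → ω v ^ 3 = 1 := fun v hv ↦ by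
    rw [← MulChar.pow_apply' _ (by norm_num), hω, MulChar.one_apply hv.isUnit]
  have key : ∀ x : F, x ^ 3 - 3 * n * x = w →
      w ^ 2 - 4 * n ^ 3 = (x ^ 2 - 4 * n) * (x ^ 2 - n) ^ 2 := by
    rintro x rfl; ring
  have hn3 : n ^ 3 ≠ 0 := pow_ne_zero _ hn
  by_cases hsq : IsSquare (w ^ 2 - 4 * n ^ 3)
  · obtain ⟨s, hs⟩ := hsq
    have hfac : ∀ v : F, v ^ 2 - w * v + n ^ 3 = (v - (w + s) / 2) * (v - (w - s) / 2) := by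
      intro v; field_simp; linear_combination -hs
    have hprod : (w + s) / 2 * ((w - s) / 2) = n ^ 3 := by
      field_simp; linear_combination hs
    have hset : ({v : F | v ^ 2 - w * v + n ^ 3 = 0} : Finset F)
        = {(w + s) / 2, (w - s) / 2} := by
      ext v; simp [hfac, sub_eq_zero]
    rw [hset]
    have hv1 : (w + s) / 2 ≠ 0 := fun h ↦ hn3 (by rw [← hprod, h, zero_mul])
    have hv2 : (w - s) / 2 ≠ 0 := fun h ↦ hn3 (by rw [← hprod, h, mul_zero])
    have hωprod : ω ((w + s) / 2) * ω ((w - s) / 2) = 1 := by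
      rw [← map_mul, hprod, map_pow, hω3 n hn]
    by_cases hs0 : s = 0
    · subst hs0
      refine ⟨1, ?_, ?_⟩
      · simp only [add_zero, sub_zero, pair_eq_singleton, sum_singleton] at *
        have := hω3 _ hv1
        push_cast
        linear_combination this - ω (w / 2) * hωprod
      · have : ({x : F | x ^ 3 - 3 * n * x = w} : Finset F) ⊆ {w / n, -w / (2 * n)} := by
          intro x hx
          simp only [mem_filter, mem_univ, true_and] at hx
          have h := key x hx
          rw [hs, mul_zero] at h
          simp only [mem_insert, mem_singleton]
          rcases mul_eq_zero.1 h.symm with h | h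
          · left; field_simp; linear_combination hx - x * h
          · right
            have h := pow_eq_zero_iff (two_ne_zero) |>.1 h
            field_simp; linear_combination -hx + x * h
        have := (card_le_card this).trans card_le_two
        omega
    · have hne : (w + s) / 2 ≠ (w - s) / 2 := by
        intro h
        have : 2 * s = 0 := by field_simp at h; linear_combination h
        simp_all
      rw [sum_pair hne]
      by_cases h1 : ω ((w + s) / 2) = 1
      · refine ⟨2, ?_, ?_⟩
        · rw [h1, one_mul] at hωprod
          rw [h1, hωprod]; norm_num
        · let P : Polynomial F := .X ^ 3 - .C (3 * n) * .X - .C w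
          have hdeg : P.natDegree = 3 := by simp only [P]; compute_degree!
          have hP : P ≠ 0 := by intro h; rw [h] at hdeg; simp at hdeg
          have : ({x : F | x ^ 3 - 3 * n * x = w} : Finset F) ⊆ P.roots.toFinset := by
            intro x hx
            simp only [mem_filter, mem_univ, true_and] at hx
            rw [Multiset.mem_toFinset, Polynomial.mem_roots hP]
            simp [P, hx]
          have := (card_le_card this).trans ((Multiset.toFinset_card_le _).trans P.card_roots')
          omega
      · refine ⟨-1, ?_, ?_⟩
        · have h3' := hω3 _ hv1
          set a := ω ((w + s) / 2)
          have hq : a ^ 2 + a + 1 = 0 := by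
            have : (a - 1) * (a ^ 2 + a + 1) = 0 := by linear_combination h3'
            exact (mul_eq_zero.1 this).resolve_left (sub_ne_zero.2 h1)
          push_cast
          linear_combination (-a - 1) * hωprod + ω ((w - s) / 2) * hq
        · have : ({x : F | x ^ 3 - 3 * n * x = w} : Finset F) = ∅ := by
            refine filter_eq_empty_iff.2 fun x _ hx ↦ h1 ?_
            have h := key x hx
            have hx0 : x ^ 2 - n ≠ 0 := by
              intro h0; rw [h0, hs] at h; simp [hs0] at h
            have hcube : (w + s) / 2 = ((x + s / (x ^ 2 - n)) / 2) ^ 3 := by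
              have ht : (s / (x ^ 2 - n)) ^ 2 = x ^ 2 - 4 * n := by
                rw [div_pow, div_eq_iff (pow_ne_zero _ hx0), ← h, hs, sq]
              have hst : s = s / (x ^ 2 - n) * (x ^ 2 - n) := by field_simp
              generalize s / (x ^ 2 - n) = t at ht hst
              rw [hst, ← hx]
              field_simp
              linear_combination (-3 * x - t) * ht
            have hu : (x + s / (x ^ 2 - n)) / 2 ≠ 0 := by
              intro h0; rw [h0] at hcube; exact hv1 (by simpa using hcube)
            rw [hcube, map_pow, hω3 _ hu]
          simp [this]
  · refine ⟨0, ?_, ?_⟩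
    · rw [filter_eq_empty_iff.2]
      · simp
      · rintro v - hv
        exact hsq ⟨2 * v - w, by linear_combination -4 * hv⟩
    · have : #{x : F | x ^ 3 - 3 * n * x = w} ≤ 1 := by
        refine card_le_one.2 fun x hx y hy ↦ ?_
        simp only [mem_filter, mem_univ, true_and] at hx hy
        by_contra hxy
        have h : y ^ 2 + x * y + x ^ 2 = 3 * n := by
          have : (x - y) * (y ^ 2 + x * y + x ^ 2 - 3 * n) = 0 := by
            linear_combination hx - hy
          linear_combination (mul_eq_zero.1 this).resolve_left (sub_ne_zero.2 hxy)
        refine hsq ⟨(2 * y + x) / z * (x ^ 2 - n), ?_⟩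
        have hz0 : z ≠ 0 := by rintro rfl; simp_all
        have : ((2 * y + x) / z) ^ 2 = x ^ 2 - 4 * n := by
          rw [div_pow, hz]; field_simp; linear_combination -4 * h
        rw [key x hx, ← this]; ring
      omega

lemma sum_sum_mulChar_quadratic {F : Type*} [Field F] [Fintype F] [DecidableEq F]
    (ω : MulChar F ℂ) (n : F) (g : F → ℂ) :
    ∑ w, (∑ v with v ^ 2 - w * v + n ^ 3 = 0, ω v) * g w = ∑ v, ω v * g (v + n ^ 3 / v) := by
  simp_rw [sum_mul, sum_filter]
  rw [sum_comm]
  refine sum_congr rfl fun v _ ↦ ?_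
  by_cases hv : v = 0
  · simp [hv, MulChar.map_zero]
  · have : ∀ w, v ^ 2 - w * v + n ^ 3 = 0 ↔ v + n ^ 3 / v = w := fun w ↦ by
      constructor
      · intro h; field_simp; linear_combination h
      · rintro rfl; field_simp; ring
    simp_rw [this]
    rw [sum_ite_eq]; simp

lemma card_cubic_roots_eq_one_add_sum {F : Type*} [Field F] [Fintype F] [DecidableEq F]
    (h2 : (2 : F) ≠ 0) (h3 : (3 : F) ≠ 0) {z : F} (hz : z ^ 2 = -3) {ω : MulChar F ℂ}
    (hω : ω ^ 3 = 1) (hω1 : ω ≠ 1) {n : F} (hn : n ≠ 0) (w : F) :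
    (#{x : F | x ^ 3 - 3 * n * x = w} : ℂ) = 1 + ∑ v with v ^ 2 - w * v + n ^ 3 = 0, ω v := by
  choose k hk hle using card_cubic_roots_le_one_add_sum h2 h3 hz hω hn
  have hk0 : ∑ w, k w = 0 := by
    have := sum_sum_mulChar_quadratic ω n 1
    simp only [Pi.one_apply, mul_one, hk, MulChar.sum_eq_zero_of_ne_one hω1] at this
    exact_mod_cast this
  have hcard : ∑ w, #{x : F | x ^ 3 - 3 * n * x = w} = Fintype.card F :=
    (card_eq_sum_card_fiberwise fun _ _ ↦ mem_univ _).symm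
  have heq := (sum_eq_sum_iff_of_le fun w (_ : w ∈ univ) ↦ hle w).1 (by
    rw [sum_add_distrib, hk0, ← Nat.cast_sum, hcard]; simp) w (mem_univ w)
  rw [hk]
  exact_mod_cast heq

/-- A cubic exponential sum is a Kloosterman sum twisted by a cubic character. -/
lemma sum_addChar_cubic {F : Type*} [Field F] [Fintype F]
    (h2 : (2 : F) ≠ 0) (h3 : (3 : F) ≠ 0) {z : F} (hz : z ^ 2 = -3) {ω : MulChar F ℂ}
    (hω : ω ^ 3 = 1) (hω1 : ω ≠ 1) {n : F} (hn : n ≠ 0) {ψ : AddChar F ℂ} (hψ : ψ ≠ 1) :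
    ∑ x, ψ (x ^ 3 - 3 * n * x) = ∑ v, ω v * ψ (v + n ^ 3 / v) := by
  classical
  rw [← sum_sum_mulChar_quadratic ω n, ← sum_fiberwise univ (fun x : F ↦ x ^ 3 - 3 * n * x)]
  have : ∀ w, ∑ x with x ^ 3 - 3 * n * x = w, ψ (x ^ 3 - 3 * n * x)
      = ψ w + (∑ v with v ^ 2 - w * v + n ^ 3 = 0, ω v) * ψ w := fun w ↦ by
    rw [sum_congr rfl (g := fun _ ↦ ψ w) (by simp +contextual), sum_const, nsmul_eq_mul,
      card_cubic_roots_eq_one_add_sum h2 h3 hz hω hω1 hn]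
    ring
  simp_rw [this, sum_add_distrib, AddChar.sum_eq_zero_of_ne_one hψ, zero_add]

lemma kloosterman_eq_sum_cubic {F : Type*} [Field F] [Fintype F]
    (h2 : (2 : F) ≠ 0) (h3 : (3 : F) ≠ 0) {z : F} (hz : z ^ 2 = -3) {ω : MulChar F ℂ}
    (hω : ω ^ 3 = 1) (hω1 : ω ≠ 1) {b : F} (hb : b ≠ 0) {ψ : AddChar F ℂ} (hψ : ψ ≠ 1) :
    ∑ v, ω v * ψ (v + b / v) = (ω ^ 2) b * ∑ x, ψ (x ^ 3 / b - 3 * x) := by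
  have h := sum_addChar_cubic h2 h3 hz hω hω1 hb
    (AddChar.IsPrimitive.of_ne_one hψ (inv_ne_zero hb))
  simp only [AddChar.mulShift_apply] at h
  have h' : ∀ x, ψ (x ^ 3 / b - 3 * x) = ψ (b⁻¹ * (x ^ 3 - 3 * b * x)) := fun x ↦ by
    congr 1; field_simp
  simp_rw [h', h]
  rw [← Equiv.sum_comp (Equiv.mulLeft₀ b hb) (fun v ↦ ω v * ψ (b⁻¹ * (v + b ^ 3 / v))), mul_sum]
  refine sum_congr rfl fun v _ ↦ ?_
  by_cases hv : v = 0
  · simp [hv, MulChar.map_zero]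
  have hωb : (ω ^ 2) b * ω b = 1 := by
    rw [← MulChar.mul_apply, ← pow_succ, hω, MulChar.one_apply hb.isUnit]
  have : b⁻¹ * (b * v + b ^ 3 / (b * v)) = v + b / v := by field_simp
  simp only [Equiv.mulLeft₀_apply, map_mul, this]
  linear_combination (- ω v * ψ (v + b / v)) * hωb

lemma gaussSum_mul_gaussSum_mul_eq_sum {F : Type*} [Field F] [Fintype F]
    (χ ω : MulChar F ℂ) (ψ : AddChar F ℂ) :
    gaussSum χ ψ * gaussSum (χ * ω) ψ = ∑ b, χ b * ∑ v, ω v * ψ (v + b / v) := by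
  simp_rw [mul_sum]
  rw [sum_comm]
  unfold gaussSum
  rw [mul_sum]
  refine sum_congr rfl fun v _ ↦ ?_
  by_cases hv : v = 0
  · simp [hv, MulChar.map_zero]
  rw [← Equiv.sum_comp (Equiv.mulLeft₀ v⁻¹ (inv_ne_zero hv)), sum_mul]
  refine sum_congr rfl fun b _ ↦ ?_
  have h1 : χ v⁻¹ * χ v = 1 := by rw [← map_mul, inv_mul_cancel₀ hv, map_one]
  simp only [Equiv.mulLeft₀_apply, map_mul, MulChar.mul_apply, AddChar.map_add_eq_mul,
    div_eq_inv_mul]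
  linear_combination (χ b * ψ (v⁻¹ * b) * ω v * ψ v) * h1

lemma sum_mulChar_mul_sum_cubic {F : Type*} [Field F] [Fintype F] (h3 : (3 : F) ≠ 0)
    {η : MulChar F ℂ} (hη : η ≠ 1) (ψ : AddChar F ℂ) :
    ∑ b, η b * ∑ x, ψ (x ^ 3 / b - 3 * x)
      = (η⁻¹ ^ 3) (-3) * gaussSum (η ^ 3) ψ * gaussSum η⁻¹ ψ := by
  have h3' : (-3 : F) ≠ 0 := neg_ne_zero.2 h3
  have hsub : (η⁻¹ ^ 3) (-3) * gaussSum (η ^ 3) ψ = ∑ x, (η ^ 3) x * ψ (-3 * x) := by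
    rw [← gaussSum_mulShift (η ^ 3) ψ (Units.mk0 _ h3')]
    simp only [Units.val_mk0, inv_pow, ← mul_assoc]
    rw [← MulChar.mul_apply, inv_mul_cancel, MulChar.one_apply h3'.isUnit, one_mul]
    rfl
  rw [hsub, sum_mul]
  simp_rw [mul_sum]
  rw [sum_comm]
  refine sum_congr rfl fun x _ ↦ ?_
  by_cases hx : x = 0
  · simp [hx, MulChar.map_zero, MulChar.sum_eq_zero_of_ne_one hη]
  unfold gaussSum
  rw [mul_sum, ← ((Equiv.inv F).trans (Equiv.mulLeft₀ _ (pow_ne_zero 3 hx))).sum_comp]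
  refine sum_congr rfl fun d _ ↦ ?_
  by_cases hd : d = 0
  · simp [hd, MulChar.map_zero]
  have : x ^ 3 / (x ^ 3 * d⁻¹) - 3 * x = -3 * x + d := by field_simp; ring
  simp only [Equiv.trans_apply, Equiv.inv_apply, Equiv.mulLeft₀_apply, this,
    AddChar.map_add_eq_mul, map_mul, MulChar.inv_apply', MulChar.pow_apply' _ three_ne_zero, map_pow]
  ring

/-- The Davenport–Hasse product formula for cubic characters. -/
theorem gaussSum_mul_cubic {F : Type*} [Field F] [Fintype F]
    (h2 : (2 : F) ≠ 0) (h3 : (3 : F) ≠ 0) {z : F} (hz : z ^ 2 = -3) {ω : MulChar F ℂ}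
    (hω : ω ^ 3 = 1) (hω1 : ω ≠ 1) {ψ : AddChar F ℂ} (hψ : ψ ≠ 1) (χ : MulChar F ℂ) :
    gaussSum χ ψ * gaussSum (χ * ω) ψ * gaussSum (χ * ω ^ 2) ψ
      = Fintype.card F * χ⁻¹ 27 * gaussSum (χ ^ 3) ψ := by
  have h27 : (27 : F) ≠ 0 := by
    rw [show (27 : F) = 3 ^ 3 by norm_num]; exact pow_ne_zero _ h3
  have hneg : ∀ α : MulChar F ℂ, α (-1) * α (-1) = 1 := fun α ↦ by
    rw [← map_mul]; simp
  have hcard : ∀ α : MulChar F ℂ, α ≠ 1 →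
      gaussSum α ψ * gaussSum α⁻¹ ψ = α (-1) * Fintype.card F := fun α hα ↦ by
    rw [← gaussSum_mul_gaussSum_eq_card hα (AddChar.IsPrimitive.of_ne_one hψ),
      ← mul_gaussSum_inv_eq_gaussSum α⁻¹ ψ, MulChar.inv_apply', inv_neg_one]
    ring
  have hωneg : ω (-1) = 1 := by
    have h := hneg ω
    have h' : ω (-1) ^ 3 = 1 := by
      rw [← MulChar.pow_apply' _ three_ne_zero, hω, MulChar.one_apply (by simp)]
    linear_combination h' - ω (-1) * h
  by_cases hη : χ * ω ^ 2 = 1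
  · have hχ : χ = ω := by
      calc χ = χ * ω ^ 3 := by rw [hω, mul_one]
        _ = (χ * ω ^ 2) * ω := by rw [pow_succ ω 2, mul_assoc]
        _ = ω := by rw [hη, one_mul]
    have hχω : χ * ω = ω⁻¹ := by
      rw [hχ, eq_inv_iff_mul_eq_one, ← hω, pow_three' ω]
    have hω27 : ω⁻¹ 27 = 1 := by
      rw [show (27 : F) = 3 ^ 3 by norm_num, map_pow, ← MulChar.pow_apply' _ three_ne_zero,
        inv_pow, hω, inv_one, MulChar.one_apply h3.isUnit]
    rw [hη, hχω, hχ, hω27, hω, hcard ω hω1, hωneg]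
    ring
  · set η := χ * ω ^ 2 with hηdef
    have hη3 : η ^ 3 = χ ^ 3 := by
      rw [hηdef, mul_pow, ← pow_mul, mul_comm 2 3, pow_mul, hω, one_pow, mul_one]
    have hsum : gaussSum χ ψ * gaussSum (χ * ω) ψ = ∑ b, η b * ∑ x, ψ (x ^ 3 / b - 3 * x) := by
      rw [gaussSum_mul_gaussSum_mul_eq_sum]
      refine sum_congr rfl fun b _ ↦ ?_
      by_cases hb : b = 0
      · simp [hb, MulChar.map_zero]
      rw [kloosterman_eq_sum_cubic h2 h3 hz hω hω1 hb hψ, hηdef, MulChar.mul_apply, mul_assoc]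
    rw [hsum, sum_mulChar_mul_sum_cubic h3 hη, hη3]
    have hηneg : η (-1) = χ (-1) := by
      rw [hηdef, MulChar.mul_apply, MulChar.pow_apply' _ two_ne_zero, hωneg]; simp
    have h27' : (η⁻¹ ^ 3) (-3) = χ (-1) * χ⁻¹ 27 := by
      rw [inv_pow, hη3, ← inv_pow, MulChar.pow_apply' _ three_ne_zero, ← map_pow,
        show (-3 : F) ^ 3 = -1 * 27 by norm_num, map_mul, MulChar.inv_apply', inv_neg_one]
    have := hcard η hη
    rw [hηneg] at this
    rw [h27']
    linear_combination (χ (-1) * χ⁻¹ 27 * gaussSum (χ ^ 3) ψ) * this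
      + (χ⁻¹ 27 * gaussSum (χ ^ 3) ψ * Fintype.card F) * hneg χ

lemma MulChar.eq_quadraticChar_of_orderOf_eq_two {F : Type*} [Field F] [Fintype F] [DecidableEq F]
    {φ : MulChar F ℂ} (hφ : orderOf φ = 2) (a : F) : φ a = quadraticChar F a := by
  have hφ2 : ∀ a : F, a ≠ 0 → φ a ^ 2 = 1 := fun a ha ↦ by
    rw [← MulChar.pow_apply' _ two_ne_zero, ← hφ, pow_orderOf_eq_one, MulChar.one_apply ha.isUnit]
  have hsq : ∀ a : F, a ≠ 0 → quadraticChar F a = 1 → φ a = 1 := fun a ha h ↦ by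
    obtain ⟨s, rfl⟩ := (quadraticChar_one_iff_isSquare ha).1 h
    rw [← sq, map_pow, hφ2 s (by simpa using ha)]
  by_cases ha : a = 0
  · simp [ha]
  rcases quadraticChar_dichotomy ha with h | h
  · rw [hsq a ha h, h]; simp
  · rw [h]
    obtain ⟨g, hg⟩ : ∃ g : Fˣ, φ g ≠ 1 := by
      by_contra! H
      have : φ = 1 := MulChar.ext fun g ↦ by rw [H g, MulChar.one_apply_coe]
      simp [this] at hφ
    have hg1 : φ g = -1 := (eq_or_eq_neg_of_sq_eq_sq _ _ (by rw [hφ2 g g.ne_zero, one_pow])).resolve_left hg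
    have hqg : quadraticChar F g = -1 :=
      (quadraticChar_dichotomy g.ne_zero).resolve_left fun h ↦ hg (hsq _ g.ne_zero h)
    have := hsq (a * g) (mul_ne_zero ha g.ne_zero) (by rw [map_mul, h, hqg]; norm_num)
    rw [map_mul, hg1] at this
    push_cast
    linear_combination -this

lemma jacobiSum_self {F : Type*} [Field F] [Fintype F] (h2 : (2 : F) ≠ 0)
    {φ : MulChar F ℂ} (hφ : orderOf φ = 2) {χ : MulChar F ℂ} (hχ : χ ≠ 1) :
    jacobiSum χ χ = χ⁻¹ 4 * jacobiSum χ φ := by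
  classical
  have h4 : (4 : F) ≠ 0 := by rw [show (4 : F) = 2 * 2 by norm_num]; exact mul_ne_zero h2 h2
  have hchar : ringChar F ≠ 2 := fun h ↦ h2 (by
    have := ringChar.Nat.cast_ringChar (R := F); rw [h] at this; exact_mod_cast this)
  have hcount : ∀ u : F, (#{x : F | x * (1 - x) = u} : ℂ) = 1 + φ (1 - 4 * u) := fun u ↦ by
    rw [MulChar.eq_quadraticChar_of_orderOf_eq_two hφ]
    have h := quadraticChar_card_sqrts hchar (1 - 4 * u)
    have : #{x : F | x * (1 - x) = u} = #({x : F | x ^ 2 = 1 - 4 * u} : Set F).toFinset := by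
      refine card_bij' (fun x _ ↦ 2 * x - 1) (fun y _ ↦ (y + 1) / 2) ?_ ?_ ?_ ?_
      · intro x hx
        simp only [mem_filter, mem_univ, true_and, Set.mem_toFinset, Set.mem_ofPred_eq] at hx ⊢
        linear_combination -4 * hx
      · intro y hy
        simp only [mem_filter, mem_univ, true_and, Set.mem_toFinset, Set.mem_ofPred_eq] at hy ⊢
        field_simp; linear_combination -hy
      · intro x _; field_simp; ring
      · intro y _; field_simp; ring
    rw [this, add_comm]
    exact_mod_cast h
  have h1 : jacobiSum χ χ = ∑ u, χ u * φ (1 - 4 * u) := by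
    unfold jacobiSum
    simp_rw [← map_mul]
    rw [← sum_fiberwise univ (fun x : F ↦ x * (1 - x))]
    have : ∀ u, ∑ x with x * (1 - x) = u, χ (x * (1 - x)) = χ u + χ u * φ (1 - 4 * u) := fun u ↦ by
      rw [sum_congr rfl (g := fun _ ↦ χ u) (by simp +contextual), sum_const, nsmul_eq_mul, hcount]
      ring
    simp_rw [this, sum_add_distrib, MulChar.sum_eq_zero_of_ne_one hχ, zero_add]
  rw [h1, jacobiSum, ← Equiv.sum_comp (Equiv.mulLeft₀ 4 h4) (fun x ↦ χ x * φ (1 - x)), mul_sum]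
  refine sum_congr rfl fun u _ ↦ ?_
  have h : χ⁻¹ 4 * χ 4 = 1 := by
    rw [← MulChar.mul_apply, inv_mul_cancel, MulChar.one_apply h4.isUnit]
  simp only [Equiv.mulLeft₀_apply, map_mul]
  linear_combination (-χ u * φ (1 - 4 * u)) * h

/-- The Davenport–Hasse product formula for the quadratic character. -/
theorem gaussSum_mul_quadratic {F : Type*} [Field F] [Fintype F] (h2 : (2 : F) ≠ 0)
    {φ : MulChar F ℂ} (hφ : orderOf φ = 2) {ψ : AddChar F ℂ} (hψ : ψ ≠ 1) (χ : MulChar F ℂ) :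
    gaussSum χ ψ * gaussSum (χ * φ) ψ = χ⁻¹ 4 * gaussSum φ ψ * gaussSum (χ ^ 2) ψ := by
  have h4 : (4 : F) ≠ 0 := by rw [show (4 : F) = 2 * 2 by norm_num]; exact mul_ne_zero h2 h2
  have hφ2 : φ ^ 2 = 1 := by rw [← hφ, pow_orderOf_eq_one]
  by_cases hχ : χ = 1
  · simp [hχ, MulChar.one_apply h4.isUnit, mul_comm]
  by_cases hχφ : χ * φ = 1
  · have : χ = φ := by
      rw [eq_inv_of_mul_eq_one_left hχφ, inv_eq_iff_mul_eq_one, ← sq, hφ2]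
    have hφ4 : φ⁻¹ 4 = 1 := by
      rw [show (4 : F) = 2 ^ 2 by norm_num, map_pow, ← MulChar.pow_apply' _ two_ne_zero,
        inv_pow, hφ2, inv_one, MulChar.one_apply h2.isUnit]
    rw [this, hφ4, ← sq φ, one_mul]
  have hχ2 : χ * χ ≠ 1 := fun h ↦ hχφ <| by
    classical
    have hχ' : orderOf χ = 2 := orderOf_eq_prime (by rw [sq, h]) hχ
    have : χ = φ := MulChar.ext fun a ↦ by
      rw [MulChar.eq_quadraticChar_of_orderOf_eq_two hχ',
        MulChar.eq_quadraticChar_of_orderOf_eq_two hφ]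
    rw [this, ← sq, hφ2]
  have hG : gaussSum χ ψ ≠ 0 := gaussSum_ne_zero_of_nontrivial
    (by exact_mod_cast Fintype.card_ne_zero) hχ (AddChar.IsPrimitive.of_ne_one hψ)
  have e1 := jacobiSum_mul_nontrivial hχ2 ψ
  have e2 := jacobiSum_mul_nontrivial hχφ ψ
  rw [jacobiSum_self h2 hφ hχ, ← sq χ] at e1
  refine mul_left_cancel₀ hG ?_
  linear_combination -gaussSum (χ * φ) ψ * e1 + χ⁻¹ 4 * gaussSum (χ ^ 2) ψ * e2


/-- The `m = 6` specialization of the Davenport–Hasse relation: if `q ≡ 1 (mod 3)` (hence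
`q ≡ 1 (mod 6)` since `q` is odd) and `χ₆` has exact order 6, then
`∏_{j=0}^{5} G(χ·χ₆^j) = q² · φ(−1) · G(φ) · G(χ⁶) · (χ⁻¹(6))⁶`, where `φ` is the quadratic
character (the unique multiplicative character of order 2). -/
theorem davenport_hasse_m_six
    (p r : ℕ) (hp : p.Prime) (hodd : Odd p) (hr : 0 < r)
    (F : Type) [Field F] [Fintype F] (hcard : Fintype.card F = p ^ r)
    (ψ : AddChar F ℂ) (hψ : ψ ≠ 1)
    (hq3 : p ^ r % 3 = 1)
    (χ₆ : MulChar F ℂ) (hχ₆ : orderOf χ₆ = 6)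
    (φ : MulChar F ℂ) (hφ : orderOf φ = 2)
    (χ : MulChar F ℂ) :
    (∏ j ∈ Finset.range 6, gaussSum (χ * χ₆ ^ j) ψ)
      = ((p : ℂ) ^ r) ^ 2 * φ (-1 : F) * gaussSum φ ψ * gaussSum (χ ^ 6) ψ
          * (χ⁻¹ (6 : F)) ^ 6 := by
  have hcast : ((p ^ r : ℕ) : F) = 0 := by rw [← hcard]; exact FiniteField.cast_card_eq_zero F
  have h2 : (2 : F) ≠ 0 := fun h ↦ by
    obtain ⟨k, hk⟩ := hodd.pow (n := r)
    rw [hk] at hcast; simp [h] at hcast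
  have h3 : (3 : F) ≠ 0 := fun h ↦ by
    rw [← Nat.div_add_mod (p ^ r) 3, hq3] at hcast; simp [h] at hcast
  obtain ⟨z, hz⟩ : ∃ z : F, z ^ 2 = -3 := by
    classical
    have : Fact (Nat.Prime 3) := ⟨Nat.prime_three⟩
    obtain ⟨ζ, hζ⟩ := exists_prime_orderOf_dvd_card (G := Fˣ) 3
      (by rw [Fintype.card_units, hcard]; omega)
    have hζ3 : (ζ : F) ^ 3 = 1 := by
      rw [← Units.val_pow_eq_pow_val, ← hζ, pow_orderOf_eq_one, Units.val_one]
    have hζ1 : (ζ : F) - 1 ≠ 0 := fun h ↦ by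
      rw [sub_eq_zero, Units.val_eq_one] at h
      simp [h] at hζ
    have hsum : (ζ : F) ^ 2 + ζ + 1 = 0 := by
      have : ((ζ : F) - 1) * (ζ ^ 2 + ζ + 1) = 0 := by linear_combination hζ3
      exact (mul_eq_zero.1 this).resolve_left hζ1
    exact ⟨1 + 2 * ζ, by linear_combination 4 * hsum⟩
  have ho2 : orderOf (χ₆ ^ 3) = 2 := by rw [orderOf_pow, hχ₆]; norm_num
  have hφχ : χ₆ ^ 3 = φ := MulChar.ext fun a ↦ by
    classical
    rw [MulChar.eq_quadraticChar_of_orderOf_eq_two ho2,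
      MulChar.eq_quadraticChar_of_orderOf_eq_two hφ]
  have h61 : χ₆ ^ 6 = 1 := by rw [← hχ₆, pow_orderOf_eq_one]
  have hω : (χ₆ ^ 2) ^ 3 = 1 := by rw [← pow_mul, h61]
  have hω1 : χ₆ ^ 2 ≠ 1 := pow_ne_one_of_lt_orderOf two_ne_zero (by rw [hχ₆]; norm_num)
  have e0 := gaussSum_mul_cubic h2 h3 hz hω hω1 hψ χ
  have e1 := gaussSum_mul_cubic h2 h3 hz hω hω1 hψ (χ * φ)
  have e2 := gaussSum_mul_quadratic h2 hφ hψ (χ ^ 3)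
  have hφ2 : φ ^ 2 = 1 := by rw [← hφ, pow_orderOf_eq_one]
  have hφ3 : φ ^ 3 = φ := by rw [pow_succ, hφ2, one_mul]
  have hφ27 : φ⁻¹ 27 = φ (-1) := by
    have hz0 : z ≠ 0 := by
      rintro rfl
      exact h3 (by simpa using hz)
    have hφz : φ (z ^ 2) = 1 := by
      rw [map_pow, ← MulChar.pow_apply' _ two_ne_zero, hφ2, MulChar.one_apply hz0.isUnit]
    rw [inv_eq_of_mul_eq_one_left (by rw [← sq, hφ2] : φ * φ = 1),
      show (27 : F) = -1 * (z ^ 2) ^ 3 by rw [hz]; norm_num, map_mul, map_pow φ (z ^ 2), hφz]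
    simp
  have hχ6 : χ⁻¹ 6 ^ 6 = χ⁻¹ 27 ^ 2 * (χ ^ 3)⁻¹ 4 := by
    rw [← inv_pow, MulChar.pow_apply' _ three_ne_zero]
    simp only [← map_pow, ← map_mul]
    norm_num
  have hχφ : (χ * φ)⁻¹ 27 = χ⁻¹ 27 * φ (-1) := by
    rw [mul_inv, MulChar.mul_apply, hφ27]
  have h5 : χ * φ * χ₆ ^ 2 = χ * χ₆ ^ 5 := by rw [← hφχ, mul_assoc, ← pow_add]
  have h7 : χ * φ * (χ₆ ^ 2) ^ 2 = χ * χ₆ ^ 1 := by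
    rw [← hφχ, mul_assoc, ← pow_mul, ← pow_add, show 3 + 2 * 2 = 6 + 1 by norm_num, pow_add, h61,
      one_mul]
  have hq : (Fintype.card F : ℂ) = (p : ℂ) ^ r := by rw [hcard]; push_cast; rfl
  rw [← pow_mul χ₆, hq] at e0
  rw [h5, h7, ← hφχ, hφχ, mul_pow, hφ3, hχφ, hq] at e1
  rw [← pow_mul] at e2
  simp only [prod_range_succ, prod_range_zero, pow_zero, mul_one, one_mul, hφχ, hχ6]
  calc _ = (gaussSum χ ψ * gaussSum (χ * χ₆ ^ 2) ψ * gaussSum (χ * χ₆ ^ 4) ψ) *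
        (gaussSum (χ * φ) ψ * gaussSum (χ * χ₆ ^ 5) ψ * gaussSum (χ * χ₆ ^ 1) ψ) := by ring
    _ = ((p : ℂ) ^ r) ^ 2 * φ (-1) * χ⁻¹ 27 ^ 2 *
        (gaussSum (χ ^ 3) ψ * gaussSum (χ ^ 3 * φ) ψ) := by rw [e0, e1]; ring
    _ = _ := by rw [e2]; ring
end

section
/- Let p > 3 be a prime, q = p^r with q ≡ 1 (mod 3), and let a ∈ F_q^×. Then Σ_{x,y,z ∈ F_q^×} ψ(z(1 + x³ + y³ − 3axy)) = (1/(q−1)) Σ_{l=0}^{q−2} G_{−l}³ G_{3l} T^{−3l}(−3a) + (2/(q−1)) Σ_{l=0}^{q−2} G_{−l} G_{−l−(q−1)/3} G_{−l−2(q−1)/3} G_{3l} T^{−3l}(−3a), as an identity of complex numbers (indices of G and exponents of T are taken modulo q−1). -/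
theorem MulChar.zpow_apply_units {F : Type*} [Field F] (χ : MulChar F ℂ) (k : ℤ) (u : Fˣ) :
    (χ ^ k) (u : F) = (χ u) ^ k := by
  have h := map_zpow (MulChar.mulEquivToUnitHom (R := F) (R' := ℂ)) χ k
  have h2 := congrArg (fun f : Fˣ →* ℂˣ => ((f u : ℂˣ) : ℂ)) h
  simpa [MulChar.mulEquivToUnitHom] using h2

theorem MulChar.apply_units_ne_zero {F : Type*} [Field F] (χ : MulChar F ℂ) (u : Fˣ) :
    χ (u : F) ≠ 0 :=
  (u.isUnit.map χ).ne_zero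

theorem MulChar.apply_units_inv {F : Type*} [Field F] (χ : MulChar F ℂ) (u : Fˣ) :
    χ ((u⁻¹ : Fˣ) : F) = (χ u)⁻¹ :=
  eq_inv_of_mul_eq_one_left (by rw [← map_mul, Units.inv_mul, map_one])

theorem MulChar.apply_units_div {F : Type*} [Field F] (χ : MulChar F ℂ) (u v : Fˣ) :
    χ ((u / v : Fˣ) : F) = χ u / χ v := by
  rw [div_eq_mul_inv, Units.val_mul, map_mul, χ.apply_units_inv, div_eq_mul_inv]

theorem sum_units_eq_sum {F : Type*} [Field F] [Fintype F] [DecidableEq F]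
    {M : Type*} [AddCommMonoid M] (f : F → M) (h : f 0 = 0) :
    ∑ u : Fˣ, f u = ∑ x : F, f x := by
  rw [← Finset.sum_subset (Finset.subset_univ ({0}ᶜ : Finset F)) (by simp [h])]
  refine Finset.sum_bij (fun u _ => (u : F)) (by simp) (fun _ _ _ _ => Units.ext)
    (fun b hb => ⟨Units.mk0 b (by simpa using hb), by simp⟩) (by simp)

theorem gaussSum_eq_sum_units {F : Type*} [Field F] [Fintype F] [DecidableEq F]
    (χ : MulChar F ℂ) (ψ : AddChar F ℂ) :
    gaussSum χ ψ = ∑ u : Fˣ, χ (u : F) * ψ (u : F) :=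
  (sum_units_eq_sum (fun x => χ x * ψ x) (by simp [MulChar.map_zero])).symm

theorem gaussSum_zpow_mul_zpow_neg {F : Type*} [Field F] [Fintype F] [DecidableEq F]
    (χ : MulChar F ℂ) (ψ : AddChar F ℂ) (k : ℤ) (d : Fˣ) :
    gaussSum (χ ^ k) ψ * (χ ^ (-k)) (d : F) = ∑ t : Fˣ, χ (t : F) ^ k * ψ (d * t) := by
  rw [gaussSum_eq_sum_units, Finset.sum_mul, ← Equiv.sum_comp (Equiv.mulLeft d)]
  refine Finset.sum_congr rfl fun t _ => ?_
  have := χ.apply_units_ne_zero d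
  rw [MulChar.zpow_apply_units, MulChar.zpow_apply_units]
  simp only [Equiv.coe_mulLeft, Units.val_mul, map_mul, mul_zpow, zpow_neg]
  field_simp

theorem orderOf_generator {F : Type*} [Field F] [Fintype F]
    {T : MulChar F ℂ} (hT : ∀ χ : MulChar F ℂ, χ ∈ Subgroup.zpowers T) :
    orderOf T = Fintype.card F - 1 := by
  rw [orderOf_eq_card_of_forall_mem_zpowers hT,
    MulChar.card_eq_card_units_of_hasEnoughRootsOfUnity F ℂ, Nat.card_units,
    Nat.card_eq_fintype_card]

theorem sum_range_generator_pow {F : Type*} [Field F] [Fintype F] [DecidableEq F]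
    {T : MulChar F ℂ} (hT : ∀ χ : MulChar F ℂ, χ ∈ Subgroup.zpowers T)
    (u : Fˣ) :
    ∑ l ∈ Finset.range (Fintype.card F - 1), T (u : F) ^ (l : ℤ) =
      if u = 1 then (Fintype.card F : ℂ) - 1 else 0 := by
  split_ifs with h
  · subst h
    simp [Nat.cast_sub Fintype.card_pos]
  · have h1 : T (u : F) ≠ 1 := by
      intro h1
      obtain ⟨χ, hχ⟩ := MulChar.exists_apply_ne_one_of_hasEnoughRootsOfUnity F ℂ
        (a := (u : F)) (by simpa using h)
      obtain ⟨k, rfl⟩ := hT χ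
      simp [MulChar.zpow_apply_units, h1] at hχ
    simp only [zpow_natCast]
    rw [geom_sum_eq h1, ← Fintype.card_units (α := F), ← map_pow,
      ← Units.val_pow_eq_pow_val, pow_card_eq_one]
    simp

theorem sum_units_generator_pow {F : Type*} [Field F] [Fintype F] [DecidableEq F]
    {T : MulChar F ℂ} (hT : ∀ χ : MulChar F ℂ, χ ∈ Subgroup.zpowers T)
    (k : ℕ) :
    ∑ u : Fˣ, T (u : F) ^ k =
      if Fintype.card F - 1 ∣ k then (Fintype.card F : ℂ) - 1 else 0 := by
  have key : ∑ u : Fˣ, T (u : F) ^ k = ∑ u : F, (T ^ k) u := by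
    rw [← sum_units_eq_sum (fun x => (T ^ k) x) (MulChar.map_zero _)]
    refine Finset.sum_congr rfl fun u _ => ?_
    simpa using (T.zpow_apply_units k u).symm
  rw [key]
  split_ifs with h
  · rw [← orderOf_generator hT, orderOf_dvd_iff_pow_eq_one] at h
    rw [h, MulChar.sum_one_eq_card_units, Fintype.card_units, Nat.cast_sub Fintype.card_pos]
    simp
  · rw [← orderOf_generator hT, orderOf_dvd_iff_pow_eq_one] at h
    exact MulChar.sum_eq_zero_of_ne_one h

theorem sum_comp_cube {F : Type*} [Field F] [Fintype F] [DecidableEq F]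
    {T : MulChar F ℂ} (hT : ∀ χ : MulChar F ℂ, χ ∈ Subgroup.zpowers T)
    {m : ℕ} (hm : Fintype.card F - 1 = 3 * m) (g : Fˣ → ℂ) :
    ∑ x : Fˣ, g (x ^ 3) =
      ∑ s : Fˣ, (1 + T (s : F) ^ (-(m : ℤ)) + T (s : F) ^ (-(2 * m : ℤ))) * g s := by
  have hm0 : 0 < m := by
    have := Fintype.one_lt_card (α := F)
    omega
  have hN : (Fintype.card F : ℂ) - 1 = 3 * m := by
    have := Fintype.card_pos (α := F)
    have h : Fintype.card F = 3 * m + 1 := by omega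
    rw [h]; push_cast; ring
  have hN0 : (3 * m : ℂ) ≠ 0 := by exact_mod_cast (by omega : 3 * m ≠ 0)
  have count : ∀ s : Fˣ, ∑ x : Fˣ, (if x ^ 3 = s then (3 * m : ℂ) else 0) =
      3 * m * (1 + T (s : F) ^ (-(m : ℤ)) + T (s : F) ^ (-(2 * m : ℤ))) := by
    intro s
    have h1 : ∀ x : Fˣ, (if x ^ 3 = s then (3 * m : ℂ) else 0) =
        ∑ l ∈ Finset.range (3 * m), T (s : F) ^ (-(l : ℤ)) * T (x : F) ^ (3 * l) := by
      intro x
      have h := sum_range_generator_pow hT (x ^ 3 * s⁻¹)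
      rw [hN, hm] at h
      simp only [mul_inv_eq_one] at h
      rw [← h]
      refine Finset.sum_congr rfl fun l _ => ?_
      rw [Units.val_mul, map_mul, T.apply_units_inv, Units.val_pow_eq_pow_val, map_pow, mul_zpow,
        inv_zpow', pow_mul, zpow_natCast, mul_comm]
    simp_rw [h1]
    rw [Finset.sum_comm]
    simp_rw [← Finset.mul_sum, sum_units_generator_pow hT, hN, hm,
      Nat.mul_dvd_mul_iff_left (show 0 < 3 by norm_num)]
    have h3 : (Finset.range (3 * m)).filter (m ∣ ·) = {0, m, 2 * m} := by
      ext l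
      simp only [Finset.mem_filter, Finset.mem_range, Finset.mem_insert, Finset.mem_singleton]
      constructor
      · rintro ⟨hl, k, rfl⟩
        have : k < 3 := by nlinarith
        interval_cases k <;> simp [mul_comm]
      · rintro (rfl | rfl | rfl)
        · simp [hm0]
        · exact ⟨by omega, dvd_rfl⟩
        · exact ⟨by omega, dvd_mul_left _ _⟩
    simp_rw [mul_ite, mul_zero]
    rw [← Finset.sum_filter, h3, Finset.sum_insert (by simp; omega),
      Finset.sum_insert (by simp; omega), Finset.sum_singleton]
    push_cast
    simp
    ring
  have h4 : ∀ x : Fˣ, (3 * m : ℂ) * g (x ^ 3) =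
      ∑ s : Fˣ, (if x ^ 3 = s then (3 * m : ℂ) else 0) * g s := by
    intro x
    simp [ite_mul]
  apply mul_left_cancel₀ hN0
  rw [Finset.mul_sum, Finset.sum_congr rfl fun x _ => h4 x, Finset.sum_comm, Finset.mul_sum]
  refine Finset.sum_congr rfl fun s _ => ?_
  rw [← Finset.sum_mul, count]
  ring

theorem sum_gaussSum_mul {F : Type*} [Field F] [Fintype F] [DecidableEq F]
    {T : MulChar F ℂ} (hT : ∀ χ : MulChar F ℂ, χ ∈ Subgroup.zpowers T) (ψ : AddChar F ℂ)
    (b c : ℤ) (d : Fˣ) :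
    ∑ l ∈ Finset.range (Fintype.card F - 1),
      gaussSum (T ^ (-(l : ℤ))) ψ * gaussSum (T ^ (-(l : ℤ) - b)) ψ *
        gaussSum (T ^ (-(l : ℤ) - c)) ψ * gaussSum (T ^ (3 * (l : ℤ))) ψ *
          (T ^ (-(3 * (l : ℤ)))) (d : F) =
      ((Fintype.card F : ℂ) - 1) * ∑ u : Fˣ, ∑ v : Fˣ, ∑ t : Fˣ,
        T (v : F) ^ (-b) * T ((t ^ 3 / (u * v) : Fˣ) : F) ^ (-c) *
          ψ (u + v + (t ^ 3 / (u * v) : Fˣ) + d * t) := by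
  have h1 : ∀ l : ℕ, gaussSum (T ^ (-(l : ℤ))) ψ * gaussSum (T ^ (-(l : ℤ) - b)) ψ *
        gaussSum (T ^ (-(l : ℤ) - c)) ψ * gaussSum (T ^ (3 * (l : ℤ))) ψ *
          (T ^ (-(3 * (l : ℤ)))) (d : F) =
      ∑ u : Fˣ, ∑ v : Fˣ, ∑ t : Fˣ, ∑ w : Fˣ, T ((t ^ 3 / (u * v) / w : Fˣ) : F) ^ (l : ℤ) *
        (T (v : F) ^ (-b) * T (w : F) ^ (-c) * ψ (u + v + w + d * t)) := by
    intro l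
    rw [mul_assoc, gaussSum_zpow_mul_zpow_neg]
    simp_rw [gaussSum_eq_sum_units, MulChar.zpow_apply_units]
    rw [Finset.sum_mul_sum, Finset.sum_mul, Finset.sum_mul]
    refine Finset.sum_congr rfl fun u _ => ?_
    rw [Finset.sum_mul, Finset.sum_mul]
    refine Finset.sum_congr rfl fun v _ => ?_
    rw [mul_assoc, Finset.sum_mul_sum, Finset.mul_sum]
    simp_rw [Finset.mul_sum]
    rw [Finset.sum_comm]
    refine Finset.sum_congr rfl fun t _ => Finset.sum_congr rfl fun w _ => ?_
    have hu := T.apply_units_ne_zero u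
    have hv := T.apply_units_ne_zero v
    have hw := T.apply_units_ne_zero w
    simp only [AddChar.map_add_eq_mul, sub_eq_add_neg, zpow_add₀ hv, zpow_add₀ hw, zpow_neg,
      MulChar.apply_units_div, Units.val_mul, Units.val_pow_eq_pow_val, map_mul, map_pow,
      div_pow, mul_pow, zpow_mul, zpow_natCast, zpow_ofNat]
    field_simp
  simp_rw [h1]
  rw [Finset.sum_comm, Finset.mul_sum]
  refine Finset.sum_congr rfl fun u _ => ?_
  rw [Finset.sum_comm, Finset.mul_sum]
  refine Finset.sum_congr rfl fun v _ => ?_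
  rw [Finset.sum_comm, Finset.mul_sum]
  refine Finset.sum_congr rfl fun t _ => ?_
  rw [Finset.sum_comm]
  simp_rw [← Finset.sum_mul, sum_range_generator_pow hT, div_eq_one]
  simp [ite_mul]

theorem sum_hessian_eq {F : Type*} [Field F] [Fintype F] [DecidableEq F]
    {T : MulChar F ℂ} (hT : ∀ χ : MulChar F ℂ, χ ∈ Subgroup.zpowers T)
    {m : ℕ} (hm : Fintype.card F - 1 = 3 * m) (ψ : AddChar F ℂ) (d : Fˣ) :
    (∑ x : Fˣ, ∑ y : Fˣ, ∑ z : Fˣ,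
        ψ ((z : F) * (1 + (x : F) ^ 3 + (y : F) ^ 3 + d * (x : F) * (y : F)))) =
      ∑ u : Fˣ, ∑ v : Fˣ, ∑ t : Fˣ,
        (1 + T ((v / u : Fˣ) : F) ^ (-(m : ℤ)) + T ((v / u : Fˣ) : F) ^ (-(2 * m : ℤ))) *
          ψ (u + v + (t ^ 3 / (u * v) : Fˣ) + d * t) := by
  have h1 : ∀ x z : Fˣ, (∑ y : Fˣ,
        ψ ((z : F) * (1 + (x : F) ^ 3 + (y : F) ^ 3 + d * (x : F) * (y : F)))) =
      ∑ t : Fˣ, ψ (z + (z * x ^ 3 : Fˣ) + (t ^ 3 / (z * (z * x ^ 3)) : Fˣ) + d * t) := by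
    intro x z
    rw [← Equiv.sum_comp (Equiv.mulLeft (x * z)) (fun t : Fˣ =>
      ψ (z + (z * x ^ 3 : Fˣ) + (t ^ 3 / (z * (z * x ^ 3)) : Fˣ) + d * t))]
    refine Finset.sum_congr rfl fun y _ => congrArg ψ ?_
    simp only [Equiv.coe_mulLeft, Units.val_div_eq_div_val, Units.val_mul, Units.val_pow_eq_pow_val]
    have hx := x.ne_zero
    have hz := z.ne_zero
    field_simp
  calc _ = ∑ z : Fˣ, ∑ x : Fˣ, ∑ y : Fˣ,
        ψ ((z : F) * (1 + (x : F) ^ 3 + (y : F) ^ 3 + d * (x : F) * (y : F))) := by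
        rw [Finset.sum_comm]
        conv_rhs => rw [Finset.sum_comm]
        rw [Finset.sum_comm]
        exact Finset.sum_congr rfl fun x _ => Finset.sum_comm
    _ = _ := Finset.sum_congr rfl fun z _ => by
        simp_rw [h1]
        rw [sum_comp_cube hT hm (fun s => ∑ t : Fˣ,
            ψ (z + (z * s : Fˣ) + (t ^ 3 / (z * (z * s)) : Fˣ) + d * t)),
          ← Equiv.sum_comp (Equiv.mulLeft z) (fun v : Fˣ => ∑ t : Fˣ,
            (1 + T ((v / z : Fˣ) : F) ^ (-(m : ℤ)) + T ((v / z : Fˣ) : F) ^ (-(2 * m : ℤ))) *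
              ψ (z + v + (t ^ 3 / (z * v) : Fˣ) + d * t))]
        refine Finset.sum_congr rfl fun s _ => ?_
        rw [Finset.mul_sum]
        simp only [Equiv.coe_mulLeft, mul_div_cancel_left]

theorem MulChar.apply_units_pow_eq_one {F : Type*} [Field F] [Fintype F] [DecidableEq F]
    (T : MulChar F ℂ) {m : ℕ} (hm : Fintype.card F - 1 = 3 * m) (u : Fˣ) :
    T (u : F) ^ (m * 3) = 1 := by
  rw [mul_comm, ← hm, ← Fintype.card_units (α := F), ← map_pow, ← Units.val_pow_eq_pow_val,
    pow_card_eq_one]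
  simp

/-- For `q ≡ 1 (mod 3)` and `a ∈ F_q^×`:
`Σ_{x,y,z ∈ F_q^×} ψ(z(1 + x³ + y³ − 3axy))
  = (1/(q−1)) Σ_{l=0}^{q−2} G_{−l}³ G_{3l} T^{−3l}(−3a)
    + (2/(q−1)) Σ_{l=0}^{q−2} G_{−l} G_{−l−(q−1)/3} G_{−l−2(q−1)/3} G_{3l} T^{−3l}(−3a)`. -/
theorem sum_hessian_char_three_dvd
    (p r : ℕ) (hp : p.Prime) (hp3 : 3 < p) (hr : 0 < r)
    (F : Type) [Field F] [Fintype F] [DecidableEq F] (hcard : Fintype.card F = p ^ r)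
    (ψ : AddChar F ℂ) (hψ : ψ ≠ 1)
    (T : MulChar F ℂ) (hT : ∀ χ : MulChar F ℂ, χ ∈ Subgroup.zpowers T)
    (hq3 : p ^ r % 3 = 1)
    (a : F) (ha : a ≠ 0) :
    (∑ x : Fˣ, ∑ y : Fˣ, ∑ z : Fˣ,
        ψ ((z : F) * (1 + (x : F) ^ 3 + (y : F) ^ 3 - 3 * a * (x : F) * (y : F))))
      = (1 / ((p : ℂ) ^ r - 1)) *
          ∑ l ∈ Finset.range (p ^ r - 1),
            (gaussSum (T ^ (-(l : ℤ))) ψ) ^ 3 * gaussSum (T ^ (3 * (l : ℤ))) ψ *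
              (T ^ (-(3 * (l : ℤ)))) (-3 * a)
        + (2 / ((p : ℂ) ^ r - 1)) *
          ∑ l ∈ Finset.range (p ^ r - 1),
            gaussSum (T ^ (-(l : ℤ))) ψ *
              gaussSum (T ^ (-(l : ℤ) - ((p ^ r - 1) / 3 : ℕ))) ψ *
              gaussSum (T ^ (-(l : ℤ) - 2 * ((p ^ r - 1) / 3 : ℕ))) ψ *
              gaussSum (T ^ (3 * (l : ℤ))) ψ * (T ^ (-(3 * (l : ℤ)))) (-3 * a) := by
  have hq : p ^ r = 3 * ((p ^ r - 1) / 3) + 1 := by omega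
  set m := (p ^ r - 1) / 3
  have hm : Fintype.card F - 1 = 3 * m := by omega
  have h3 : (3 : F) ≠ 0 := by
    intro h3
    have h := FiniteField.cast_card_eq_zero F
    rw [hcard, hq] at h
    simp [h3] at h
  have hd0 : -3 * a ≠ 0 := mul_ne_zero (neg_ne_zero.mpr h3) ha
  obtain ⟨d, hd⟩ : ∃ d : Fˣ, (d : F) = -3 * a := ⟨Units.mk0 _ hd0, rfl⟩
  have hN : (Fintype.card F : ℂ) - 1 = (p : ℂ) ^ r - 1 := by rw [hcard]; push_cast; rfl
  have hN0 : (p : ℂ) ^ r - 1 ≠ 0 := by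
    rw [sub_ne_zero]
    exact_mod_cast (Nat.one_lt_pow hr.ne' hp.one_lt).ne'
  have hL : (∑ x : Fˣ, ∑ y : Fˣ, ∑ z : Fˣ,
        ψ ((z : F) * (1 + (x : F) ^ 3 + (y : F) ^ 3 - 3 * a * (x : F) * (y : F)))) =
      ∑ x : Fˣ, ∑ y : Fˣ, ∑ z : Fˣ,
        ψ ((z : F) * (1 + (x : F) ^ 3 + (y : F) ^ 3 + d * (x : F) * (y : F))) := by
    simp only [hd, neg_mul, ← sub_eq_add_neg]
  have e1 := sum_gaussSum_mul hT ψ 0 0 d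
  have e2 := sum_gaussSum_mul hT ψ m (2 * m) d
  rw [hN, hcard] at e1 e2
  rw [hL, sum_hessian_eq hT hm]
  simp only [sub_zero, neg_zero, zpow_zero, one_mul] at e1
  have f1 : ∀ l ∈ Finset.range (p ^ r - 1), (gaussSum (T ^ (-(l : ℤ))) ψ) ^ 3 *
      gaussSum (T ^ (3 * (l : ℤ))) ψ * (T ^ (-(3 * (l : ℤ)))) (-3 * a) =
      gaussSum (T ^ (-(l : ℤ))) ψ * gaussSum (T ^ (-(l : ℤ))) ψ * gaussSum (T ^ (-(l : ℤ))) ψ *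
      gaussSum (T ^ (3 * (l : ℤ))) ψ * (T ^ (-(3 * (l : ℤ)))) (-3 * a) := fun l _ => by ring
  rw [Finset.sum_congr rfl f1, ← hd, e1, e2, ← mul_assoc, ← mul_assoc,
    one_div_mul_cancel hN0, div_mul_cancel₀ _ hN0, one_mul]
  have g1 : ∀ u v t : Fˣ, T (v : F) ^ (-(m : ℤ)) *
      T ((t ^ 3 / (u * v) : Fˣ) : F) ^ (-(2 * m : ℤ)) =
      T ((v / u : Fˣ) : F) ^ (-(2 * m : ℤ)) := by
    intro u v t
    have hu := T.apply_units_ne_zero u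
    have hv := T.apply_units_ne_zero v
    have hv3 := MulChar.apply_units_pow_eq_one T hm v
    have ht3 := MulChar.apply_units_pow_eq_one T hm t
    rw [pow_mul] at hv3 ht3
    simp only [MulChar.apply_units_div, Units.val_mul, Units.val_pow_eq_pow_val, map_mul,
      map_pow, mul_comm (2 : ℤ), zpow_neg, zpow_mul, zpow_natCast, zpow_ofNat, div_pow, mul_pow]
    rw [pow_right_comm _ 3 m, ht3]
    field_simp
    exact hv3
  have g2 : ∀ u v : Fˣ, T ((v / u : Fˣ) : F) ^ (-(m : ℤ)) =
      T ((u / v : Fˣ) : F) ^ (-(2 * m : ℤ)) := by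
    intro u v
    have hu := T.apply_units_ne_zero (v / u)
    have h3 := MulChar.apply_units_pow_eq_one T hm (v / u)
    rw [← inv_div v u, T.apply_units_inv, inv_zpow', neg_neg,
      zpow_neg]
    refine inv_eq_of_mul_eq_one_right ?_
    rw [← zpow_add₀ hu, ← h3, ← zpow_natCast]
    congr 1
    push_cast
    ring
  have swap : (∑ u : Fˣ, ∑ v : Fˣ, ∑ t : Fˣ, T ((v / u : Fˣ) : F) ^ (-(m : ℤ)) *
        ψ (u + v + (t ^ 3 / (u * v) : Fˣ) + d * t)) =
      ∑ u : Fˣ, ∑ v : Fˣ, ∑ t : Fˣ, T ((v / u : Fˣ) : F) ^ (-(2 * m : ℤ)) *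
        ψ (u + v + (t ^ 3 / (u * v) : Fˣ) + d * t) := by
    rw [Finset.sum_comm]
    refine Finset.sum_congr rfl fun u _ => Finset.sum_congr rfl fun v _ =>
      Finset.sum_congr rfl fun t _ => ?_
    rw [g2, mul_comm v u, add_comm (v : F) u]
  simp_rw [g1, add_mul, one_mul, Finset.sum_add_distrib]
  rw [swap]
  ring
end

section
/- Let p > 3 be a prime, q = p^r with q ≡ 1 (mod 3), and let a ∈ F_q^× with a³ ≠ 1. Then (2/(q−1)) Σ_{l=0}^{q−2} G_{−l} G_{−l−(q−1)/3} G_{−l−2(q−1)/3} G_{3l} T^{−3l}(−3a) = −6q·φ(−3), as an identity of complex numbers (indices of G and exponents of T are taken modulo q−1). -/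
section Cubic

variable {F : Type*} [Field F]

lemma exists_cube_eq_of_mul_mul_eq_one {y z : F} (h : y * z * (3 - y - z) = 1) :
    ∃ c : F, c ≠ 0 ∧ y * z ^ 2 = c ^ 3 := by
  have hy : y ≠ 0 := by rintro rfl; simp at h
  have hz : z ≠ 0 := by rintro rfl; simp at h
  by_cases hs : y + z - 2 = 0
  · have h1 : (y - 1) ^ 2 = 0 := by
      obtain rfl : z = 2 - y := by linear_combination hs
      linear_combination -h
    have h2 : y = 1 := by linear_combination pow_eq_zero_iff two_ne_zero |>.1 h1
    subst h2
    exact ⟨1, one_ne_zero, by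
      obtain rfl : z = 1 := by linear_combination hs
      ring⟩
  · have key : y * z ^ 2 = (-(z - 1) / (y + z - 2)) ^ 3 := by
      field_simp
      linear_combination (-(z - 1) + z * (y + z - 2) * (y - 1) * (z - 1) -
        y * z ^ 2 * (y + z - 2)) * h
    refine ⟨_, ?_, key⟩
    intro h0
    rw [h0] at key
    simp [hy, hz] at key

lemma card_cubic_points [Fintype F] [DecidableEq F] (h3 : (3 : F) ≠ 0) {ζ : F}
    (hζ : ζ ^ 2 + ζ + 1 = 0) :
    (Finset.univ.filter fun w : F × F ↦ w.1 * w.2 * (3 - w.1 - w.2) = 1).card + 3 =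
      Fintype.card F := by
  have hbad : ({0, -1, ζ, ζ ^ 2} : Finset F).card = 4 := by
    have h0 : ζ ≠ 0 := by rintro rfl; simp at hζ
    have h1 : ζ ≠ 1 := by rintro rfl; exact h3 (by linear_combination hζ)
    have h2 : ζ ≠ -1 := by rintro rfl; simp at hζ
    have h4 : ζ ≠ ζ ^ 2 := fun h ↦ h1 (mul_left_cancel₀ h0 (by linear_combination -h))
    have h5 : (-1 : F) ≠ ζ ^ 2 := fun h ↦ h0 (by linear_combination hζ + h)
    have h6 : (0 : F) ≠ ζ ^ 2 := (pow_ne_zero 2 h0).symm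
    have h7 : (-1 : F) ≠ 0 := by simp
    simp [h0.symm, h2.symm, h4, h5, h6, h7.symm]
  have hbij : ((Finset.univ.filter fun w : F × F ↦ w.1 * w.2 * (3 - w.1 - w.2) = 1).erase
      (1, 1)).card = (({0, -1, ζ, ζ ^ 2} : Finset F)ᶜ).card := by
    have hy1 {y z : F} (h : y * z * (3 - y - z) = 1) (hne : ¬ (y = 1 ∧ z = 1)) :
        y - 1 ≠ 0 := by
      intro hy
      obtain rfl : y = 1 := sub_eq_zero.1 hy
      have : (z - 1) ^ 2 = 0 := by linear_combination -h
      exact hne ⟨rfl, sub_eq_zero.1 (pow_eq_zero_iff two_ne_zero |>.1 this)⟩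
    have hbad' {m : F} : m ∈ ({0, -1, ζ, ζ ^ 2} : Finset F)ᶜ ↔
        m ≠ 0 ∧ 1 + m ≠ 0 ∧ 1 + m + m ^ 2 ≠ 0 := by
      have hfac : 1 + m + m ^ 2 = (m - ζ) * (m - ζ ^ 2) := by
        linear_combination (1 + m - ζ) * hζ
      rw [hfac, mul_ne_zero_iff, sub_ne_zero, sub_ne_zero, Ne, Ne, add_comm, add_eq_zero_iff_eq_neg]
      simp
    have hmem {y z : F} : (y, z) ∈ (Finset.univ.filter fun w : F × F ↦
        w.1 * w.2 * (3 - w.1 - w.2) = 1).erase (1, 1) ↔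
        ¬ (y = 1 ∧ z = 1) ∧ y * z * (3 - y - z) = 1 := by
      simp
    have hslope {y z : F} (h : y * z * (3 - y - z) = 1) (hne : ¬ (y = 1 ∧ z = 1)) :
        z - 1 ≠ 0 ∧ y + z - 2 ≠ 0 := by
      have hy := hy1 h hne
      constructor
      · intro hz
        refine hy (pow_eq_zero_iff two_ne_zero |>.1 ?_)
        obtain rfl : z = 1 := sub_eq_zero.1 hz
        linear_combination -h
      · intro hs
        refine hy (pow_eq_zero_iff two_ne_zero |>.1 ?_)
        obtain rfl : z = 2 - y := by linear_combination hs
        linear_combination -h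
    refine Finset.card_nbij' (fun w ↦ (w.2 - 1) / (w.1 - 1))
      (fun m ↦ (-1 / (m * (1 + m)), -m ^ 2 / (1 + m))) ?_ ?_ ?_ ?_
    · rintro ⟨y, z⟩ hw
      obtain ⟨hne, h⟩ := hmem.1 hw
      have hy := hy1 h hne
      obtain ⟨hz, hs⟩ := hslope h hne
      refine hbad'.2 ⟨div_ne_zero hz hy, ?_, ?_⟩
      · rw [show 1 + (z - 1) / (y - 1) = (y + z - 2) / (y - 1) by field_simp; ring]
        exact div_ne_zero hs hy
      · rw [show 1 + (z - 1) / (y - 1) + ((z - 1) / (y - 1)) ^ 2 =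
          -((y - 1) * (z - 1) * (y + z - 2)) / (y - 1) ^ 2 by
            field_simp; linear_combination -h]
        exact div_ne_zero (neg_ne_zero.2 (mul_ne_zero (mul_ne_zero hy hz) hs)) (pow_ne_zero 2 hy)
    · intro m hm
      obtain ⟨h0, h1, h2⟩ := hbad'.1 hm
      refine hmem.2 ⟨?_, ?_⟩
      · rintro ⟨h, -⟩
        rw [div_eq_one_iff_eq (mul_ne_zero h0 h1)] at h
        exact h2 (by linear_combination -h)
      · field_simp
        ring
    · rintro ⟨y, z⟩ hw
      obtain ⟨hne, h⟩ := hmem.1 hw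
      have hy := hy1 h hne
      obtain ⟨hz, hs⟩ := hslope h hne
      have hm : 1 + (z - 1) / (y - 1) = (y + z - 2) / (y - 1) := by field_simp; ring
      simp only [hm, Prod.mk.injEq]
      constructor
      · field_simp
        linear_combination h
      · field_simp
        linear_combination h
    · intro m hm
      obtain ⟨h0, h1, h2⟩ := hbad'.1 hm
      have hy : -1 / (m * (1 + m)) - 1 = -(1 + m + m ^ 2) / (m * (1 + m)) := by field_simp; ring
      have hz : -m ^ 2 / (1 + m) - 1 = -(1 + m + m ^ 2) / (1 + m) := by field_simp; ring
      simp only [hy, hz]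
      have h2' : -(1 + m + m ^ 2) ≠ 0 := neg_ne_zero.2 h2
      field_simp
  rw [Finset.card_erase_of_mem (by simp; norm_num), Finset.card_compl, hbad] at hbij
  have : 0 < (Finset.univ.filter fun w : F × F ↦ w.1 * w.2 * (3 - w.1 - w.2) = 1).card :=
    Finset.card_pos.2 ⟨(1, 1), by simp; norm_num⟩
  have : 4 ≤ Fintype.card F := hbad ▸ Finset.card_le_univ _
  omega

end Cubic

section Orthogonality

variable {F : Type*} [Field F] [Fintype F]

lemma MulChar.sum_apply_eq_ite [Fintype (MulChar F ℂ)] [DecidableEq F] (x : F) :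
    ∑ χ : MulChar F ℂ, χ x = if x = 1 then ((Fintype.card F : ℂ) - 1) else 0 := by
  split_ifs with h
  · subst h
    have := MulChar.card_eq_card_units_of_hasEnoughRootsOfUnity F ℂ
    rw [Nat.card_eq_fintype_card, Nat.card_eq_fintype_card, Fintype.card_units] at this
    simp [this, Nat.cast_sub Fintype.card_pos]
  · obtain ⟨χ, hχ⟩ := MulChar.exists_apply_ne_one_of_hasEnoughRootsOfUnity F ℂ h
    refine eq_zero_of_mul_eq_self_left hχ ?_
    simp only [Finset.mul_sum, ← MulChar.mul_apply]
    exact Fintype.sum_bijective _ (Group.mulLeft_bijective χ) _ _ fun χ' ↦ rfl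

lemma norm_gaussSum_sq {χ : MulChar F ℂ} (hχ : χ ≠ 1) {ψ : AddChar F ℂ} (hψ : ψ ≠ 1) :
    ‖gaussSum χ ψ‖ ^ 2 = Fintype.card F := by
  have h := gaussSum_mul_gaussSum_eq_card hχ (AddChar.IsPrimitive.of_ne_one hψ)
  rw [← star_gaussSum_eq] at h
  have h2 := Complex.mul_conj' (gaussSum χ ψ)
  rw [starRingEnd_apply, h] at h2
  exact_mod_cast h2.symm

end Orthogonality

lemma IsCyclic.filter_pow_three_eq_one {G : Type*} [CommGroup G] [Fintype G]
    [DecidableEq G] [IsCyclic G] {g : G} (hg3 : g ^ 3 = 1) (hg : g ≠ 1) :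
    ({1, g, g ^ 2} : Finset G).card = 3 ∧
      (Finset.univ.filter fun x : G ↦ x ^ 3 = 1) = {1, g, g ^ 2} := by
  have h2 : g ^ 2 ≠ 1 := fun h ↦ hg (by rw [← hg3, pow_succ, h, one_mul])
  have h1 : g ≠ g ^ 2 := fun h ↦ hg (by simpa [sq] using h)
  have hcard : ({1, g, g ^ 2} : Finset G).card = 3 :=
    Finset.card_eq_three.2 ⟨_, _, _, hg.symm, h2.symm, h1, rfl⟩
  refine ⟨hcard, (Finset.eq_of_subset_of_card_le ?_ ?_).symm⟩
  · intro x hx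
    simp only [Finset.mem_insert, Finset.mem_singleton] at hx
    rw [Finset.mem_filter]
    refine ⟨Finset.mem_univ _, ?_⟩
    rcases hx with rfl | rfl | rfl
    · exact one_pow 3
    · exact hg3
    · rw [pow_right_comm, hg3, one_pow]
  · rw [hcard]
    exact IsCyclic.card_pow_eq_one_le three_pos

/-- The product of Gauss sums whose value is the Hasse–Davenport relation for a cubic character. -/
noncomputable def cubicGaussProduct {F : Type*} [Field F] [Fintype F] (ω : MulChar F ℂ)
    (ψ : AddChar F ℂ) (χ : MulChar F ℂ) : ℂ :=
  gaussSum χ ψ * gaussSum (χ * ω) ψ * gaussSum (χ * ω ^ 2) ψ * gaussSum (χ⁻¹ ^ 3) ψ *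
    (χ ^ 3) (-3)

section Product

variable {F : Type*} [Field F] [Fintype F] {ω : MulChar F ℂ} {ψ : AddChar F ℂ}

lemma norm_cubicGaussProduct (h3 : (3 : F) ≠ 0) (hω3 : ω ^ 3 = 1) (hψ : ψ ≠ 1)
    {χ : MulChar F ℂ} (hχ : χ ^ 3 ≠ 1) :
    ‖cubicGaussProduct ω ψ χ‖ = (Fintype.card F : ℝ) ^ 2 := by
  have h1 : χ ≠ 1 := by rintro rfl; simp at hχ
  have h2 : χ * ω ≠ 1 := fun h ↦ hχ (calc
    χ ^ 3 = (χ * ω) ^ 3 := by rw [mul_pow, hω3, mul_one]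
    _ = 1 := by rw [h, one_pow])
  have h4 : χ * ω ^ 2 ≠ 1 := fun h ↦ hχ (calc
    χ ^ 3 = (χ * ω ^ 2) ^ 3 := by rw [mul_pow, pow_right_comm, hω3, one_pow, mul_one]
    _ = 1 := by rw [h, one_pow])
  have h5 : χ⁻¹ ^ 3 ≠ 1 := by rwa [inv_pow, Ne, inv_eq_one]
  have h6 : ‖(χ ^ 3) (-3)‖ = 1 := by
    refine Complex.norm_eq_one_of_pow_eq_one (n := Fintype.card F - 1) ?_
      (Nat.sub_ne_zero_of_lt Fintype.one_lt_card)
    rw [← map_pow, FiniteField.pow_card_sub_one_eq_one _ (by simpa using h3), map_one]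
  rw [← sq_eq_sq₀ (norm_nonneg _) (by positivity)]
  simp only [cubicGaussProduct, norm_mul, mul_pow, norm_gaussSum_sq h1 hψ, norm_gaussSum_sq h2 hψ,
    norm_gaussSum_sq h4 hψ, norm_gaussSum_sq h5 hψ, h6]
  ring

lemma gaussSum_mul_gaussSum_inv_of_pow_three (hω3 : ω ^ 3 = 1) (hω : ω ≠ 1) (hψ : ψ ≠ 1) :
    gaussSum ω ψ * gaussSum (ω ^ 2) ψ = Fintype.card F := by
  have h := gaussSum_mul_gaussSum_eq_card hω (AddChar.IsPrimitive.of_ne_one hψ)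
  have h1 : ω⁻¹ = ω ^ 2 := by rw [inv_eq_iff_mul_eq_one, ← hω3, pow_succ' ω 2]
  have h2 : (ω ^ 2) (-1) = 1 := by
    rw [MulChar.pow_apply' _ two_ne_zero, ← map_pow]; simp
  rw [← h, ← mul_gaussSum_inv_eq_gaussSum (ω ^ 2), h1, h2, one_mul]

lemma cubicGaussProduct_of_mem (h3 : (3 : F) ≠ 0) (hω3 : ω ^ 3 = 1) (hω : ω ≠ 1) (hψ : ψ ≠ 1)
    {χ : MulChar F ℂ} (hχ : χ = 1 ∨ χ = ω ∨ χ = ω ^ 2) :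
    cubicGaussProduct ω ψ χ = Fintype.card F := by
  have hG := gaussSum_mul_gaussSum_inv_of_pow_three hω3 hω hψ
  have hc : χ ^ 3 = 1 := by
    rcases hχ with rfl | rfl | rfl
    · simp
    · exact hω3
    · rw [← pow_mul, mul_comm, pow_mul, hω3, one_pow]
  have hu : (1 : MulChar F ℂ) (-3) = 1 := MulChar.one_apply (by simpa using h3)
  have e1 : ω * ω = ω ^ 2 := (sq ω).symm
  have e2 : ω * ω ^ 2 = 1 := by rw [← hω3, pow_succ' ω 2]
  have e3 : ω ^ 2 * ω = 1 := by rw [← hω3, pow_succ ω 2]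
  have e4 : ω ^ 2 * ω ^ 2 = ω := by
    rw [← pow_add, pow_succ ω 3, hω3, one_mul]
  rw [cubicGaussProduct, inv_pow, hc, inv_one, hu, gaussSum_one_left hψ, ← hG]
  rcases hχ with rfl | rfl | rfl
  · rw [one_mul, one_mul, gaussSum_one_left hψ]; ring
  · rw [e1, e2, gaussSum_one_left hψ]; ring
  · rw [e3, e4, gaussSum_one_left hψ]; ring

lemma cubicGaussProduct_eq_sum (h3 : (3 : F) ≠ 0) (hω3 : ω ^ 3 = 1) (hω : ω ≠ 1)
    (χ : MulChar F ℂ) :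
    cubicGaussProduct ω ψ χ = ∑ v : F, ψ (-3 * v) * (gaussSum χ (ψ.mulShift v) *
      gaussSum (χ * ω) (ψ.mulShift v) * gaussSum (χ * ω ^ 2) (ψ.mulShift v)) := by
  have hterm (v : F) : gaussSum χ (ψ.mulShift v) * gaussSum (χ * ω) (ψ.mulShift v) *
      gaussSum (χ * ω ^ 2) (ψ.mulShift v) = (χ⁻¹ ^ 3) v *
        (gaussSum χ ψ * gaussSum (χ * ω) ψ * gaussSum (χ * ω ^ 2) ψ) := by
    rcases eq_or_ne v 0 with rfl | hv
    · rw [MulChar.map_zero, zero_mul, AddChar.mulShift_zero]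
      by_cases h : χ = 1
      · rw [gaussSum_one_right (χ := χ * ω) (by simpa [h] using hω)]; ring
      · rw [gaussSum_one_right h]; ring
    · have hs (η : MulChar F ℂ) : gaussSum η (ψ.mulShift v) = η⁻¹ v * gaussSum η ψ :=
        gaussSum_mulShift_eq η ψ (Units.mk0 v hv)
      have hprod : χ⁻¹ ^ 3 = χ⁻¹ * (χ * ω)⁻¹ * (χ * ω ^ 2)⁻¹ := by
        have : χ * (χ * ω) * (χ * ω ^ 2) = χ ^ 3 * ω ^ 3 := by
          rw [pow_succ' ω 2, pow_succ χ 2, sq χ]; ac_rfl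
        rw [← mul_inv, ← mul_inv, this, hω3, mul_one, inv_pow]
      rw [hs, hs, hs, hprod, MulChar.mul_apply, MulChar.mul_apply]
      ring
  have h := gaussSum_mulShift_eq (χ⁻¹ ^ 3) ψ (Units.mk0 (-3 : F) (by simpa using h3))
  simp only [Units.val_mk0, inv_pow, inv_inv] at h
  simp only [hterm, cubicGaussProduct, inv_pow]
  rw [mul_assoc, mul_comm (gaussSum _ ψ) ((χ ^ 3) (-3)), ← h,
    gaussSum.eq_def _ (ψ.mulShift (-3)), Finset.mul_sum]
  refine Finset.sum_congr rfl fun v _ ↦ ?_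
  rw [AddChar.mulShift_apply]
  ring

lemma sum_cubicGaussProduct [Fintype (MulChar F ℂ)] (h3 : (3 : F) ≠ 0) (hω3 : ω ^ 3 = 1)
    (hω : ω ≠ 1) (hψ : ψ ≠ 1) {ζ : F} (hζ : ζ ^ 2 + ζ + 1 = 0) :
    ∑ χ : MulChar F ℂ, cubicGaussProduct ω ψ χ =
      (Fintype.card F : ℂ) * ((Fintype.card F : ℂ) - 1) * ((Fintype.card F : ℂ) - 3) := by
  classical
  have hprod (χ : MulChar F ℂ) (v : F) : gaussSum χ (ψ.mulShift v) *
      gaussSum (χ * ω) (ψ.mulShift v) * gaussSum (χ * ω ^ 2) (ψ.mulShift v) =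
      ∑ y, ∑ z, ∑ x, ω (y * z ^ 2) * χ (y * z * x) * ψ (v * (x + y + z)) := by
    rw [mul_comm (gaussSum χ _), mul_right_comm, gaussSum, gaussSum, gaussSum,
      Finset.sum_mul_sum, Finset.sum_mul]
    refine Finset.sum_congr rfl fun y _ ↦ ?_
    rw [Finset.sum_mul]
    refine Finset.sum_congr rfl fun z _ ↦ ?_
    rw [Finset.mul_sum]
    refine Finset.sum_congr rfl fun x _ ↦ ?_
    simp only [AddChar.mulShift_apply, mul_add, AddChar.map_add_eq_mul, map_mul, map_pow,
      MulChar.mul_apply, MulChar.pow_apply' _ two_ne_zero]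
    ring
  have hinner (y z x : F) : ∑ χ : MulChar F ℂ, ∑ v : F,
      ψ (-3 * v) * (ω (y * z ^ 2) * χ (y * z * x) * ψ (v * (x + y + z))) =
      if x = 3 - y - z then (if y * z * (3 - y - z) = 1 then
        (Fintype.card F : ℂ) * ((Fintype.card F : ℂ) - 1) else 0) else 0 := by
    have hv := AddChar.sum_mulShift (x + y + z - 3) (AddChar.IsPrimitive.of_ne_one hψ)
    have hχ := MulChar.sum_apply_eq_ite (y * z * x)
    have : ∑ χ : MulChar F ℂ, ∑ v : F,
        ψ (-3 * v) * (ω (y * z ^ 2) * χ (y * z * x) * ψ (v * (x + y + z))) =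
        ω (y * z ^ 2) * ((∑ χ : MulChar F ℂ, χ (y * z * x)) *
          ∑ v : F, ψ (v * (x + y + z - 3))) := by
      rw [Finset.sum_mul_sum, Finset.mul_sum]
      refine Finset.sum_congr rfl fun χ _ ↦ ?_
      rw [Finset.mul_sum]
      refine Finset.sum_congr rfl fun v _ ↦ ?_
      rw [show v * (x + y + z - 3) = -3 * v + v * (x + y + z) by ring, AddChar.map_add_eq_mul]
      ring
    rw [this, hv, hχ]
    by_cases hx : x = 3 - y - z
    · subst hx
      by_cases hc : y * z * (3 - y - z) = 1
      · obtain ⟨c, hc0, hc3⟩ := exists_cube_eq_of_mul_mul_eq_one hc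
        have : ω (y * z ^ 2) = 1 := by
          rw [hc3, map_pow, ← MulChar.pow_apply' _ three_ne_zero, hω3,
            MulChar.one_apply hc0.isUnit]
        rw [this, if_pos hc, if_pos (by ring), if_pos rfl, if_pos hc]
        ring
      · simp [hc]
    · have : x + y + z - 3 ≠ 0 := fun h ↦ hx (by linear_combination h)
      simp [this, hx]
  simp only [cubicGaussProduct_eq_sum h3 hω3 hω, hprod, Finset.mul_sum]
  have hswap : ∑ χ : MulChar F ℂ, ∑ v, ∑ y, ∑ z, ∑ x,
      ψ (-3 * v) * (ω (y * z ^ 2) * χ (y * z * x) * ψ (v * (x + y + z))) =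
      ∑ y, ∑ z, ∑ x, ∑ χ : MulChar F ℂ, ∑ v,
      ψ (-3 * v) * (ω (y * z ^ 2) * χ (y * z * x) * ψ (v * (x + y + z))) := by
    have hstep (g : MulChar F ℂ → F → F → ℂ) : ∑ χ, ∑ v, ∑ y, g χ v y = ∑ y, ∑ χ, ∑ v, g χ v y :=
      (Finset.sum_congr rfl fun _ _ ↦ Finset.sum_comm).trans Finset.sum_comm
    exact (hstep _).trans <| Finset.sum_congr rfl fun y _ ↦ (hstep _).trans <|
      Finset.sum_congr rfl fun z _ ↦ hstep _
  rw [hswap]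
  simp only [hinner, Finset.sum_ite_eq', Finset.mem_univ, if_true]
  rw [← Fintype.sum_prod_type' (f := fun y z : F ↦ if y * z * (3 - y - z) = 1 then
        (Fintype.card F : ℂ) * ((Fintype.card F : ℂ) - 1) else 0), ← Finset.sum_filter,
        Finset.sum_const, nsmul_eq_mul, ← card_cubic_points h3 hζ]
  push_cast
  ring

lemma cubicGaussProduct_eq [Fintype (MulChar F ℂ)] [IsCyclic (MulChar F ℂ)] (h3 : (3 : F) ≠ 0)
    (hω3 : ω ^ 3 = 1) (hω : ω ≠ 1) (hψ : ψ ≠ 1) {ζ : F} (hζ : ζ ^ 2 + ζ + 1 = 0)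
    (χ : MulChar F ℂ) :
    cubicGaussProduct ω ψ χ =
      if χ ^ 3 = 1 then (Fintype.card F : ℂ) else (Fintype.card F : ℂ) ^ 2 := by
  classical
  obtain ⟨hcard, hfilter⟩ := IsCyclic.filter_pow_three_eq_one hω3 hω
  have htors {χ : MulChar F ℂ} (h : χ ^ 3 = 1) : cubicGaussProduct ω ψ χ = Fintype.card F := by
    refine cubicGaussProduct_of_mem h3 hω3 hω hψ ?_
    have : χ ∈ Finset.univ.filter fun χ : MulChar F ℂ ↦ χ ^ 3 = 1 := by simpa using h
    simpa [hfilter] using this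
  have hsum : ∑ χ : MulChar F ℂ, ((if χ ^ 3 = 1 then (Fintype.card F : ℝ) else
      (Fintype.card F : ℝ) ^ 2) - (cubicGaussProduct ω ψ χ).re) = 0 := by
    have hq := MulChar.sum_apply_eq_ite (1 : F)
    simp only [map_one, Finset.sum_const, nsmul_eq_mul, mul_one, if_true] at hq
    have hq' : ((Finset.univ : Finset (MulChar F ℂ)).card : ℝ) = Fintype.card F - 1 := by
      exact_mod_cast hq
    have hsplit := Finset.card_filter_add_card_filter_not (s := Finset.univ)
      (fun χ : MulChar F ℂ ↦ χ ^ 3 = 1)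
    have hU := congrArg Complex.re (sum_cubicGaussProduct h3 hω3 hω hψ hζ)
    rw [Finset.sum_sub_distrib, ← Complex.re_sum, hU, Finset.sum_ite, Finset.sum_const,
      Finset.sum_const, nsmul_eq_mul, nsmul_eq_mul]
    rw [hfilter, hcard] at *
    have hsplit' : (3 : ℝ) + ((Finset.univ.filter fun χ : MulChar F ℂ ↦ ¬ χ ^ 3 = 1).card : ℝ) =
        Fintype.card F - 1 := by
      rw [← hq']; exact_mod_cast hsplit
    rw [← eq_sub_iff_add_eq'] at hsplit'
    rw [hsplit']
    have : ((Fintype.card F : ℂ) * ((Fintype.card F : ℂ) - 1) * ((Fintype.card F : ℂ) - 3)) =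
      ((Fintype.card F * (Fintype.card F - 1) * (Fintype.card F - 3) : ℝ) : ℂ) := by push_cast; rfl
    rw [this, Complex.ofReal_re]
    push_cast
    ring
  have hle (χ : MulChar F ℂ) : 0 ≤ (if χ ^ 3 = 1 then (Fintype.card F : ℝ) else
      (Fintype.card F : ℝ) ^ 2) - (cubicGaussProduct ω ψ χ).re := by
    split_ifs with h
    · simp [htors h]
    · rw [← norm_cubicGaussProduct h3 hω3 hψ h]
      exact sub_nonneg.2 (Complex.re_le_norm _)
  split_ifs with h
  · exact htors h
  · have hre := (Finset.sum_eq_zero_iff_of_nonneg fun χ _ ↦ hle χ).1 hsum χ (Finset.mem_univ _)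
    rw [if_neg h, sub_eq_zero, ← norm_cubicGaussProduct h3 hω3 hψ h] at hre
    have h0 := Complex.re_eq_norm.1 hre.symm
    rw [← Complex.re_add_im (cubicGaussProduct ω ψ χ), ← hre, ← (Complex.nonneg_iff.1 h0).2,
      norm_cubicGaussProduct h3 hω3 hψ h]
    simp

lemma sum_cubicGaussProduct_mul_apply [Fintype (MulChar F ℂ)] [IsCyclic (MulChar F ℂ)]
    (h3 : (3 : F) ≠ 0) (hω3 : ω ^ 3 = 1) (hω : ω ≠ 1) (hψ : ψ ≠ 1) {ζ : F}
    (hζ : ζ ^ 2 + ζ + 1 = 0) {a : F} (ha : a ≠ 0) (ha3 : a ^ 3 ≠ 1) :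
    ∑ χ : MulChar F ℂ, cubicGaussProduct ω ψ χ * χ (a ^ 3) =
      -3 * (Fintype.card F : ℂ) * ((Fintype.card F : ℂ) - 1) := by
  classical
  obtain ⟨hcard, hfilter⟩ := IsCyclic.filter_pow_three_eq_one hω3 hω
  have hterm (χ : MulChar F ℂ) : cubicGaussProduct ω ψ χ * χ (a ^ 3) =
      (Fintype.card F : ℂ) ^ 2 * χ (a ^ 3) +
        if χ ^ 3 = 1 then (Fintype.card F : ℂ) - (Fintype.card F : ℂ) ^ 2 else 0 := by
    rw [cubicGaussProduct_eq h3 hω3 hω hψ hζ]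
    split_ifs with h
    · rw [map_pow, ← MulChar.pow_apply' _ three_ne_zero, h, MulChar.one_apply ha.isUnit]
      ring
    · ring
  rw [Finset.sum_congr rfl fun χ _ ↦ hterm χ, Finset.sum_add_distrib, ← Finset.mul_sum,
    MulChar.sum_apply_eq_ite, if_neg ha3, ← Finset.sum_filter, hfilter, Finset.sum_const, hcard]
  simp only [nsmul_eq_mul]
  push_cast
  ring

end Product

section Generator

variable {F : Type*} [Field F] [Fintype F]

lemma MulChar.orderOf_eq_of_forall_mem_zpowers {T : MulChar F ℂ}
    (hT : ∀ χ : MulChar F ℂ, χ ∈ Subgroup.zpowers T) : orderOf T = Fintype.card F - 1 := by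
  classical
  rw [orderOf_eq_card_of_forall_mem_zpowers hT,
    MulChar.card_eq_card_units_of_hasEnoughRootsOfUnity F ℂ, Nat.card_eq_fintype_card,
    Fintype.card_units]

lemma sum_range_zpow_neg [Fintype (MulChar F ℂ)] {T : MulChar F ℂ}
    (hT : ∀ χ : MulChar F ℂ, χ ∈ Subgroup.zpowers T) (f : MulChar F ℂ → ℂ) :
    ∑ l ∈ Finset.range (Fintype.card F - 1), f (T ^ (-(l : ℤ))) = ∑ χ, f χ := by
  rw [← MulChar.orderOf_eq_of_forall_mem_zpowers hT]
  refine Finset.sum_nbij (fun l : ℕ ↦ T ^ (-(l : ℤ))) (by simp) ?_ ?_ (fun _ _ ↦ rfl)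
  · intro l hl l' hl' h
    simp only [zpow_neg, zpow_natCast, inv_inj] at h
    exact pow_injOn_Iio_orderOf (by simpa using hl) (by simpa using hl') h
  · intro χ _
    obtain ⟨m, rfl⟩ := hT χ
    have hpos : (0 : ℤ) < orderOf T := by exact_mod_cast orderOf_pos T
    have h0 := Int.emod_nonneg (-m) hpos.ne'
    have h1 := Int.emod_lt_of_pos (-m) hpos
    refine ⟨((-m) % orderOf T).toNat, by simp; omega, ?_⟩
    simp only [Int.toNat_of_nonneg h0]
    rw [zpow_neg, zpow_mod_orderOf, zpow_neg, inv_inv]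

end Generator



/-- For `q ≡ 1 (mod 3)` and `a ∈ F_q^×` with `a³ ≠ 1`:
`(2/(q−1)) Σ_{l=0}^{q−2} G_{−l} G_{−l−(q−1)/3} G_{−l−2(q−1)/3} G_{3l} T^{−3l}(−3a) = −6q·φ(−3)`,
where `φ = T^{(q−1)/2}` is the quadratic character. -/
theorem sum_gauss_products_eq_neg_six_q_phi
    (p r : ℕ) (hp : p.Prime) (hp3 : 3 < p) (hr : 0 < r)
    (F : Type) [Field F] [Fintype F] (hcard : Fintype.card F = p ^ r)
    (ψ : AddChar F ℂ) (hψ : ψ ≠ 1)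
    (T : MulChar F ℂ) (hT : ∀ χ : MulChar F ℂ, χ ∈ Subgroup.zpowers T)
    (hq3 : p ^ r % 3 = 1)
    (a : F) (ha : a ≠ 0) (ha3 : a ^ 3 ≠ 1) :
    (2 / ((p : ℂ) ^ r - 1)) *
        ∑ l ∈ Finset.range (p ^ r - 1),
          gaussSum (T ^ (-(l : ℤ))) ψ *
            gaussSum (T ^ (-(l : ℤ) - ((p ^ r - 1) / 3 : ℕ))) ψ *
            gaussSum (T ^ (-(l : ℤ) - 2 * ((p ^ r - 1) / 3 : ℕ))) ψ *
            gaussSum (T ^ (3 * (l : ℤ))) ψ * (T ^ (-(3 * (l : ℤ)))) (-3 * a)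
      = -6 * (p : ℂ) ^ r * (T ^ ((p ^ r - 1) / 2)) (-3 : F) := by
  classical
  have : Fact p.Prime := ⟨hp⟩
  have hchar : CharP F p := charP_of_card_eq_prime_pow hcard
  have h3 : (3 : F) ≠ 0 := by
    intro h
    have h' : ((3 : ℕ) : F) = 0 := by exact_mod_cast h
    rw [CharP.cast_eq_zero_iff F p] at h'
    exact absurd (Nat.le_of_dvd three_pos h') (by omega)
  have : Fintype (MulChar F ℂ) := Fintype.ofFinite _
  have : IsCyclic (MulChar F ℂ) := ⟨T, hT⟩
  have hord := MulChar.orderOf_eq_of_forall_mem_zpowers hT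
  have hodd : p ^ r % 2 = 1 :=
    Nat.odd_iff.1 ((hp.odd_of_ne_two (by omega)).pow)
  have hq : 1 < p ^ r := Nat.one_lt_pow hr.ne' hp.one_lt
  rw [hcard] at hord
  obtain ⟨ζ, hζ⟩ : ∃ ζ : F, ζ ^ 2 + ζ + 1 = 0 := by
    obtain ⟨u, hu⟩ := exists_prime_orderOf_dvd_card (G := Fˣ) 3
      (by rw [Fintype.card_units, hcard]; omega)
    refine ⟨u, ?_⟩
    have hu3 : (u : F) ^ 3 = 1 := by
      rw [← Units.val_pow_eq_pow_val, ← hu, pow_orderOf_eq_one, Units.val_one]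
    have hu1 : (u : F) - 1 ≠ 0 := by
      intro h
      have : u = 1 := Units.ext (sub_eq_zero.1 h)
      simp [this] at hu
    exact mul_left_cancel₀ hu1 (by linear_combination hu3)
  set k := (p ^ r - 1) / 3 with hk
  set ω : MulChar F ℂ := T ^ (-(k : ℤ)) with hωdef
  have hω3 : ω ^ 3 = 1 := by
    rw [hωdef, zpow_neg, zpow_natCast, inv_pow, ← pow_mul, show k * 3 = p ^ r - 1 by omega, ← hord,
      pow_orderOf_eq_one, inv_one]
  have hω : ω ≠ 1 := by
    rw [hωdef, zpow_neg, zpow_natCast, Ne, inv_eq_one]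
    intro h
    exact absurd (Nat.le_of_dvd (by omega) (orderOf_dvd_of_pow_eq_one h)) (by omega)
  have hφ : (T ^ ((p ^ r - 1) / 2)) (-3 : F) = 1 := by
    have hsq : (-3 : F) = (2 * ζ + 1) ^ 2 := by linear_combination -4 * hζ
    have hne : 2 * ζ + 1 ≠ 0 := by
      intro h
      rw [h] at hsq
      exact h3 (by linear_combination -hsq)
    rw [hsq, map_pow, ← MulChar.pow_apply' _ two_ne_zero, ← pow_mul,
      show (p ^ r - 1) / 2 * 2 = p ^ r - 1 by omega, ← hord, pow_orderOf_eq_one,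
      MulChar.one_apply hne.isUnit]
  have hmain := sum_cubicGaussProduct_mul_apply h3 hω3 hω hψ hζ ha ha3
  rw [← sum_range_zpow_neg hT, hcard, Nat.cast_pow] at hmain
  have hterm (l : ℕ) : gaussSum (T ^ (-(l : ℤ))) ψ * gaussSum (T ^ (-(l : ℤ) - (k : ℕ))) ψ *
      gaussSum (T ^ (-(l : ℤ) - 2 * (k : ℕ))) ψ * gaussSum (T ^ (3 * (l : ℤ))) ψ *
      (T ^ (-(3 * (l : ℤ)))) (-3 * a) =
      cubicGaussProduct ω ψ (T ^ (-(l : ℤ))) * (T ^ (-(l : ℤ))) (a ^ 3) := by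
    have e1 : T ^ (-(l : ℤ) - (k : ℕ)) = T ^ (-(l : ℤ)) * ω := by
      rw [hωdef, ← zpow_add, sub_eq_add_neg]
    have e2 : T ^ (-(l : ℤ) - 2 * (k : ℕ)) = T ^ (-(l : ℤ)) * ω ^ 2 := by
      rw [hωdef, ← zpow_natCast, ← zpow_mul, ← zpow_add]; congr 1; push_cast; ring
    have e3 : T ^ (3 * (l : ℤ)) = (T ^ (-(l : ℤ)))⁻¹ ^ 3 := by
      rw [← zpow_neg, ← zpow_natCast, ← zpow_mul]; congr 1; push_cast; ring
    have e4 : T ^ (-(3 * (l : ℤ))) = (T ^ (-(l : ℤ))) ^ 3 := by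
      rw [← zpow_natCast (T ^ (-(l : ℤ))), ← zpow_mul]; congr 1; push_cast; ring
    rw [e1, e2, e3, e4, cubicGaussProduct, map_mul, map_pow _ a,
      MulChar.pow_apply' _ three_ne_zero a]
    ring
  have hq0 : (p : ℂ) ^ r - 1 ≠ 0 := by
    rw [sub_ne_zero]
    exact_mod_cast hq.ne'
  rw [Finset.sum_congr rfl fun l _ ↦ hterm l, hmain, hφ]
  field_simp
  ring
end
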